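/- Let r ≥ 130 be an integer and let a ∈ (0, (r-129)/256). Then any linearly edge-reinforced random walk measure P on G_r with constant initial weights a started at 0 := (0,0) visits every vertex infinitely often with probability one; that is, P[for every v ∈ V_r the set {t ∈ ℕ₀ : X_t = v} is infinite] = 1. -/

import Mathlib

open MeasureTheory
open scoped ENNReal Classical

namespace ERRWZ2

/-- The vertex set `V_r` of the diluted lattice `G_r`. -/
def Vr (r : ℕ) : Set (ℤ × ℤ) := {x | (r : ℤ) ∣ x.1 ∨ (r : ℤ) ∣ x.2}

/-- The set `L_r = rℤ²` of four-way crossings. -/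
def Lr (r : ℕ) : Set (ℤ × ℤ) := {x | (r : ℤ) ∣ x.1 ∧ (r : ℤ) ∣ x.2}

/-- Maximum norm on `ℤ²`. -/
def linf (v : ℤ × ℤ) : ℤ := max |v.1| |v.2|

/-- Adjacency in `G_r`: both endpoints in `V_r` and Euclidean distance one. -/
def AdjG (r : ℕ) (u v : ℤ × ℤ) : Prop :=
  u ∈ Vr r ∧ v ∈ Vr r ∧ (u.1 - v.1) ^ 2 + (u.2 - v.2) ^ 2 = 1

/-- Weight at time `t` of the undirected edge `{x,y}` for the trajectory `u`. -/
noncomputable def wt (a : ℝ) (u : ℕ → ℤ × ℤ) (t : ℕ) (x y : ℤ × ℤ) : ℝ :=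
  a + (((Finset.range t).filter fun s =>
    (u s = x ∧ u (s + 1) = y) ∨ (u s = y ∧ u (s + 1) = x)).card : ℝ)

/-- Total weight at time `t` of all edges of `G_r` incident to the current position `u t`. -/
noncomputable def totWt (r : ℕ) (a : ℝ) (u : ℕ → ℤ × ℤ) (t : ℕ) : ℝ :=
  ∑ d ∈ ({(1, 0), (-1, 0), (0, 1), (0, -1)} : Finset (ℤ × ℤ)),
    if AdjG r (u t) (u t + d) then wt a u t (u t) (u t + d) else 0

/-- Hitting time `τ_A = inf{t ≥ 1 : X_t ∈ A}` (with value `⊤` if the set is never hit). -/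
noncomputable def tau (A : Set (ℤ × ℤ)) (X : ℕ → ℤ × ℤ) : ℕ∞ :=
  sInf ((fun t : ℕ => (t : ℕ∞)) '' {t : ℕ | 1 ≤ t ∧ X t ∈ A})

/-- `P` is a linearly edge-reinforced random walk on `G_r` with constant initial
weights `a`, started at `(0,0)`. -/
def IsERRW (r : ℕ) (a : ℝ) (P : Measure (ℕ → ℤ × ℤ)) : Prop :=
  IsProbabilityMeasure P ∧
    ∀ (n : ℕ) (u : ℕ → ℤ × ℤ),
      P {X | ∀ t ≤ n, X t = u t} =
        if u 0 = (0, 0) ∧ ∀ t < n, AdjG r (u t) (u (t + 1)) then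
          ENNReal.ofReal (∏ t ∈ Finset.range n, wt a u t (u t) (u (t + 1)) / totWt r a u t)
        else 0

/-- Lebesgue measure on the positive half-line. -/
noncomputable abbrev posVol : Measure ℝ := volume.restrict (Set.Ioi 0)

lemma lintegral_posVol_exp_subst {c : ℝ} (hc : 0 < c) (f : ℝ → ℝ≥0∞) :
    ∫⁻ t, f t ∂posVol = ∫⁻ x, ENNReal.ofReal (c * Real.exp x) * f (c * Real.exp x) := by
  have himg : (fun x => c * Real.exp x) '' Set.univ = Set.Ioi 0 := by
    ext t
    simp only [Set.image_univ, Set.mem_range, Set.mem_Ioi]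
    constructor
    · rintro ⟨x, rfl⟩; positivity
    · intro ht
      exact ⟨Real.log (t / c), by rw [Real.exp_log (by positivity)]; field_simp⟩
  have h := lintegral_image_eq_lintegral_abs_deriv_mul (s := Set.univ)
    (f := fun x => c * Real.exp x) (f' := fun x => c * Real.exp x) MeasurableSet.univ
    (fun x _ => ((Real.hasDerivAt_exp x).const_mul c).hasDerivWithinAt)
    (fun x _ y _ hxy => by
      have : c * Real.exp x = c * Real.exp y := hxy
      exact Real.exp_injective (mul_left_cancel₀ hc.ne' this)) f
  rw [himg] at h
  rw [h, Measure.restrict_univ]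
  refine lintegral_congr fun x => ?_
  rw [abs_of_pos (by positivity)]

lemma lintegral_sinh_subst (f : ℝ → ℝ≥0∞) :
    ∫⁻ u, f u = ∫⁻ x, ENNReal.ofReal (Real.cosh (x / 2) / 2) * f (Real.sinh (x / 2)) := by
  have himg : (fun x => Real.sinh (x / 2)) '' Set.univ = Set.univ := by
    rw [Set.image_univ, Set.range_eq_univ]
    intro y
    exact ⟨2 * Real.arsinh y, by simp [Real.sinh_arsinh]⟩
  have h := lintegral_image_eq_lintegral_abs_deriv_mul (s := Set.univ)
    (f := fun x => Real.sinh (x / 2)) (f' := fun x => Real.cosh (x / 2) * (1 / 2))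
    MeasurableSet.univ
    (fun x _ => by
      have := (Real.hasDerivAt_sinh (x / 2)).comp x ((hasDerivAt_id x).div_const 2)
      exact this.hasDerivWithinAt)
    (fun x _ y _ hxy => by
      have := Real.sinh_injective hxy
      linarith) f
  rw [himg, Measure.restrict_univ] at h
  rw [h]
  refine lintegral_congr fun x => ?_
  have := Real.cosh_pos (x / 2)
  rw [abs_of_pos (by positivity), mul_one_div]

/-- The Gamma integral with a rate parameter. -/
lemma lintegral_gamma {p c : ℝ} (hp : 0 < p) (hc : 0 < c) :
    ∫⁻ w, ENNReal.ofReal (w ^ (p - 1) * Real.exp (-(c * w))) ∂posVol =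
      ENNReal.ofReal (Real.Gamma p * c ^ (-p)) := by
  have h := Real.integral_rpow_mul_exp_neg_mul_Ioi hp hc
  have hval : (1 / c) ^ p * Real.Gamma p = Real.Gamma p * c ^ (-p) := by
    rw [one_div, Real.inv_rpow hc.le, Real.rpow_neg hc.le, mul_comm]
  have hpos : 0 < Real.Gamma p * c ^ (-p) :=
    mul_pos (Real.Gamma_pos_of_pos hp) (Real.rpow_pos_of_pos hc _)
  have hfi : Integrable (fun w : ℝ => w ^ (p - 1) * Real.exp (-(c * w))) posVol := by
    by_contra hni
    rw [integral_undef hni, hval] at h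
    exact hpos.ne h
  rw [← hval, ← h, ofReal_integral_eq_lintegral_ofReal hfi]
  refine (ae_restrict_mem measurableSet_Ioi).mono fun w hw => ?_
  have hw' : (0 : ℝ) < w := hw
  positivity

/-- The half-line Gaussian-type moment. -/
lemma lintegral_rpow_mul_exp_sq {q b : ℝ} (hq : -1 < q) (hb : 0 < b) :
    ∫⁻ w, ENNReal.ofReal (w ^ q * Real.exp (-(b * w ^ 2))) ∂posVol =
      ENNReal.ofReal (b ^ (-((q + 1) / 2)) * (1 / 2) * Real.Gamma ((q + 1) / 2)) := by
  have h := integral_rpow_mul_exp_neg_mul_rpow (p := 2) (q := q) (b := b) (by norm_num) hq hb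
  have hpos : 0 < b ^ (-((q + 1) / 2)) * (1 / 2) * Real.Gamma ((q + 1) / 2) := by
    have := Real.Gamma_pos_of_pos (s := (q + 1) / 2) (by linarith)
    have := Real.rpow_pos_of_pos hb (-((q + 1) / 2))
    positivity
  have h' : ∫ w in Set.Ioi (0 : ℝ), w ^ q * Real.exp (-(b * w ^ 2)) =
      b ^ (-((q + 1) / 2)) * (1 / 2) * Real.Gamma ((q + 1) / 2) := by
    rw [neg_div] at h
    rw [← h]
    refine integral_congr_ae (Filter.Eventually.of_forall fun w => ?_)
    simp [neg_mul]
  have hfi : Integrable (fun w : ℝ => w ^ q * Real.exp (-(b * w ^ 2))) posVol := by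
    by_contra hni
    rw [integral_undef hni] at h'
    exact hpos.ne h'
  rw [← h', ofReal_integral_eq_lintegral_ofReal hfi]
  refine (ae_restrict_mem measurableSet_Ioi).mono fun w hw => ?_
  have hw' : (0 : ℝ) < w := hw
  positivity

/-- The inverse-Gaussian normalisation integral. -/
lemma lintegral_invGaussian {θ s : ℝ} (hθ : 0 < θ) (hs : 0 ≤ s) :
    ∫⁻ t, ENNReal.ofReal (t ^ (-(1 / 2) : ℝ) * Real.exp (-(θ ^ 2 * t + s ^ 2 / t) / 2)) ∂posVol =
      ENNReal.ofReal (√(2 * Real.pi) / θ * Real.exp (-(θ * s))) := by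
  rcases hs.eq_or_lt with rfl | hs
  · have h := lintegral_gamma (p := 1 / 2) (c := θ ^ 2 / 2) (by norm_num) (by positivity)
    have hval : Real.Gamma (1 / 2) * (θ ^ 2 / 2) ^ (-(1 / 2) : ℝ) =
        √(2 * Real.pi) / θ * Real.exp (-(θ * 0)) := by
      rw [Real.Gamma_one_half_eq, Real.rpow_neg (by positivity), ← Real.sqrt_eq_rpow,
        Real.sqrt_div (by positivity), Real.sqrt_sq hθ.le, Real.sqrt_mul (by norm_num)]
      simp; field_simp
    rw [← hval, ← h]
    refine lintegral_congr fun t => ?_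
    congr 2
    · norm_num
    · congr 1; simp; ring
  have hc : 0 < s / θ := by positivity
  set κ := θ * s with hκ
  have hκ0 : 0 < κ := by positivity
  have hexp : ∀ x : ℝ, Real.exp (-(θ ^ 2 * (s / θ * Real.exp x) +
      s ^ 2 / (s / θ * Real.exp x)) / 2) = Real.exp (-(κ * Real.cosh x)) := by
    intro x
    congr 1
    rw [Real.cosh_eq, Real.exp_neg]
    have := Real.exp_pos x
    field_simp
    rw [hκ]
  have hpre : ∀ x : ℝ, s / θ * Real.exp x * (s / θ * Real.exp x) ^ (-(1 / 2) : ℝ) =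
      √(s / θ) * Real.exp (x / 2) := by
    intro x
    have h1 : 0 < s / θ * Real.exp x := by positivity
    have h2 : s / θ * Real.exp x * (s / θ * Real.exp x) ^ (-(1 / 2) : ℝ) =
        (s / θ * Real.exp x) ^ (1 / 2 : ℝ) := by
      nth_rewrite 1 [← Real.rpow_one (s / θ * Real.exp x)]
      rw [← Real.rpow_add h1]; norm_num
    rw [h2, ← Real.sqrt_eq_rpow, Real.sqrt_mul hc.le, Real.exp_half]
  set g : ℝ → ℝ≥0∞ := fun x =>
    ENNReal.ofReal (√(s / θ) * Real.exp (x / 2) * Real.exp (-(κ * Real.cosh x))) with hg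
  have hI : ∫⁻ t, ENNReal.ofReal (t ^ (-(1 / 2) : ℝ) *
      Real.exp (-(θ ^ 2 * t + s ^ 2 / t) / 2)) ∂posVol = ∫⁻ x, g x := by
    rw [lintegral_posVol_exp_subst hc]
    refine lintegral_congr fun x => ?_
    rw [← ENNReal.ofReal_mul (by positivity), ← mul_assoc, hexp, hpre]
  have hneg : ∫⁻ x, g x = ∫⁻ x, g (-x) := (lintegral_neg_eq_self g).symm
  have hsum : 2 * ∫⁻ x, g x = ∫⁻ x, (ENNReal.ofReal (Real.cosh (x / 2) / 2) *
      ENNReal.ofReal (4 * √(s / θ) * Real.exp (-κ) *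
        Real.exp (-(2 * κ) * (Real.sinh (x / 2)) ^ 2))) := by
    rw [two_mul]
    nth_rewrite 2 [hneg]
    rw [← lintegral_add_left (by rw [hg]; fun_prop)]
    refine lintegral_congr fun x => ?_
    rw [hg, ← ENNReal.ofReal_add (by positivity) (by positivity),
      ← ENNReal.ofReal_mul (by have := Real.cosh_pos (x / 2); positivity)]
    congr 1
    have h2 : Real.cosh x = 1 + 2 * Real.sinh (x / 2) ^ 2 := by
      have := Real.cosh_two_mul (x / 2)
      rw [show 2 * (x / 2) = x by ring, Real.cosh_sq] at this
      linarith
    have h3 : Real.exp (-(κ * Real.cosh x)) =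
        Real.exp (-κ) * Real.exp (-(2 * κ) * (Real.sinh (x / 2)) ^ 2) := by
      rw [← Real.exp_add, h2]; congr 1; ring
    rw [Real.cosh_neg, h3, Real.cosh_eq (x / 2)]
    rw [show -x / 2 = -(x / 2) by ring]
    ring
  rw [← lintegral_sinh_subst (fun u => ENNReal.ofReal (4 * √(s / θ) * Real.exp (-κ) *
        Real.exp (-(2 * κ) * u ^ 2)))] at hsum
  have hgauss : ∫⁻ u : ℝ, ENNReal.ofReal (4 * √(s / θ) * Real.exp (-κ) *
        Real.exp (-(2 * κ) * u ^ 2)) =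
      2 * ENNReal.ofReal (√(2 * Real.pi) / θ * Real.exp (-κ)) := by
    rw [← ofReal_integral_eq_lintegral_ofReal
      ((integrable_exp_neg_mul_sq (by positivity)).const_mul _)
      (Filter.Eventually.of_forall fun u => by positivity),
      integral_const_mul, integral_gaussian,
      show (2 : ℝ≥0∞) = ENNReal.ofReal 2 by simp, ← ENNReal.ofReal_mul (by norm_num)]
    congr 1
    have e1 : √(s / θ) * √(Real.pi / (2 * κ)) = √(2 * Real.pi) / (2 * θ) := by
      rw [← Real.sqrt_mul hc.le]
      rw [show s / θ * (Real.pi / (2 * κ)) = (2 * Real.pi) / (2 * θ) ^ 2 by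
        rw [hκ]; field_simp]
      rw [Real.sqrt_div (by positivity), Real.sqrt_sq (by positivity)]
    calc 4 * √(s / θ) * Real.exp (-κ) * √(Real.pi / (2 * κ))
        = 4 * Real.exp (-κ) * (√(s / θ) * √(Real.pi / (2 * κ))) := by ring
      _ = _ := by rw [e1]; field_simp; ring
  rw [hgauss] at hsum
  rw [hI]
  exact (ENNReal.mul_right_inj (by norm_num) (by norm_num)).1 hsum

/-- The Bessel-type integral appearing at marked vertices. -/
noncomputable def bessel (θ s : ℝ) : ℝ≥0∞ :=
  ∫⁻ t, ENNReal.ofReal (t⁻¹ * Real.exp (-(θ ^ 2 * t + s ^ 2 / t) / 2)) ∂posVol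

lemma ofReal_exp_mul_bessel {θ s : ℝ} (hθ : 0 < θ) (hs : 0 < s) :
    ENNReal.ofReal (Real.exp (θ * s)) * bessel θ s =
      ∫⁻ x, ENNReal.ofReal (Real.exp (-(θ * s * (Real.cosh x - 1)))) := by
  have hc : 0 < s / θ := by positivity
  rw [bessel, lintegral_posVol_exp_subst hc, ← lintegral_const_mul' _ _ (by simp)]
  refine lintegral_congr fun x => ?_
  have hx := Real.exp_pos x
  rw [← ENNReal.ofReal_mul (by positivity), ← ENNReal.ofReal_mul (by positivity),
    mul_inv_cancel_left₀ (by positivity), ← Real.exp_add]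
  congr 2
  rw [Real.cosh_eq, Real.exp_neg]
  field_simp
  ring

lemma ofReal_exp_mul_bessel_anti {θ s s' : ℝ} (hθ : 0 < θ) (hs : 0 < s) (hss : s ≤ s') :
    ENNReal.ofReal (Real.exp (θ * s')) * bessel θ s' ≤
      ENNReal.ofReal (Real.exp (θ * s)) * bessel θ s := by
  rw [ofReal_exp_mul_bessel hθ hs, ofReal_exp_mul_bessel hθ (hs.trans_le hss)]
  refine lintegral_mono fun x => ENNReal.ofReal_le_ofReal (Real.exp_le_exp.2 ?_)
  have := Real.one_le_cosh x
  have : θ * s * (Real.cosh x - 1) ≤ θ * s' * (Real.cosh x - 1) := by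
    gcongr
  linarith

lemma lintegral_rpow_mul_bessel {a θ θ' : ℝ} (ha : 0 < a) (hθ : 0 < θ) (hθ' : 0 < θ') :
    ∫⁻ w, ENNReal.ofReal (w ^ (a - 1 / 2)) * bessel θ (θ' * w) ∂posVol =
      ENNReal.ofReal (2 ^ (a - 1 / 2) * Real.Gamma (a / 2 + 1 / 4) ^ 2 *
        (θ * θ') ^ (-(a + 1 / 2))) := by
  have hG := Real.Gamma_pos_of_pos (s := a / 2 + 1 / 4) (by linarith)
  have h1 : ∀ w, ENNReal.ofReal (w ^ (a - 1 / 2)) * bessel θ (θ' * w) =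
      ∫⁻ t, ENNReal.ofReal (w ^ (a - 1 / 2)) *
        ENNReal.ofReal (t⁻¹ * Real.exp (-(θ ^ 2 * t + (θ' * w) ^ 2 / t) / 2)) ∂posVol := by
    intro w
    rw [bessel, lintegral_const_mul' _ _ (by simp)]
  simp_rw [h1]
  rw [lintegral_lintegral_swap (Measurable.aemeasurable (by fun_prop))]
  have h2 : ∀ t ∈ Set.Ioi (0 : ℝ), ∫⁻ w, ENNReal.ofReal (w ^ (a - 1 / 2)) *
        ENNReal.ofReal (t⁻¹ * Real.exp (-(θ ^ 2 * t + (θ' * w) ^ 2 / t) / 2)) ∂posVol =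
      ENNReal.ofReal (2 ^ (a / 2 + 1 / 4 - 1) * Real.Gamma (a / 2 + 1 / 4) *
        θ' ^ (-(a + 1 / 2))) *
        ENNReal.ofReal (t ^ (a / 2 + 1 / 4 - 1) * Real.exp (-(θ ^ 2 / 2 * t))) := by
    intro t ht
    have ht : 0 < t := ht
    have h3 := lintegral_rpow_mul_exp_sq (q := a - 1 / 2) (b := θ' ^ 2 / (2 * t))
      (by linarith) (by positivity)
    calc _ = ∫⁻ w, ENNReal.ofReal (t⁻¹ * Real.exp (-(θ ^ 2 / 2 * t))) *
          ENNReal.ofReal (w ^ (a - 1 / 2) * Real.exp (-(θ' ^ 2 / (2 * t) * w ^ 2))) ∂posVol := by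
            refine setLIntegral_congr_fun measurableSet_Ioi fun w hw => ?_
            have hw : 0 < w := hw
            rw [← ENNReal.ofReal_mul (by positivity), ← ENNReal.ofReal_mul (by positivity)]
            congr 1
            have : Real.exp (-(θ ^ 2 * t + (θ' * w) ^ 2 / t) / 2) =
              Real.exp (-(θ ^ 2 / 2 * t)) * Real.exp (-(θ' ^ 2 / (2 * t) * w ^ 2)) := by
              rw [← Real.exp_add]; congr 1; field_simp; ring
            rw [this]; ring
      _ = _ := by
            rw [lintegral_const_mul' _ _ (by simp), h3, ← ENNReal.ofReal_mul (by positivity),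
              ← ENNReal.ofReal_mul (by positivity)]
            congr 1
            rw [show (a - 1 / 2 + 1) / 2 = a / 2 + 1 / 4 by ring,
              Real.div_rpow (by positivity) (by positivity),
              Real.mul_rpow (by norm_num) ht.le,
              ← Real.rpow_natCast θ' 2, ← Real.rpow_mul hθ'.le,
              Real.rpow_neg (x := 2) (by norm_num), Real.rpow_neg (x := t) ht.le,
              Real.rpow_sub_one (by norm_num), Real.rpow_sub_one ht.ne']
            rw [show ((2 : ℕ) : ℝ) * -(a / 2 + 1 / 4) = -(a + 1 / 2) by push_cast; ring]
            field_simp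
  rw [setLIntegral_congr_fun measurableSet_Ioi h2, lintegral_const_mul' _ _ (by simp),
    lintegral_gamma (by linarith) (by positivity), ← ENNReal.ofReal_mul (by positivity)]
  congr 1
  rw [Real.div_rpow (by positivity) (by positivity), ← Real.rpow_natCast θ 2,
    ← Real.rpow_mul hθ.le, Real.mul_rpow hθ.le hθ'.le,
    show ((2 : ℕ) : ℝ) * -(a / 2 + 1 / 4) = -(a + 1 / 2) by push_cast; ring]
  have e : (2 : ℝ) ^ (a - 1 / 2) = 2 ^ (a / 2 + 1 / 4 - 1) * 2 ^ (a / 2 + 1 / 4) := by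
    rw [← Real.rpow_add (by norm_num)]; congr 1; ring
  rw [e, Real.rpow_neg (x := 2) (by norm_num)]
  field_simp

/-- The Beta integral of the second kind. -/
lemma lintegral_beta_prime {p A : ℝ} (hp : 0 < p) (hA : 0 < A) :
    ∫⁻ τ, ENNReal.ofReal (τ ^ (p - 1) * (1 + τ) ^ (-(A + p))) ∂posVol =
      ENNReal.ofReal (Real.Gamma p * Real.Gamma A / Real.Gamma (A + p)) := by
  have hGA := Real.Gamma_pos_of_pos hA
  have hGp := Real.Gamma_pos_of_pos hp
  have hG := Real.Gamma_pos_of_pos (add_pos hA hp)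
  have h1 : ∀ τ ∈ Set.Ioi (0 : ℝ), ENNReal.ofReal (Real.Gamma (A + p)) *
      ENNReal.ofReal (τ ^ (p - 1) * (1 + τ) ^ (-(A + p))) =
      ∫⁻ w, ENNReal.ofReal (τ ^ (p - 1)) *
        ENNReal.ofReal (w ^ (A + p - 1) * Real.exp (-((1 + τ) * w))) ∂posVol := by
    intro τ hτ
    have hτ : 0 < τ := hτ
    rw [lintegral_const_mul' _ _ (by simp), lintegral_gamma (by linarith) (by linarith),
      ← ENNReal.ofReal_mul (by positivity), ← ENNReal.ofReal_mul (by positivity)]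
    congr 1; ring
  have h2 : ENNReal.ofReal (Real.Gamma (A + p)) *
      ∫⁻ τ, ENNReal.ofReal (τ ^ (p - 1) * (1 + τ) ^ (-(A + p))) ∂posVol =
      ENNReal.ofReal (Real.Gamma p * Real.Gamma A) := by
    rw [← lintegral_const_mul' _ _ (by simp), setLIntegral_congr_fun measurableSet_Ioi h1,
      lintegral_lintegral_swap (Measurable.aemeasurable (by fun_prop))]
    have h3 : ∀ w ∈ Set.Ioi (0 : ℝ), ∫⁻ τ, ENNReal.ofReal (τ ^ (p - 1)) *
        ENNReal.ofReal (w ^ (A + p - 1) * Real.exp (-((1 + τ) * w))) ∂posVol =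
        ENNReal.ofReal (Real.Gamma p) * ENNReal.ofReal (w ^ (A - 1) * Real.exp (-(1 * w))) := by
      intro w hw
      have hw : 0 < w := hw
      calc _ = ∫⁻ τ, ENNReal.ofReal (w ^ (A + p - 1) * Real.exp (-w)) *
            ENNReal.ofReal (τ ^ (p - 1) * Real.exp (-(w * τ))) ∂posVol := by
              refine setLIntegral_congr_fun measurableSet_Ioi fun τ hτ => ?_
              have hτ : 0 < τ := hτ
              rw [← ENNReal.ofReal_mul (by positivity), ← ENNReal.ofReal_mul (by positivity)]
              congr 1
              have : Real.exp (-((1 + τ) * w)) = Real.exp (-w) * Real.exp (-(w * τ)) := by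
                rw [← Real.exp_add]; congr 1; ring
              rw [this]; ring
        _ = _ := by
              rw [lintegral_const_mul' _ _ (by simp), lintegral_gamma hp hw,
                ← ENNReal.ofReal_mul (by positivity), ← ENNReal.ofReal_mul (by positivity)]
              congr 1
              have : w ^ (A + p - 1) * w ^ (-p) = w ^ (A - 1) := by
                rw [← Real.rpow_add hw]; congr 1; ring
              rw [one_mul, ← this]; ring
    rw [setLIntegral_congr_fun measurableSet_Ioi h3, lintegral_const_mul' _ _ (by simp),
      lintegral_gamma hA one_pos, ← ENNReal.ofReal_mul hGp.le]
    simp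
  rw [← ENNReal.mul_right_inj (a := ENNReal.ofReal (Real.Gamma (A + p))) (by simpa using hG)
    (by simp), h2, ← ENNReal.ofReal_mul hG.le]
  congr 1
  field_simp

/-- The decay factor gained at every step of a self-avoiding path. -/
noncomputable def decay (a : ℝ) : ℝ :=
  2 ^ (a - 1 / 2) * Real.Gamma (a / 2 + 1 / 4) ^ 2 / (√(2 * Real.pi) * Real.Gamma a)

lemma decay_pos {a : ℝ} (ha : 0 < a) : 0 < decay a := by
  have h1 := Real.Gamma_pos_of_pos (s := a / 2 + 1 / 4) (by linarith)
  have h2 := Real.Gamma_pos_of_pos ha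
  unfold decay
  positivity

/-- The ratio of Gamma values controlling `decay`. -/
noncomputable def gammaRatio (x : ℝ) : ℝ :=
  Real.Gamma (x + 1 / 4) ^ 2 / (Real.Gamma x * Real.Gamma (x + 1 / 2))

lemma decay_eq_gammaRatio {a : ℝ} (ha : 0 < a) : decay a = gammaRatio (a / 2) := by
  have h := Real.Gamma_mul_Gamma_add_half (a / 2)
  rw [show 2 * (a / 2) = a by ring] at h
  have h2 := Real.Gamma_pos_of_pos ha
  have hpi := Real.pi_pos
  have hs : 0 < √Real.pi := by positivity
  unfold decay gammaRatio
  rw [h, Real.sqrt_mul (by norm_num), Real.rpow_sub (by norm_num), Real.rpow_sub (by norm_num),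
    Real.rpow_one, ← Real.sqrt_eq_rpow]
  have : (0 : ℝ) < 2 ^ a := by positivity
  have h22 : √2 * √2 = (2 : ℝ) := Real.mul_self_sqrt (by norm_num)
  field_simp
  nlinarith [h22]

lemma gammaRatio_le_one {x : ℝ} (hx : 0 < x) : gammaRatio x ≤ 1 := by
  have h1 := Real.Gamma_pos_of_pos hx
  have h2 := Real.Gamma_pos_of_pos (s := x + 1 / 2) (by linarith)
  have h3 := Real.Gamma_pos_of_pos (s := x + 1 / 4) (by linarith)
  have hc := Real.convexOn_log_Gamma.2 (show x ∈ Set.Ioi 0 from hx)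
    (show x + 1 / 2 ∈ Set.Ioi 0 by simp only [Set.mem_Ioi]; linarith)
    (show (0 : ℝ) ≤ 1 / 2 by norm_num) (show (0 : ℝ) ≤ 1 / 2 by norm_num) (by norm_num)
  simp only [smul_eq_mul, Function.comp] at hc
  rw [show 1 / 2 * x + 1 / 2 * (x + 1 / 2) = x + 1 / 4 by ring] at hc
  unfold gammaRatio
  rw [div_le_one (by positivity), ← Real.log_le_log_iff (by positivity) (by positivity),
    Real.log_pow, Real.log_mul h1.ne' h2.ne']
  push_cast
  linarith

lemma gammaRatio_succ {x : ℝ} (hx : 0 < x) :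
    gammaRatio x = gammaRatio (x + 1) * (x * (x + 1 / 2) / (x + 1 / 4) ^ 2) := by
  have h1 := Real.Gamma_pos_of_pos hx
  have h2 := Real.Gamma_pos_of_pos (s := x + 1 / 2) (by linarith)
  have h3 := Real.Gamma_pos_of_pos (s := x + 1 / 4) (by linarith)
  unfold gammaRatio
  rw [show x + 1 + 1 / 4 = (x + 1 / 4) + 1 by ring, show x + 1 + 1 / 2 = (x + 1 / 2) + 1 by ring,
    Real.Gamma_add_one hx.ne', Real.Gamma_add_one (by linarith),
    Real.Gamma_add_one (by linarith)]
  have : x + 1 / 4 ≠ 0 := by linarith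
  have : x + 1 / 2 ≠ 0 := by linarith
  field_simp

lemma gammaRatio_step {x : ℝ} (hx : 0 < x) :
    x * (x + 1 / 2) / (x + 1 / 4) ^ 2 ≤
      Real.exp (-(1 / (16 * x + 4)) + 1 / (16 * (x + 1) + 4)) := by
  have h1 := Real.add_one_le_exp (-(1 / (16 * x + 4)) + 1 / (16 * (x + 1) + 4))
  refine le_trans ?_ h1
  have e : x * (x + 1 / 2) / (x + 1 / 4) ^ 2 = 1 - 1 / (16 * (x + 1 / 4) ^ 2) := by
    have : x + 1 / 4 ≠ 0 := by linarith
    field_simp; ring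
  rw [e]
  have : 1 / (16 * x + 4) - 1 / (16 * (x + 1) + 4) ≤ 1 / (16 * (x + 1 / 4) ^ 2) := by
    rw [div_sub_div _ _ (by positivity) (by positivity), div_le_div_iff₀ (by positivity)
      (by positivity)]
    nlinarith
  linarith

lemma gammaRatio_le_exp_add {x : ℝ} (hx : 0 < x) (n : ℕ) :
    gammaRatio x ≤ Real.exp (-(1 / (16 * x + 4)) + 1 / (16 * (x + n) + 4)) := by
  induction n generalizing x with
  | zero => simpa using gammaRatio_le_one hx
  | succ n ih =>
    have h := ih (x := x + 1) (by linarith)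
    rw [gammaRatio_succ hx]
    have h1 := gammaRatio_step hx
    have hg : 0 ≤ gammaRatio (x + 1) := by
      have := Real.Gamma_pos_of_pos (s := x + 1) (by linarith)
      have := Real.Gamma_pos_of_pos (s := x + 1 + 1 / 2) (by linarith)
      unfold gammaRatio
      positivity
    calc _ ≤ Real.exp (-(1 / (16 * (x + 1) + 4)) + 1 / (16 * (x + 1 + n) + 4)) *
          Real.exp (-(1 / (16 * x + 4)) + 1 / (16 * (x + 1) + 4)) :=
            mul_le_mul h h1 (by positivity) (by positivity)
      _ = _ := by
            rw [← Real.exp_add]; congr 1; push_cast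
            rw [show x + 1 + (n : ℝ) = x + (n + 1) by ring]; ring

lemma decay_le_exp {a : ℝ} (ha : 0 < a) : decay a ≤ Real.exp (-(1 / (8 * a + 4))) := by
  rw [decay_eq_gammaRatio ha]
  have h : Filter.Tendsto
      (fun n : ℕ => Real.exp (-(1 / (16 * (a / 2) + 4)) + 1 / (16 * (a / 2 + n) + 4)))
      Filter.atTop (nhds (Real.exp (-(1 / (16 * (a / 2) + 4)) + 0))) := by
    refine (Real.continuous_exp.tendsto _).comp (tendsto_const_nhds.add ?_)
    refine Filter.Tendsto.div_atTop tendsto_const_nhds ?_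
    refine Filter.tendsto_atTop_add_const_right _ _ ?_
    refine Filter.Tendsto.const_mul_atTop (by norm_num) ?_
    exact Filter.tendsto_atTop_add_const_left _ _ tendsto_natCast_atTop_atTop
  have := ge_of_tendsto' h fun n => gammaRatio_le_exp_add (by linarith) n
  refine this.trans_eq ?_
  congr 2
  ring_nf

lemma decay_lt_one {a : ℝ} (ha : 0 < a) : decay a < 1 := by
  refine (decay_le_exp ha).trans_lt ?_
  rw [Real.exp_lt_one_iff]
  have : 0 < 1 / (8 * a + 4) := by positivity
  linarith

lemma sqrt_decay_pow_le {a : ℝ} (ha : 0 < a) {r : ℕ} (hr : a < ((r : ℝ) - 129) / 256) :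
    √(decay a) ^ r ≤ 1 / 3 := by
  have h : decay a ^ r ≤ (1 / 3) ^ 2 := by
    calc decay a ^ r ≤ Real.exp (-(1 / (8 * a + 4))) ^ r :=
          pow_le_pow_left₀ (decay_pos ha).le (decay_le_exp ha) r
      _ = Real.exp (-(r / (8 * a + 4))) := by
          rw [← Real.exp_nat_mul]; congr 1; ring
      _ ≤ Real.exp (-32) := by
          apply Real.exp_le_exp.2
          rw [neg_le_neg_iff, le_div_iff₀ (by positivity)]
          linarith
      _ ≤ (1 / 3) ^ 2 := by
          rw [Real.exp_neg, inv_le_comm₀ (by positivity) (by norm_num)]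
          have := Real.add_one_le_exp (32 : ℝ)
          norm_num; linarith
  rw [Real.sqrt_eq_rpow, ← Real.rpow_natCast, ← Real.rpow_mul (decay_pos ha).le, mul_comm,
    Real.rpow_mul (decay_pos ha).le, ← Real.sqrt_eq_rpow, Real.rpow_natCast]
  exact Real.sqrt_le_iff.2 ⟨by norm_num, h⟩

section IteratedIntegral

variable {ι κ : Type*} [DecidableEq ι] [DecidableEq κ]

/-- Iterated integral over the positive half-line in the coordinates of a list. -/
noncomputable def itInt : List ι → ((ι → ℝ) → ℝ≥0∞) → (ι → ℝ) → ℝ≥0∞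
  | [], f, x => f x
  | i :: l, f, x => ∫⁻ t, itInt l f (Function.update x i t) ∂posVol

lemma itInt_mono {l : List ι} {f g : (ι → ℝ) → ℝ≥0∞} {x : ι → ℝ}
    (h : ∀ y, (∀ i ∉ l, y i = x i) → (∀ i ∈ l, 0 < y i) → f y ≤ g y) :
    itInt l f x ≤ itInt l g x := by
  induction l generalizing x with
  | nil => exact h x (fun _ _ => rfl) (by simp)
  | cons i l ih =>
    refine setLIntegral_mono' measurableSet_Ioi fun t ht => ih fun y hy hpos => h y ?_ ?_
    · intro j hj
      rw [List.mem_cons, not_or] at hj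
      rw [hy j hj.2, Function.update_of_ne hj.1]
    · intro j hj
      by_cases hjl : j ∈ l
      · exact hpos j hjl
      · obtain rfl : j = i := by simpa [hjl] using hj
        rw [hy j hjl, Function.update_self]
        exact ht

lemma itInt_congr {l : List ι} {f g : (ι → ℝ) → ℝ≥0∞} {x : ι → ℝ}
    (h : ∀ y, (∀ i ∉ l, y i = x i) → (∀ i ∈ l, 0 < y i) → f y = g y) :
    itInt l f x = itInt l g x :=
  le_antisymm (itInt_mono fun y h1 h2 => (h y h1 h2).le)
    (itInt_mono fun y h1 h2 => (h y h1 h2).ge)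

lemma itInt_const_mul (l : List ι) {c : ℝ≥0∞} (hc : c ≠ ⊤) (f : (ι → ℝ) → ℝ≥0∞) (x : ι → ℝ) :
    itInt l (fun y => c * f y) x = c * itInt l f x := by
  induction l generalizing x with
  | nil => rfl
  | cons i l ih =>
    simp only [itInt, ih]
    exact lintegral_const_mul' _ _ hc

lemma itInt_add_le (l : List ι) (f g : (ι → ℝ) → ℝ≥0∞) (x : ι → ℝ) :
    itInt l f x + itInt l g x ≤ itInt l (fun y => f y + g y) x := by
  induction l generalizing x with
  | nil => exact le_rfl
  | cons i l ih => exact (le_lintegral_add _ _).trans (lintegral_mono fun t => ih _)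

lemma itInt_tsum_le {α : Type*} (l : List ι) (f : α → (ι → ℝ) → ℝ≥0∞) (x : ι → ℝ) :
    ∑' k, itInt l (f k) x ≤ itInt l (fun y => ∑' k, f k y) x := by
  rw [ENNReal.tsum_eq_iSup_sum]
  refine iSup_le fun s => le_trans (b := itInt l (fun y => ∑ k ∈ s, f k y) x) ?_
    (itInt_mono fun y _ _ => ENNReal.sum_le_tsum s)
  induction s using Finset.induction_on with
  | empty => simp
  | insert k s hk ih =>
    simp only [Finset.sum_insert hk]
    exact (add_le_add le_rfl ih).trans (itInt_add_le l _ _ x)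

lemma itInt_prod {l : List ι} (hl : l.Nodup) (f : ι → ℝ → ℝ≥0∞)
    (hf : ∀ i ∈ l, ∀ t, f i t ≠ ⊤) (x : ι → ℝ) (hi : ∀ i ∈ l, ∫⁻ t, f i t ∂posVol ≠ ⊤) :
    itInt l (fun y => (l.map fun i => f i (y i)).prod) x =
      (l.map fun i => ∫⁻ t, f i t ∂posVol).prod := by
  induction l generalizing x with
  | nil => simp [itInt]
  | cons i l ih =>
    rw [List.nodup_cons] at hl
    simp only [itInt, List.map_cons, List.prod_cons]
    have h1 : ∀ t, itInt l (fun y => f i (y i) * (l.map fun j => f j (y j)).prod)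
        (Function.update x i t) = (l.map fun j => ∫⁻ t, f j t ∂posVol).prod * f i t := by
      intro t
      rw [← ih hl.2 (fun j hj => hf j (by simp [hj])) (Function.update x i t)
        (fun j hj => hi j (by simp [hj])), mul_comm,
        ← itInt_const_mul _ (hf i (by simp) t)]
      refine itInt_congr fun y hy _ => ?_
      rw [hy i hl.1, Function.update_self]
    simp_rw [h1]
    rw [lintegral_const_mul', mul_comm]
    exact List.prod_induction (· ≠ ⊤) (fun a b ha hb => ENNReal.mul_ne_top ha hb)
      ENNReal.one_ne_top (by
        intro z hz
        obtain ⟨j, hj, rfl⟩ := List.mem_map.1 hz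
        exact hi j (by simp [hj]))

lemma measurable_itInt {X : Type*} [MeasurableSpace X] (l : List ι)
    {f : X → (ι → ℝ) → ℝ≥0∞} (hf : Measurable (Function.uncurry f)) :
    Measurable fun p : X × (ι → ℝ) => itInt l (f p.1) p.2 := by
  induction l with
  | nil => exact hf
  | cons i l ih =>
    simp only [itInt]
    refine Measurable.lintegral_prod_right'
      (f := fun q : (X × (ι → ℝ)) × ℝ => itInt l (f q.1.1) (Function.update q.1.2 i q.2)) ?_
    exact ih.comp (Measurable.prodMk (by fun_prop)
      (measurable_update'.comp (Measurable.prodMk (by fun_prop) measurable_snd)))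

lemma itInt_lintegral_swap (l : List ι) {f : (ι → ℝ) → ℝ → ℝ≥0∞}
    (hf : Measurable (Function.uncurry f)) (x : ι → ℝ) :
    itInt l (fun y => ∫⁻ t, f y t ∂posVol) x = ∫⁻ t, itInt l (fun y => f y t) x ∂posVol := by
  induction l generalizing x with
  | nil => rfl
  | cons i l ih =>
    simp only [itInt, ih]
    refine lintegral_lintegral_swap (Measurable.aemeasurable ?_)
    have h := measurable_itInt (X := ℝ) l (f := fun t y => f y t) (hf.comp measurable_swap)
    exact h.comp (Measurable.prodMk measurable_snd
      (measurable_update'.comp (Measurable.prodMk measurable_const measurable_fst)))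

lemma itInt_swap (l : List ι) (m : List κ) {f : (ι → ℝ) → (κ → ℝ) → ℝ≥0∞}
    (hf : Measurable (Function.uncurry f)) (x : ι → ℝ) (z : κ → ℝ) :
    itInt l (fun y => itInt m (f y) z) x = itInt m (fun w => itInt l (fun y => f y w) x) z := by
  induction m generalizing z with
  | nil => rfl
  | cons k m ih =>
    simp only [itInt]
    rw [itInt_lintegral_swap]
    · simp only [ih]
    · have h := measurable_itInt (X := ι → ℝ) m hf
      exact h.comp (Measurable.prodMk measurable_fst
        (measurable_update'.comp (Measurable.prodMk measurable_const measurable_snd)))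

end IteratedIntegral

section Elimination

variable {V : Type*}

/-- Schur complement step: elimination of the vertex `u` with pivot `t`. -/
noncomputable def sch (B : V → V → ℝ) (u : V) (t : ℝ) : V → V → ℝ :=
  fun i j => B i j + B i u * B u j / t

/-- The weighted trace of the diagonal given by `bval`. -/
noncomputable def quad (θ : V → ℝ) : List V → (V → V → ℝ) → (V → ℝ) → ℝ
  | [], _, _ => 0
  | u :: l, B, y => θ u ^ 2 * (y u + B u u) + quad θ l (sch B u (y u)) y

/-- The quadratic form of `B` at `θ`, restricted to a list. -/
noncomputable def energy (θ : V → ℝ) (l : List V) (B : V → V → ℝ) : ℝ :=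
  (l.map fun i => (l.map fun j => B i j * θ i * θ j).sum).sum

lemma sch_symm {B : V → V → ℝ} (hB : ∀ i j, B i j = B j i) (u : V) (t : ℝ) (i j : V) :
    sch B u t i j = sch B u t j i := by
  simp only [sch]
  rw [hB i j, hB i u, hB u j]; ring

lemma le_sch {B : V → V → ℝ} (hB : ∀ i j, 0 ≤ B i j) {u : V} {t : ℝ} (ht : 0 < t) (i j : V) :
    B i j ≤ sch B u t i j := by
  have h1 := hB i u
  have h2 := hB u j
  have : 0 ≤ B i u * B u j / t := by positivity
  simp only [sch]; linarith

lemma sch_nonneg {B : V → V → ℝ} (hB : ∀ i j, 0 ≤ B i j) {u : V} {t : ℝ} (ht : 0 < t) (i j : V) :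
    0 ≤ sch B u t i j :=
  (hB i j).trans (le_sch hB ht i j)

lemma energy_cons (θ : V → ℝ) (u : V) (l : List V) {B : V → V → ℝ}
    (hB : ∀ i j, B i j = B j i) :
    energy θ (u :: l) B = B u u * θ u ^ 2 + 2 * θ u * (l.map fun j => B u j * θ j).sum +
      energy θ l B := by
  have h1 : (l.map fun j => B u j * θ u * θ j).sum = θ u * (l.map fun j => B u j * θ j).sum := by
    rw [← List.sum_map_mul_left]
    congr 1
    exact List.map_congr_left fun j _ => by ring
  have h2 : (l.map fun i => B i u * θ i * θ u).sum = θ u * (l.map fun j => B u j * θ j).sum := by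
    rw [← List.sum_map_mul_left]
    congr 1
    exact List.map_congr_left fun j _ => by rw [hB j u]; ring
  simp only [energy, List.map_cons, List.sum_cons, List.sum_map_add, h1, h2]
  ring

lemma energy_sch (θ : V → ℝ) (u : V) (t : ℝ) (l : List V) {B : V → V → ℝ}
    (hB : ∀ i j, B i j = B j i) :
    energy θ l (sch B u t) = energy θ l B + (l.map fun j => B u j * θ j).sum ^ 2 / t := by
  have h1 : ∀ i, (l.map fun j => sch B u t i j * θ i * θ j).sum =
      (l.map fun j => B i j * θ i * θ j).sum +
        B u i * θ i * ((l.map fun j => B u j * θ j).sum / t) := by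
    intro i
    rw [div_eq_mul_inv, ← List.sum_map_mul_right, ← List.sum_map_mul_left, ← List.sum_map_add]
    congr 1
    refine List.map_congr_left fun j _ => ?_
    simp only [sch]
    rw [hB i u]; ring
  simp only [energy, h1, List.sum_map_add, List.sum_map_mul_right]
  ring

lemma measurable_quad {X : Type*} [MeasurableSpace X] (l : List V) {θ : X → V → ℝ}
    {B : X → V → V → ℝ} {y : X → V → ℝ} (hθ : ∀ i, Measurable fun x => θ x i)
    (hB : ∀ i j, Measurable fun x => B x i j) (hy : ∀ i, Measurable fun x => y x i) :
    Measurable fun x => quad (θ x) l (B x) (y x) := by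
  induction l generalizing B with
  | nil => exact measurable_const
  | cons u l ih =>
    simp only [quad]
    have h := ih (B := fun x => sch (B x) u (y x u)) (fun i j => by
      simp only [sch]
      exact (hB i j).add (((hB i u).mul (hB u j)).div (hy u)))
    exact (((hθ u).pow_const 2).mul ((hy u).add (hB u u))).add h

/-- Exponent of the pivot at `u`: an extra factor `-1/2` at marked vertices. -/
noncomputable def pivExp (mk : V → Option V) (u : V) : ℝ :=
  if mk u = none then -(1 / 2) else -1

/-- The contribution of the vertex `u` to the bound `itInt_quad_marked`. -/
noncomputable def pivFactor (θ : V → ℝ) (mk : V → Option V) (B : V → V → ℝ) (u : V) : ℝ≥0∞ :=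
  match mk u with
  | none => ENNReal.ofReal (√(2 * Real.pi) / θ u)
  | some x => ENNReal.ofReal (Real.exp (θ u * (θ x * B u x))) * bessel (θ u) (θ x * B u x)

/-- Every marked vertex of the list points to a later vertex with positive weight. -/
def MarkOK (mk : V → Option V) (B : V → V → ℝ) : List V → Prop
  | [] => True
  | u :: l => (∀ x, mk u = some x → x ∈ l ∧ 0 < B u x) ∧ MarkOK mk B l

lemma MarkOK.mono {mk : V → Option V} {B B' : V → V → ℝ} (h : ∀ i j, B i j ≤ B' i j)
    {l : List V} (hl : MarkOK mk B l) : MarkOK mk B' l := by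
  induction l with
  | nil => trivial
  | cons u l ih =>
    exact ⟨fun x hx => ⟨(hl.1 x hx).1, (hl.1 x hx).2.trans_le (h u x)⟩, ih hl.2⟩

lemma MarkOK.pos {mk : V → Option V} {B : V → V → ℝ} {l : List V} (hl : MarkOK mk B l)
    {u x : V} (hu : u ∈ l) (hx : mk u = some x) : 0 < B u x := by
  induction l with
  | nil => simp at hu
  | cons w l ih =>
    rcases List.mem_cons.1 hu with rfl | hu
    · exact (hl.1 x hx).2
    · exact ih hl.2 hu

lemma list_prod_le_prod {α : Type*} {l : List α} {f g : α → ℝ≥0∞} (h : ∀ i ∈ l, f i ≤ g i) :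
    (l.map f).prod ≤ (l.map g).prod := by
  induction l with
  | nil => simp
  | cons i l ih =>
    simp only [List.map_cons, List.prod_cons]
    exact mul_le_mul' (h i (by simp)) (ih fun j hj => h j (by simp [hj]))

variable [DecidableEq V]

/-- Diagonal entries expressed through the pivots of the elimination along a list. -/
noncomputable def bval : List V → (V → V → ℝ) → (V → ℝ) → V → ℝ
  | [], _, _, _ => 0
  | u :: l, B, y, x => if x = u then y u + B u u else bval l (sch B u (y u)) y x

lemma quad_eq_sum (θ : V → ℝ) {l : List V} (hl : l.Nodup) (B : V → V → ℝ) (y : V → ℝ) :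
    quad θ l B y = (l.map fun u => θ u ^ 2 * bval l B y u).sum := by
  induction l generalizing B with
  | nil => rfl
  | cons u l ih =>
    rw [List.nodup_cons] at hl
    simp only [quad, List.map_cons, List.sum_cons, bval, if_true, ih hl.2]
    congr 2
    refine List.map_congr_left fun x hx => ?_
    rw [if_neg (fun h : x = u => hl.1 (h ▸ hx))]

/-- Normalisation of the pivot integral. -/
lemma itInt_quad {l : List V} (hl : l.Nodup) {θ : V → ℝ} (hθ : ∀ i, 0 < θ i)
    {B : V → V → ℝ} (hB : ∀ i j, B i j = B j i) (hB0 : ∀ i j, 0 ≤ B i j) (x : V → ℝ) :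
    itInt l (fun y => ENNReal.ofReal ((l.map fun u => y u ^ (-(1 / 2) : ℝ)).prod *
        Real.exp (-quad θ l B y / 2))) x =
      ENNReal.ofReal ((l.map fun u => √(2 * Real.pi) / θ u).prod *
        Real.exp (-energy θ l B / 2)) := by
  induction l generalizing B x with
  | nil => simp [itInt, quad, energy]
  | cons u l ih =>
    rw [List.nodup_cons] at hl
    set s := (l.map fun j => B u j * θ j).sum with hs
    have hs0 : 0 ≤ s := List.sum_nonneg (by
      intro z hz
      obtain ⟨j, _, rfl⟩ := List.mem_map.1 hz
      exact mul_nonneg (hB0 u j) (hθ j).le)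
    have hprod : 0 ≤ (l.map fun u => √(2 * Real.pi) / θ u).prod := List.prod_nonneg (by
      intro z hz
      obtain ⟨j, _, rfl⟩ := List.mem_map.1 hz
      have := hθ j
      positivity)
    set K := (l.map fun u => √(2 * Real.pi) / θ u).prod *
      Real.exp (-(B u u * θ u ^ 2 + energy θ l B) / 2) with hK
    have hstep : ∀ t ∈ Set.Ioi (0 : ℝ),
        itInt l (fun y => ENNReal.ofReal (((u :: l).map fun u => y u ^ (-(1 / 2) : ℝ)).prod *
          Real.exp (-quad θ (u :: l) B y / 2))) (Function.update x u t) =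
        ENNReal.ofReal K * ENNReal.ofReal (t ^ (-(1 / 2) : ℝ) *
          Real.exp (-(θ u ^ 2 * t + s ^ 2 / t) / 2)) := by
      intro t ht
      have ht : 0 < t := ht
      have h1 := ih hl.2 (sch_symm hB u t) (sch_nonneg hB0 ht) (Function.update x u t)
      rw [energy_sch θ u t l hB] at h1
      calc _ = itInt l (fun y => ENNReal.ofReal (t ^ (-(1 / 2) : ℝ) *
              Real.exp (-(θ u ^ 2 * (t + B u u)) / 2)) *
            ENNReal.ofReal ((l.map fun u => y u ^ (-(1 / 2) : ℝ)).prod *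
              Real.exp (-quad θ l (sch B u t) y / 2))) (Function.update x u t) := by
              refine itInt_congr fun y hy _ => ?_
              have hyu : y u = t := by rw [hy u hl.1, Function.update_self]
              rw [← ENNReal.ofReal_mul (by positivity)]
              congr 1
              simp only [quad, List.map_cons, List.prod_cons, hyu]
              rw [show -(θ u ^ 2 * (t + B u u) + quad θ l (sch B u t) y) / 2 =
                -(θ u ^ 2 * (t + B u u)) / 2 + -quad θ l (sch B u t) y / 2 by ring, Real.exp_add]
              ring
        _ = _ := by
              rw [itInt_const_mul _ (by simp), h1, ← ENNReal.ofReal_mul (by positivity),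
                ← ENNReal.ofReal_mul (by positivity)]
              congr 1
              rw [hK]
              have e : Real.exp (-(θ u ^ 2 * (t + B u u)) / 2) *
                  Real.exp (-(energy θ l B + s ^ 2 / t) / 2) =
                  Real.exp (-(B u u * θ u ^ 2 + energy θ l B) / 2) *
                  Real.exp (-(θ u ^ 2 * t + s ^ 2 / t) / 2) := by
                rw [← Real.exp_add, ← Real.exp_add]; congr 1; ring
              linear_combination (t ^ (-(1 / 2) : ℝ) *
                (l.map fun u => √(2 * Real.pi) / θ u).prod) * e
    rw [itInt, setLIntegral_congr_fun measurableSet_Ioi hstep, lintegral_const_mul' _ _ (by simp),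
      lintegral_invGaussian (hθ u) hs0, ← ENNReal.ofReal_mul (by positivity), energy_cons θ u l hB,
      hK]
    congr 1
    have e : Real.exp (-(B u u * θ u ^ 2 + energy θ l B) / 2) * Real.exp (-(θ u * s)) =
        Real.exp (-(B u u * θ u ^ 2 + 2 * θ u * s + energy θ l B) / 2) := by
      rw [← Real.exp_add]; congr 1; ring
    rw [← e, List.map_cons, List.prod_cons]
    ring

lemma itInt_quad_marked {l : List V} (hl : l.Nodup) {θ : V → ℝ} (hθ : ∀ i, 0 < θ i)
    {B : V → V → ℝ} (hB : ∀ i j, B i j = B j i) (hB0 : ∀ i j, 0 ≤ B i j)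
    {mk : V → Option V} (hmk : MarkOK mk B l) (x : V → ℝ) :
    itInt l (fun y => ENNReal.ofReal ((l.map fun u => y u ^ pivExp mk u).prod *
        Real.exp (-quad θ l B y / 2))) x ≤
      (l.map (pivFactor θ mk B)).prod * ENNReal.ofReal (Real.exp (-energy θ l B / 2)) := by
  induction l generalizing B x with
  | nil => simp [itInt, quad, energy]
  | cons u l ih =>
    rw [List.nodup_cons] at hl
    set s := (l.map fun j => B u j * θ j).sum with hs
    have hterm : ∀ z ∈ l.map (fun j => B u j * θ j), 0 ≤ z := by
      intro z hz
      obtain ⟨j, _, rfl⟩ := List.mem_map.1 hz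
      exact mul_nonneg (hB0 u j) (hθ j).le
    have hs0 : 0 ≤ s := List.sum_nonneg hterm
    set K := (l.map (pivFactor θ mk B)).prod *
      ENNReal.ofReal (Real.exp (-(B u u * θ u ^ 2 + energy θ l B) / 2)) with hK
    have hstep : ∀ t ∈ Set.Ioi (0 : ℝ),
        itInt l (fun y => ENNReal.ofReal (((u :: l).map fun u => y u ^ pivExp mk u).prod *
          Real.exp (-quad θ (u :: l) B y / 2))) (Function.update x u t) ≤
        K * ENNReal.ofReal (t ^ pivExp mk u *
          Real.exp (-(θ u ^ 2 * t + s ^ 2 / t) / 2)) := by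
      intro t ht
      have ht : 0 < t := ht
      have h1 := ih hl.2 (sch_symm hB u t) (sch_nonneg hB0 ht) (hmk.2.mono (le_sch hB0 ht))
        (Function.update x u t)
      rw [energy_sch θ u t l hB] at h1
      have h2 : (l.map (pivFactor θ mk (sch B u t))).prod ≤ (l.map (pivFactor θ mk B)).prod := by
        refine list_prod_le_prod fun w hw => ?_
        unfold pivFactor
        cases hmw : mk w with
        | none => exact le_rfl
        | some z =>
          have hz := hθ z
          exact ofReal_exp_mul_bessel_anti (hθ w) (mul_pos hz (hmk.2.pos hw hmw))
            (mul_le_mul_of_nonneg_left (le_sch hB0 ht w z) hz.le)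
      calc _ = itInt l (fun y => ENNReal.ofReal (t ^ pivExp mk u *
              Real.exp (-(θ u ^ 2 * (t + B u u)) / 2)) *
            ENNReal.ofReal ((l.map fun u => y u ^ pivExp mk u).prod *
              Real.exp (-quad θ l (sch B u t) y / 2))) (Function.update x u t) := by
              refine itInt_congr fun y hy _ => ?_
              have hyu : y u = t := by rw [hy u hl.1, Function.update_self]
              rw [← ENNReal.ofReal_mul (by positivity)]
              congr 1
              simp only [quad, List.map_cons, List.prod_cons, hyu]
              rw [show -(θ u ^ 2 * (t + B u u) + quad θ l (sch B u t) y) / 2 =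
                -(θ u ^ 2 * (t + B u u)) / 2 + -quad θ l (sch B u t) y / 2 by ring, Real.exp_add]
              ring
        _ ≤ ENNReal.ofReal (t ^ pivExp mk u * Real.exp (-(θ u ^ 2 * (t + B u u)) / 2)) *
            ((l.map (pivFactor θ mk B)).prod *
              ENNReal.ofReal (Real.exp (-(energy θ l B + s ^ 2 / t) / 2))) := by
              rw [itInt_const_mul _ (by simp)]
              gcongr
              exact h1.trans (mul_le_mul' h2 le_rfl)
        _ = _ := by
              rw [hK, mul_left_comm, mul_assoc, ← ENNReal.ofReal_mul (by positivity),
                ← ENNReal.ofReal_mul (by positivity)]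
              congr 2
              have e : Real.exp (-(θ u ^ 2 * (t + B u u)) / 2) *
                  Real.exp (-(energy θ l B + s ^ 2 / t) / 2) =
                  Real.exp (-(B u u * θ u ^ 2 + energy θ l B) / 2) *
                  Real.exp (-(θ u ^ 2 * t + s ^ 2 / t) / 2) := by
                rw [← Real.exp_add, ← Real.exp_add]; congr 1; ring
              linear_combination (t ^ pivExp mk u) * e
    have hfin : ∫⁻ t, ENNReal.ofReal (t ^ pivExp mk u *
        Real.exp (-(θ u ^ 2 * t + s ^ 2 / t) / 2)) ∂posVol ≤
        pivFactor θ mk B u * ENNReal.ofReal (Real.exp (-(θ u * s))) := by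
      unfold pivExp pivFactor
      cases hmu : mk u with
      | none =>
        have := hθ u
        simp only [if_true]
        rw [lintegral_invGaussian (hθ u) hs0, ENNReal.ofReal_mul (by positivity)]
      | some z =>
        obtain ⟨hzl, hz0⟩ := hmk.1 z hmu
        have hz := hθ z
        have hle : θ z * B u z ≤ s := by
          rw [mul_comm]
          exact List.single_le_sum hterm _ (List.mem_map.2 ⟨z, hzl, rfl⟩)
        have h0 : 0 < θ z * B u z := mul_pos hz hz0
        have h3 := ofReal_exp_mul_bessel_anti (hθ u) h0 hle
        have h4 : ∫⁻ t, ENNReal.ofReal (t ^ (if some z = none then -(1 / 2) else -1 : ℝ) *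
            Real.exp (-(θ u ^ 2 * t + s ^ 2 / t) / 2)) ∂posVol = bessel (θ u) s := by
          rw [bessel]
          simp [Real.rpow_neg_one]
        rw [h4]
        calc bessel (θ u) s = ENNReal.ofReal (Real.exp (θ u * s)) * bessel (θ u) s *
              ENNReal.ofReal (Real.exp (-(θ u * s))) := by
                rw [mul_right_comm, ← ENNReal.ofReal_mul (by positivity), ← Real.exp_add]
                simp
          _ ≤ _ := mul_le_mul' h3 le_rfl
    calc _ ≤ ∫⁻ t, K * ENNReal.ofReal (t ^ pivExp mk u *
          Real.exp (-(θ u ^ 2 * t + s ^ 2 / t) / 2)) ∂posVol :=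
            setLIntegral_mono' measurableSet_Ioi hstep
      _ = K * ∫⁻ t, ENNReal.ofReal (t ^ pivExp mk u *
          Real.exp (-(θ u ^ 2 * t + s ^ 2 / t) / 2)) ∂posVol :=
            lintegral_const_mul _ (by fun_prop)
      _ ≤ K * (pivFactor θ mk B u * ENNReal.ofReal (Real.exp (-(θ u * s)))) := by gcongr
      _ = _ := by
            rw [hK, energy_cons θ u l hB, List.map_cons, List.prod_cons]
            have e : ENNReal.ofReal (Real.exp (-(B u u * θ u ^ 2 + energy θ l B) / 2)) *
                ENNReal.ofReal (Real.exp (-(θ u * s))) = ENNReal.ofReal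
                (Real.exp (-(B u u * θ u ^ 2 + 2 * θ u * s + energy θ l B) / 2)) := by
              rw [← ENNReal.ofReal_mul (by positivity), ← Real.exp_add]; congr 2; ring
            rw [← e]
            ring

end Elimination

section ListProducts

variable {α : Type*}

lemma ofReal_list_prod {l : List α} {f : α → ℝ} (hf : ∀ i ∈ l, 0 ≤ f i) :
    ENNReal.ofReal (l.map f).prod = (l.map fun i => ENNReal.ofReal (f i)).prod := by
  induction l with
  | nil => simp
  | cons i l ih =>
    simp only [List.map_cons, List.prod_cons]
    rw [ENNReal.ofReal_mul (hf i (by simp)), ih fun j hj => hf j (by simp [hj])]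

lemma list_map_prod_nonneg {l : List α} {f : α → ℝ} (hf : ∀ i ∈ l, 0 ≤ f i) :
    0 ≤ (l.map f).prod :=
  List.prod_nonneg (by
    intro z hz
    obtain ⟨i, hi, rfl⟩ := List.mem_map.1 hz
    exact hf i hi)

lemma list_prod_filter {M : Type*} [CommMonoid M] {l : List α} {f : α → M} {p : α → Bool}
    (h : ∀ i ∈ l, p i = false → f i = 1) : ((l.filter p).map f).prod = (l.map f).prod := by
  induction l with
  | nil => rfl
  | cons i l ih =>
    have := ih fun j hj => h j (by simp [hj])
    cases hp : p i
    · simp [hp, this, h i (by simp) hp]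
    · simp [hp, this]

lemma list_sum_map_neg (l : List α) (f : α → ℝ) : (l.map fun i => -f i).sum = -(l.map f).sum := by
  induction l with
  | nil => simp
  | cons i l ih => simp only [List.map_cons, List.sum_cons, ih]; ring

end ListProducts

section EdgeWeights

variable {V : Type*}

/-- Product of a vertex function over the two endpoints of an edge. -/
def emul (θ : V → ℝ) (e : Sym2 V) : ℝ := (e.map θ).mul

@[simp] lemma emul_mk (θ : V → ℝ) (x y : V) : emul θ s(x, y) = θ x * θ y := rfl

lemma emul_pos {θ : V → ℝ} (hθ : ∀ i, 0 < θ i) (e : Sym2 V) : 0 < emul θ e := by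
  induction e with
  | _ x y => exact mul_pos (hθ x) (hθ y)

variable [DecidableEq V]

/-- The symmetric weight matrix of a list of edges. -/
def edgeMat (E : List (Sym2 V)) (W : Sym2 V → ℝ) : V → V → ℝ :=
  fun i j => if s(i, j) ∈ E then W s(i, j) else 0

lemma edgeMat_symm (E : List (Sym2 V)) (W : Sym2 V → ℝ) (i j : V) :
    edgeMat E W i j = edgeMat E W j i := by
  simp only [edgeMat, Sym2.eq_swap (a := i)]

lemma edgeMat_nonneg {E : List (Sym2 V)} {W : Sym2 V → ℝ} (hW : ∀ e ∈ E, 0 < W e) (i j : V) :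
    0 ≤ edgeMat E W i j := by
  unfold edgeMat
  split_ifs with h
  · exact (hW _ h).le
  · exact le_rfl

/-- The edges of the list `E` are non-degenerate and have both endpoints in `l`. -/
def EdgesIn (E : List (Sym2 V)) (l : List V) : Prop :=
  ∀ e ∈ E, ¬ e.IsDiag ∧ ∀ x ∈ e, x ∈ l

lemma energy_edgeMat (θ : V → ℝ) {l : List V} (hl : l.Nodup) {E : List (Sym2 V)} (hE : E.Nodup)
    (hEl : EdgesIn E l) (W : Sym2 V → ℝ) :
    energy θ l (edgeMat E W) = 2 * (E.map fun e => W e * emul θ e).sum := by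
  induction E with
  | nil => simp [energy, edgeMat]
  | cons e E ih =>
    rw [List.nodup_cons] at hE
    have h1 : ∀ i j, edgeMat (e :: E) W i j * θ i * θ j =
        (if s(i, j) = e then W e * emul θ e else 0) + edgeMat E W i j * θ i * θ j := by
      intro i j
      unfold edgeMat
      by_cases h : s(i, j) = e
      · subst h
        simp [hE.1, mul_assoc]
      · simp [h]
    have h2 : (l.map fun i => (l.map fun j => if s(i, j) = e then W e * emul θ e else 0).sum).sum =
        2 * (W e * emul θ e) := by
      obtain ⟨hd, hmem⟩ := hEl e (by simp)
      induction e with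
      | _ p q =>
        have hp : p ∈ l.toFinset := by simpa using hmem p (by simp)
        have hq : q ∈ l.toFinset := by simpa using hmem q (by simp)
        have hpq : p ≠ q := by simpa using hd
        simp_rw [← List.sum_toFinset _ hl]
        have h3 : ∀ i j, (if s(i, j) = s(p, q) then W s(p, q) * emul θ s(p, q) else 0) =
            (if i = p then (if j = q then W s(p, q) * emul θ s(p, q) else 0) else 0) +
            (if i = q then (if j = p then W s(p, q) * emul θ s(p, q) else 0) else 0) := by
          intro i j
          simp only [Sym2.eq_iff]
          by_cases h1 : i = p <;> by_cases h2 : j = q <;> by_cases h3 : i = q <;>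
            by_cases h4 : j = p <;> simp_all
        simp_rw [h3]
        simp [Finset.sum_add_distrib, hp, hq, two_mul]
    have hEl' : EdgesIn E l := fun f hf => hEl f (by simp [hf])
    have h4 := ih hE.2 hEl'
    simp only [energy] at h4 ⊢
    simp only [h1, List.sum_map_add, h2, h4, List.map_cons, List.sum_cons]
    ring

lemma prod_emul_rpow {θ : V → ℝ} (hθ : ∀ i, 0 < θ i) {l : List V} (hl : l.Nodup)
    {E : List (Sym2 V)} (hEl : EdgesIn E l) (c : Sym2 V → ℝ) :
    (E.map fun e => emul θ e ^ c e).prod =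
      (l.map fun i => θ i ^ ((E.filter (i ∈ ·)).map c).sum).prod := by
  induction E with
  | nil => simp
  | cons e E ih =>
    have hEl' : EdgesIn E l := fun f hf => hEl f (by simp [hf])
    have h1 : ∀ i, θ i ^ (((e :: E).filter (i ∈ ·)).map c).sum =
        (if i ∈ e then θ i ^ c e else 1) * θ i ^ ((E.filter (i ∈ ·)).map c).sum := by
      intro i
      by_cases h : i ∈ e
      · simp [h, Real.rpow_add (hθ i)]
      · simp [h]
    have h2 : (l.map fun i => if i ∈ e then θ i ^ c e else 1).prod = emul θ e ^ c e := by
      obtain ⟨hd, hmem⟩ := hEl e (by simp)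
      induction e with
      | _ p q =>
        have hp : p ∈ l.toFinset := by simpa using hmem p (by simp)
        have hq : q ∈ l.toFinset := by simpa using hmem q (by simp)
        have hpq : p ≠ q := by simpa using hd
        rw [← List.prod_toFinset _ hl, emul_mk, Real.mul_rpow (hθ p).le (hθ q).le]
        have h3 : ∀ i, (if i ∈ s(p, q) then θ i ^ c s(p, q) else 1) =
            (if i = p then θ p ^ c s(p, q) else 1) * (if i = q then θ q ^ c s(p, q) else 1) := by
          intro i
          simp only [Sym2.mem_iff]
          by_cases h1 : i = p <;> by_cases h2 : i = q <;> simp_all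
        simp_rw [h3]
        rw [Finset.prod_mul_distrib]
        simp only [Finset.prod_ite_eq', hp, hq, if_true]
    simp only [h1, List.prod_map_mul, h2, List.map_cons, List.prod_cons, ih hEl']

/-- Unnormalised expectation over edge weights and pivots. -/
noncomputable def expct (a : ℝ) (E : List (Sym2 V)) (l : List V)
    (F : (Sym2 V → ℝ) → (V → ℝ) → ℝ≥0∞) : ℝ≥0∞ :=
  itInt E (fun W => ENNReal.ofReal (E.map fun e => W e ^ (a - 1)).prod *
    itInt l (fun y => ENNReal.ofReal ((l.map fun u => y u ^ (-(1 / 2) : ℝ)).prod *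
      Real.exp (-quad (fun _ => 1) l (edgeMat E W) y / 2)) * F W y) 0) 0

lemma bval_pos {l : List V} {B : V → V → ℝ} (hB0 : ∀ i j, 0 ≤ B i j) {y : V → ℝ}
    (hy : ∀ i ∈ l, 0 < y i) {x : V} (hx : x ∈ l) : 0 < bval l B y x := by
  induction l generalizing B with
  | nil => simp at hx
  | cons u l ih =>
    have hu := hy u (by simp)
    simp only [bval]
    split_ifs with h
    · have := hB0 u u
      linarith
    · exact ih (sch_nonneg hB0 hu) (fun i hi => hy i (by simp [hi])) (by simpa [h] using hx)

/-- Normalised Gamma density factor used to represent negative powers. -/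
noncomputable def gammaDens (k : ℕ) (τ : ℝ) : ℝ := τ ^ ((k : ℝ) - 1) / (2 ^ k * Real.Gamma k)

lemma gammaDens_nonneg (k : ℕ) {τ : ℝ} (hτ : 0 ≤ τ) : 0 ≤ gammaDens k τ := by
  have := Real.Gamma_nonneg_of_nonneg (s := k) (by positivity)
  unfold gammaDens; positivity

lemma lintegral_gammaDens_exp {k : ℕ} (hk : k ≠ 0) {b : ℝ} (hb : 0 < b) :
    ∫⁻ τ, ENNReal.ofReal (gammaDens k τ * Real.exp (-(τ * b) / 2)) ∂posVol =
      ENNReal.ofReal (b ^ k)⁻¹ := by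
  have hk' : (0 : ℝ) < k := by positivity
  have hG := Real.Gamma_pos_of_pos hk'
  have h := lintegral_gamma hk' (half_pos hb)
  have h1 : ∀ τ, ENNReal.ofReal (gammaDens k τ * Real.exp (-(τ * b) / 2)) =
      ENNReal.ofReal (1 / (2 ^ k * Real.Gamma k)) *
        ENNReal.ofReal (τ ^ ((k : ℝ) - 1) * Real.exp (-(b / 2 * τ))) := by
    intro τ
    rw [← ENNReal.ofReal_mul (by positivity), gammaDens]
    congr 1
    rw [show -(τ * b) / 2 = -(b / 2 * τ) by ring]
    ring
  simp_rw [h1]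
  rw [lintegral_const_mul' _ _ (by simp), h, ← ENNReal.ofReal_mul (by positivity)]
  congr 1
  rw [Real.rpow_neg (by positivity), Real.rpow_natCast, div_pow]
  field_simp

lemma lintegral_gammaDens_rpow {k : ℕ} (hk : k ≠ 0) {A : ℝ} (hA : 0 < A) :
    ∫⁻ τ, ENNReal.ofReal (gammaDens k τ * (1 + τ) ^ (-(A + k))) ∂posVol =
      ENNReal.ofReal (Real.Gamma A / (2 ^ k * Real.Gamma (A + k))) := by
  have hk' : (0 : ℝ) < k := by positivity
  have hG := Real.Gamma_pos_of_pos hk'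
  have hG' := Real.Gamma_pos_of_pos (add_pos hA hk')
  have h1 : ∀ τ, ENNReal.ofReal (gammaDens k τ * (1 + τ) ^ (-(A + k))) =
      ENNReal.ofReal (1 / (2 ^ k * Real.Gamma k)) *
        ENNReal.ofReal (τ ^ ((k : ℝ) - 1) * (1 + τ) ^ (-(A + k))) := by
    intro τ
    rw [← ENNReal.ofReal_mul (by positivity), gammaDens]
    congr 1
    ring
  simp_rw [h1]
  rw [lintegral_const_mul' _ _ (by simp), lintegral_beta_prime hk' hA,
    ← ENNReal.ofReal_mul (by positivity)]
  congr 1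
  field_simp

/-- Half of the total exponent at a vertex with unit initial charge. -/
noncomputable def vexp (a : ℝ) (E : List (Sym2 V)) (i : V) : ℝ :=
  (a * (E.filter (i ∈ ·)).length + 1) / 2

lemma vexp_pos {a : ℝ} (ha : 0 < a) (E : List (Sym2 V)) (i : V) : 0 < vexp a E i := by
  unfold vexp; positivity

/-- Gamma representation of the negative powers of the diagonal. -/
lemma inv_pow_bval_eq {l : List V} (hl : l.Nodup) {B : V → V → ℝ} (hB0 : ∀ i j, 0 ≤ B i j)
    {y : V → ℝ} (hy : ∀ i ∈ l, 0 < y i) (k : V → ℕ) :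
    ENNReal.ofReal (Real.exp (-quad (fun _ => 1) l B y / 2) *
        (l.map fun i => (bval l B y i ^ k i)⁻¹).prod) =
      itInt (l.filter (k · ≠ 0)) (fun τ => ENNReal.ofReal
        (((l.filter (k · ≠ 0)).map fun i => gammaDens (k i) (τ i)).prod *
          Real.exp (-quad (fun i => √(1 + τ i)) l B y / 2))) 0 := by
  set D := l.filter (k · ≠ 0) with hD
  have hDk : ∀ i ∈ D, k i ≠ 0 := by intro i hi; simpa using (List.mem_filter.1 hi).2
  have hDl : ∀ i ∈ D, i ∈ l := fun i hi => (List.mem_filter.1 hi).1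
  have hb : ∀ i ∈ l, 0 < bval l B y i := fun i hi => bval_pos hB0 hy hi
  have h1 : (l.map fun i => (bval l B y i ^ k i)⁻¹).prod =
      (D.map fun i => (bval l B y i ^ k i)⁻¹).prod := by
    refine (list_prod_filter fun i _ hp => ?_).symm
    have : k i = 0 := by simpa using hp
    simp [this]
  rw [h1, ENNReal.ofReal_mul (by positivity), ofReal_list_prod fun i hi => by
    have := hb i (hDl i hi); positivity]
  have h2 : (D.map fun i => ENNReal.ofReal (bval l B y i ^ k i)⁻¹).prod =
      itInt D (fun τ => (D.map fun i => ENNReal.ofReal (gammaDens (k i) (τ i) *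
        Real.exp (-(τ i * bval l B y i) / 2))).prod) 0 := by
    rw [itInt_prod (hl.filter _) (fun i t => ENNReal.ofReal (gammaDens (k i) t *
        Real.exp (-(t * bval l B y i) / 2))) (by simp) 0]
    · congr 1
      refine List.map_congr_left fun i hi => ?_
      rw [lintegral_gammaDens_exp (hDk i hi) (hb i (hDl i hi))]
    · intro i hi
      rw [lintegral_gammaDens_exp (hDk i hi) (hb i (hDl i hi))]
      simp
  rw [h2, ← itInt_const_mul _ (by simp)]
  refine itInt_congr fun τ h0 hpos => ?_
  have hτ : ∀ i, 0 ≤ τ i := by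
    intro i
    by_cases hi : i ∈ D
    · exact (hpos i hi).le
    · simp [h0 i hi]
  rw [← ofReal_list_prod fun i _ => mul_nonneg (gammaDens_nonneg _ (hτ i)) (by positivity),
    ← ENNReal.ofReal_mul (by positivity), List.prod_map_mul]
  have h3 : (D.map fun i => Real.exp (-(τ i * bval l B y i) / 2)).prod =
      (l.map fun i => Real.exp (-(τ i * bval l B y i) / 2)).prod := by
    refine list_prod_filter fun i hi hp => ?_
    have : i ∉ D := by
      intro hiD
      have := (List.mem_filter.1 hiD).2
      rw [hp] at this
      exact absurd this (by simp)
    simp [h0 i this]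
  have h4 : Real.exp (-quad (fun i => √(1 + τ i)) l B y / 2) =
      Real.exp (-quad (fun _ => 1) l B y / 2) *
        (l.map fun i => Real.exp (-(τ i * bval l B y i) / 2)).prod := by
    rw [quad_eq_sum _ hl, quad_eq_sum _ hl]
    have : (l.map fun i => Real.exp (-(τ i * bval l B y i) / 2)).prod =
        Real.exp ((l.map fun i => -(τ i * bval l B y i) / 2).sum) := by
      rw [Real.exp_list_sum, List.map_map]; rfl
    rw [this, ← Real.exp_add]
    congr 1
    rw [neg_div, neg_div, div_eq_mul_inv, div_eq_mul_inv, ← List.sum_map_mul_right,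
      ← List.sum_map_mul_right, ← sub_eq_iff_eq_add', sub_neg_eq_add, neg_add_eq_sub,
      ← neg_sub, ← neg_inj, neg_neg, sub_eq_iff_eq_add]
    have e : ∀ i, Real.sqrt (1 + τ i) ^ 2 * bval l B y i * 2⁻¹ =
        -(-(τ i * bval l B y i) / 2) + 1 ^ 2 * bval l B y i * 2⁻¹ := by
      intro i
      rw [Real.sq_sqrt (by linarith [hτ i])]; ring
    simp only [e, List.sum_map_add]
    congr 1
    exact list_sum_map_neg l _
  rw [h3, h4]
  congr 1
  ring

end EdgeWeights

section Moments

lemma measurable_list_map_prod {α X : Type*} [MeasurableSpace X] (l : List α) {f : α → X → ℝ}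
    (hf : ∀ i, Measurable (f i)) : Measurable fun x => (l.map fun i => f i x).prod := by
  induction l with
  | nil => exact measurable_const
  | cons i l ih =>
    simp only [List.map_cons, List.prod_cons]
    exact (hf i).mul ih

variable {V : Type*}

lemma measurable_emul {X : Type*} [MeasurableSpace X] {θ : X → V → ℝ}
    (hθ : ∀ i, Measurable fun x => θ x i) (e : Sym2 V) : Measurable fun x => emul (θ x) e := by
  induction e with
  | _ p q => exact (hθ p).mul (hθ q)

lemma measurable_gammaDens (k : ℕ) : Measurable (gammaDens k) := by
  unfold gammaDens; fun_prop

variable [DecidableEq V]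

lemma inner_moment {l : List V} (hl : l.Nodup) {B : V → V → ℝ} (hB : ∀ i j, B i j = B j i)
    (hB0 : ∀ i j, 0 ≤ B i j) (k : V → ℕ) :
    itInt l (fun y => ENNReal.ofReal ((l.map fun u => y u ^ (-(1 / 2) : ℝ)).prod *
        Real.exp (-quad (fun _ => 1) l B y / 2)) *
        ENNReal.ofReal (l.map fun i => (bval l B y i ^ k i)⁻¹).prod) 0 =
      itInt (l.filter (k · ≠ 0)) (fun τ => ENNReal.ofReal
        (((l.filter (k · ≠ 0)).map fun i => gammaDens (k i) (τ i)).prod *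
          ((l.map fun u => √(2 * Real.pi) / √(1 + τ u)).prod *
            Real.exp (-energy (fun i => √(1 + τ i)) l B / 2)))) 0 := by
  set D := l.filter (k · ≠ 0) with hD
  have h1 : itInt l (fun y => ENNReal.ofReal ((l.map fun u => y u ^ (-(1 / 2) : ℝ)).prod *
        Real.exp (-quad (fun _ => 1) l B y / 2)) *
        ENNReal.ofReal (l.map fun i => (bval l B y i ^ k i)⁻¹).prod) 0 =
      itInt l (fun y => itInt D (fun τ =>
        ENNReal.ofReal (l.map fun u => y u ^ (-(1 / 2) : ℝ)).prod *
        ENNReal.ofReal ((D.map fun i => gammaDens (k i) (τ i)).prod *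
          Real.exp (-quad (fun i => √(1 + τ i)) l B y / 2))) 0) 0 := by
    refine itInt_congr fun y _ hy => ?_
    have hp : 0 ≤ (l.map fun u => y u ^ (-(1 / 2) : ℝ)).prod :=
      list_map_prod_nonneg fun i hi => (Real.rpow_pos_of_pos (hy i hi) _).le
    rw [ENNReal.ofReal_mul hp, mul_assoc, ← ENNReal.ofReal_mul (Real.exp_pos _).le,
      inv_pow_bval_eq hl hB0 hy k, itInt_const_mul _ (by simp)]
  rw [h1, itInt_swap]
  · refine itInt_congr fun τ h0 hτ => ?_
    have hτ0 : ∀ i, 0 ≤ τ i := by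
      intro i
      by_cases hi : i ∈ D
      · exact (hτ i hi).le
      · simp [h0 i hi]
    have hg : 0 ≤ (D.map fun i => gammaDens (k i) (τ i)).prod :=
      list_map_prod_nonneg fun i hi => gammaDens_nonneg _ (hτ0 i)
    have h2 := itInt_quad hl (θ := fun i => √(1 + τ i))
      (fun i => Real.sqrt_pos.2 (by linarith [hτ0 i])) hB hB0 0
    rw [ENNReal.ofReal_mul hg, ← h2, ← itInt_const_mul _ (by simp)]
    refine itInt_congr fun y _ hy => ?_
    have hp : 0 ≤ (l.map fun u => y u ^ (-(1 / 2) : ℝ)).prod :=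
      list_map_prod_nonneg fun i hi => (Real.rpow_pos_of_pos (hy i hi) _).le
    rw [← ENNReal.ofReal_mul hp, ← ENNReal.ofReal_mul hg]
    congr 1
    ring
  · have hq : Measurable fun p : (V → ℝ) × (V → ℝ) =>
        quad (fun i => √(1 + p.2 i)) l B p.1 :=
      measurable_quad l (θ := fun p : (V → ℝ) × (V → ℝ) => fun i => √(1 + p.2 i))
        (B := fun _ => B) (y := fun p => p.1) (fun i => by fun_prop) (fun i j => measurable_const)
        (fun i => by fun_prop)
    have hm1 := measurable_list_map_prod (X := (V → ℝ) × (V → ℝ)) l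
      (f := fun u p => p.1 u ^ (-(1 / 2) : ℝ)) (fun u => by fun_prop)
    have hm2 := measurable_list_map_prod (X := (V → ℝ) × (V → ℝ)) D
      (f := fun u p => gammaDens (k u) (p.2 u))
      (fun u => (measurable_gammaDens _).comp (by fun_prop))
    exact hm1.ennreal_ofReal.mul
      (hm2.mul (Real.measurable_exp.comp (hq.neg.div_const 2))).ennreal_ofReal

lemma itInt_edges {a : ℝ} (ha : 0 < a) {E : List (Sym2 V)} (hE : E.Nodup) (N : Sym2 V → ℕ)
    {m : Sym2 V → ℝ} (hm : ∀ e, 0 < m e) :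
    itInt E (fun W => ENNReal.ofReal
        ((E.map fun e => W e ^ (a + N e - 1)).prod * Real.exp (-(E.map fun e => W e * m e).sum)))
        0 =
      ENNReal.ofReal ((E.map fun e => Real.Gamma (a + N e)).prod *
        (E.map fun e => m e ^ (-(a + N e))).prod) := by
  have hp : ∀ e, 0 < a + N e := fun e => by positivity
  have h1 := itInt_prod hE (fun e t => ENNReal.ofReal (t ^ (a + N e - 1) * Real.exp (-(m e * t))))
    (by simp) 0 (by
      intro e _
      rw [lintegral_gamma (hp e) (hm e)]
      simp)
  rw [← List.prod_map_mul, ofReal_list_prod fun e _ => by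
    have := Real.Gamma_pos_of_pos (hp e)
    have := hm e
    positivity]
  simp only [lintegral_gamma (hp _) (hm _)] at h1
  rw [← h1]
  refine itInt_congr fun W _ hW => ?_
  rw [← list_sum_map_neg, Real.exp_list_sum, List.map_map, ← List.prod_map_mul, ofReal_list_prod]
  · congr 1
    refine List.map_congr_left fun e _ => ?_
    simp only [Function.comp, mul_comm]
  · intro e he
    have := hW e he
    simp only [Function.comp]
    positivity

/-- Closed form of the mixed moments of edge weights and inverse diagonal entries. -/
theorem expct_moment {a : ℝ} (ha : 0 < a) {l : List V} (hl : l.Nodup) {E : List (Sym2 V)}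
    (hE : E.Nodup) (hEl : EdgesIn E l) (N : Sym2 V → ℕ) (k : V → ℕ)
    (hk : ∀ i ∈ l, k i ≠ 0 → ((E.filter (i ∈ ·)).map N).sum = 2 * k i) :
    expct a E l (fun W y => ENNReal.ofReal ((E.map fun e => W e ^ N e).prod *
        (l.map fun i => (bval l (edgeMat E W) y i ^ k i)⁻¹).prod)) =
      ENNReal.ofReal (√(2 * Real.pi) ^ l.length * (E.map fun e => Real.Gamma (a + N e)).prod *
        (l.map fun i => Real.Gamma (vexp a E i) /
          (2 ^ k i * Real.Gamma (vexp a E i + k i))).prod) := by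
  set D := l.filter (k · ≠ 0) with hD
  have h1 : expct a E l (fun W y => ENNReal.ofReal ((E.map fun e => W e ^ N e).prod *
        (l.map fun i => (bval l (edgeMat E W) y i ^ k i)⁻¹).prod)) =
      itInt E (fun W => itInt D (fun τ =>
        ENNReal.ofReal ((D.map fun i => gammaDens (k i) (τ i)).prod *
          (l.map fun u => √(2 * Real.pi) / √(1 + τ u)).prod) *
        ENNReal.ofReal ((E.map fun e => W e ^ (a + N e - 1)).prod *
          Real.exp (-(E.map fun e => W e * emul (fun i => √(1 + τ i)) e).sum))) 0) 0 := by
    unfold expct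
    refine itInt_congr fun W _ hW => ?_
    have hB0 : ∀ i j, 0 ≤ edgeMat E W i j := edgeMat_nonneg hW
    have hN : 0 ≤ (E.map fun e => W e ^ N e).prod :=
      list_map_prod_nonneg fun e he => (pow_pos (hW e he) _).le
    have hA : 0 ≤ (E.map fun e => W e ^ (a - 1)).prod :=
      list_map_prod_nonneg fun e he => (Real.rpow_pos_of_pos (hW e he) _).le
    have h2 := inner_moment hl (edgeMat_symm E W) hB0 k
    have h3 : (E.map fun e => W e ^ (a + N e - 1)).prod =
        (E.map fun e => W e ^ (a - 1)).prod * (E.map fun e => W e ^ N e).prod := by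
      rw [← List.prod_map_mul]
      congr 1
      refine List.map_congr_left fun e he => ?_
      rw [← Real.rpow_natCast (W e), ← Real.rpow_add (hW e he)]
      congr 1; ring
    have hAN : 0 ≤ (E.map fun e => W e ^ (a + N e - 1)).prod := by rw [h3]; positivity
    calc _ = ENNReal.ofReal (E.map fun e => W e ^ (a + N e - 1)).prod *
          itInt l (fun y => ENNReal.ofReal ((l.map fun u => y u ^ (-(1 / 2) : ℝ)).prod *
            Real.exp (-quad (fun _ => 1) l (edgeMat E W) y / 2)) *
            ENNReal.ofReal (l.map fun i => (bval l (edgeMat E W) y i ^ k i)⁻¹).prod) 0 := by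
          rw [h3, ENNReal.ofReal_mul hA, mul_assoc]
          refine congrArg _ ?_
          rw [← itInt_const_mul _ (by simp)]
          refine itInt_congr fun y _ _ => ?_
          beta_reduce
          rw [ENNReal.ofReal_mul hN]
          ring
      _ = _ := by
          rw [h2, ← itInt_const_mul _ (by simp)]
          refine itInt_congr fun τ h0 hτ => ?_
          have hτ0 : ∀ i, 0 ≤ τ i := by
            intro i
            by_cases hi : i ∈ D
            · exact (hτ i hi).le
            · simp [h0 i hi]
          rw [energy_edgeMat _ hl hE hEl, ← ENNReal.ofReal_mul hAN, ← ENNReal.ofReal_mul]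
          · congr 1
            rw [show ∀ s : ℝ, -(2 * s) / 2 = -s from fun s => by ring]
            ring
          · exact mul_nonneg (list_map_prod_nonneg fun i hi => gammaDens_nonneg _ (hτ0 i))
              (list_map_prod_nonneg fun i hi => by positivity)
  rw [h1, itInt_swap]
  · have h2 : itInt D (fun τ => itInt E (fun W =>
        ENNReal.ofReal ((D.map fun i => gammaDens (k i) (τ i)).prod *
          (l.map fun u => √(2 * Real.pi) / √(1 + τ u)).prod) *
        ENNReal.ofReal ((E.map fun e => W e ^ (a + N e - 1)).prod *
          Real.exp (-(E.map fun e => W e * emul (fun i => √(1 + τ i)) e).sum))) 0) 0 =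
        itInt D (fun τ => ENNReal.ofReal (√(2 * Real.pi) ^ l.length *
            (E.map fun e => Real.Gamma (a + N e)).prod) *
          (D.map fun i => ENNReal.ofReal
            (gammaDens (k i) (τ i) * (1 + τ i) ^ (-(vexp a E i + k i)))).prod) 0 := by
      refine itInt_congr fun τ h0 hτ => ?_
      have hτ0 : ∀ i, 0 ≤ τ i := by
        intro i
        by_cases hi : i ∈ D
        · exact (hτ i hi).le
        · simp [h0 i hi]
      have hθ : ∀ i, 0 < √(1 + τ i) := fun i => Real.sqrt_pos.2 (by linarith [hτ0 i])
      have hg : ∀ i, 0 ≤ gammaDens (k i) (τ i) := fun i => gammaDens_nonneg _ (hτ0 i)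
      have hG : ∀ e, 0 ≤ Real.Gamma (a + N e) := fun e =>
        Real.Gamma_nonneg_of_nonneg (by positivity)
      rw [itInt_const_mul _ (by simp), itInt_edges ha hE N (emul_pos hθ),
        ← ofReal_list_prod fun i _ => mul_nonneg (hg i)
          (Real.rpow_nonneg (by linarith [hτ0 i]) _),
        ← ENNReal.ofReal_mul, ← ENNReal.ofReal_mul]
      · congr 1
        rw [prod_emul_rpow hθ hl hEl, List.prod_map_mul]
        have e1 : (l.map fun u => √(2 * Real.pi) / √(1 + τ u)).prod =
            √(2 * Real.pi) ^ l.length * (l.map fun u => (√(1 + τ u))⁻¹).prod := by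
          simp only [div_eq_mul_inv, List.prod_map_mul]
          simp
        have e2 : (l.map fun u => (√(1 + τ u))⁻¹).prod *
            (l.map fun i => √(1 + τ i) ^
              ((E.filter (i ∈ ·)).map fun e => -(a + (N e : ℝ))).sum).prod =
            (D.map fun i => (1 + τ i) ^ (-(vexp a E i + k i))).prod := by
          rw [← List.prod_map_mul]
          rw [hD, ← list_prod_filter (p := fun i => decide (k i ≠ 0))]
          · congr 1
            refine List.map_congr_left fun i hi => ?_
            have hi' : i ∈ D := hi
            have hki : k i ≠ 0 := by simpa using (List.mem_filter.1 hi).2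
            have hil : i ∈ l := (List.mem_filter.1 hi).1
            have hs : ((E.filter (i ∈ ·)).map fun e => -(a + (N e : ℝ))).sum =
                -(a * (E.filter (i ∈ ·)).length + 2 * k i) := by
              rw [list_sum_map_neg, List.sum_map_add]
              have : ((E.filter (i ∈ ·)).map fun e => (N e : ℝ)).sum = 2 * k i := by
                have := congrArg (Nat.cast (R := ℝ)) (hk i hil hki)
                rw [Nat.cast_list_sum, List.map_map] at this
                simpa [Function.comp_def] using this
              rw [this]
              simp [mul_comm]
            rw [hs, ← Real.rpow_neg_one, ← Real.rpow_add (hθ i), Real.sqrt_eq_rpow,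
              ← Real.rpow_mul (by linarith [hτ0 i])]
            congr 1
            unfold vexp
            ring
          · intro i _ hp
            have : i ∉ D := by
              intro hiD
              have := (List.mem_filter.1 hiD).2
              rw [hp] at this
              exact absurd this (by simp)
            simp [h0 i this]
        rw [e1, ← e2]
        ring
      · exact mul_nonneg (by positivity) (list_map_prod_nonneg fun e _ => hG e)
      · exact mul_nonneg (list_map_prod_nonneg fun i hi => hg i)
          (list_map_prod_nonneg fun i hi => by have := hθ i; positivity)
    rw [h2, itInt_const_mul _ (by simp)]
    have hA : ∀ i, 0 < vexp a E i := vexp_pos ha E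
    have hfac : ∀ i, 0 ≤ Real.Gamma (vexp a E i) / (2 ^ k i * Real.Gamma (vexp a E i + k i)) :=
      fun i => by
        have h1 := Real.Gamma_pos_of_pos (hA i)
        have h2 := Real.Gamma_pos_of_pos (add_pos_of_pos_of_nonneg (hA i) (Nat.cast_nonneg (k i)))
        positivity
    have hDk : ∀ i ∈ D, k i ≠ 0 := by intro i hi; simpa using (List.mem_filter.1 hi).2
    have h3 := itInt_prod (hl.filter (k · ≠ 0)) (fun i t => ENNReal.ofReal
      (gammaDens (k i) t * (1 + t) ^ (-(vexp a E i + k i)))) (by simp) 0 (by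
        intro i hi
        rw [lintegral_gammaDens_rpow (hDk i hi) (hA i)]
        simp)
    rw [h3, ENNReal.ofReal_mul (mul_nonneg (by positivity) (list_map_prod_nonneg fun e _ =>
      Real.Gamma_nonneg_of_nonneg (by positivity)))]
    congr 1
    rw [ofReal_list_prod fun i _ => hfac i]
    refine Eq.trans ?_ (list_prod_filter (p := fun i => decide (k i ≠ 0)) ?_)
    · congr 1
      refine List.map_congr_left fun i hi => ?_
      exact lintegral_gammaDens_rpow (hDk i hi) (hA i)
    · intro i _ hp
      have : k i = 0 := by simpa using hp
      have h4 := Real.Gamma_pos_of_pos (hA i)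
      simp [this, h4.ne']
  · have hm1 := measurable_list_map_prod (X := (Sym2 V → ℝ) × (V → ℝ)) D
      (f := fun u p => gammaDens (k u) (p.2 u))
      (fun u => (measurable_gammaDens _).comp (by fun_prop))
    have hm2 := measurable_list_map_prod (X := (Sym2 V → ℝ) × (V → ℝ)) l
      (f := fun u p => √(2 * Real.pi) / √(1 + p.2 u)) (fun u => by fun_prop)
    have hm3 := measurable_list_map_prod (X := (Sym2 V → ℝ) × (V → ℝ)) E
      (f := fun e p => p.1 e ^ (a + N e - 1)) (fun u => by fun_prop)
    have hm4 : Measurable fun p : (Sym2 V → ℝ) × (V → ℝ) =>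
        Real.exp (-(E.map fun e => p.1 e * emul (fun i => √(1 + p.2 i)) e).sum) := by
      have := measurable_list_map_prod (X := (Sym2 V → ℝ) × (V → ℝ)) E
        (f := fun e p => Real.exp (-(p.1 e * emul (fun i => √(1 + p.2 i)) e))) (fun e => by
          have := measurable_emul (X := (Sym2 V → ℝ) × (V → ℝ))
            (θ := fun p i => √(1 + p.2 i)) (fun i => by fun_prop) e
          fun_prop)
      simp only [← list_sum_map_neg, Real.exp_list_sum, List.map_map]
      exact this
    exact (hm1.mul hm2).ennreal_ofReal.mul (hm3.mul hm4).ennreal_ofReal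

end Moments

section Segments

variable {V : Type*}

/-- Weight of the self-avoiding path from `prev` through the list to `v`. -/
noncomputable def hseg (B : V → V → ℝ) (y : V → ℝ) (v : V) : V → List V → ℝ
  | prev, [] => B prev v
  | prev, x :: γ => B prev x / y x * hseg B y v x γ

/-- Elimination of all vertices of a list. -/
noncomputable def elim : List V → (V → V → ℝ) → (V → ℝ) → V → V → ℝ
  | [], B, _ => B
  | u :: l, B, y => elim l (sch B u (y u)) y

lemma hseg_nonneg {B : V → V → ℝ} (hB : ∀ i j, 0 ≤ B i j) {y : V → ℝ} {γ : List V}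
    (hy : ∀ i ∈ γ, 0 < y i) (v prev : V) : 0 ≤ hseg B y v prev γ := by
  induction γ generalizing prev with
  | nil => exact hB _ _
  | cons x γ ih =>
    have h1 := hB prev x
    have h2 := hy x (by simp)
    have h3 := ih (fun i hi => hy i (by simp [hi])) x
    simp only [hseg]
    positivity

lemma hseg_mono {B B' : V → V → ℝ} (hB : ∀ i j, 0 ≤ B i j) (h : ∀ i j, B i j ≤ B' i j) {y : V → ℝ}
    {γ : List V} (hy : ∀ i ∈ γ, 0 < y i) (v prev : V) :
    hseg B y v prev γ ≤ hseg B' y v prev γ := by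
  induction γ generalizing prev with
  | nil => exact h _ _
  | cons x γ ih =>
    have h2 := hy x (by simp)
    have hy' : ∀ i ∈ γ, 0 < y i := fun i hi => hy i (by simp [hi])
    have h3 := hseg_nonneg hB hy' v x
    have h4 := (hB prev x).trans (h prev x)
    simp only [hseg]
    have h5 := h prev x
    have h6 := ih hy' x
    gcongr

lemma hseg_append_le {B : V → V → ℝ} (hB : ∀ i j, 0 ≤ B i j) {y : V → ℝ} {γ : List V} {x : V}
    (hy : ∀ i ∈ γ ++ [x], 0 < y i) (v prev : V) :
    hseg B y v prev (γ ++ [x]) ≤ hseg (sch B x (y x)) y v prev γ := by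
  have hx : 0 < y x := hy x (by simp)
  induction γ generalizing prev with
  | nil =>
    have h1 := hB prev v
    simp only [List.nil_append, hseg, sch]
    have : B prev x / y x * B x v = B prev x * B x v / y x := by ring
    linarith
  | cons z γ ih =>
    have hz := hy z (by simp)
    have hy' : ∀ i ∈ γ ++ [x], 0 < y i := fun i hi => hy i (by simp_all)
    have h3 := hseg_nonneg hB hy' v z
    have h4 : 0 ≤ sch B x (y x) prev z := sch_nonneg hB hx prev z
    have h5 : B prev z ≤ sch B x (y x) prev z := le_sch hB hx prev z
    have h6 := ih hy' z
    simp only [List.cons_append, hseg]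
    gcongr

lemma elim_nonneg {l : List V} {B : V → V → ℝ} (hB : ∀ i j, 0 ≤ B i j) {y : V → ℝ}
    (hy : ∀ i ∈ l, 0 < y i) (i j : V) : 0 ≤ elim l B y i j := by
  induction l generalizing B with
  | nil => exact hB i j
  | cons u l ih => exact ih (sch_nonneg hB (hy u (by simp))) fun i hi => hy i (by simp [hi])

lemma elim_symm {l : List V} {B : V → V → ℝ} (hB : ∀ i j, B i j = B j i) {y : V → ℝ}
    (i j : V) : elim l B y i j = elim l B y j i := by
  induction l generalizing B with
  | nil => exact hB i j
  | cons u l ih => exact ih (sch_symm hB u _)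

lemma le_elim {l : List V} {B : V → V → ℝ} (hB : ∀ i j, 0 ≤ B i j) {y : V → ℝ}
    (hy : ∀ i ∈ l, 0 < y i) (i j : V) : B i j ≤ elim l B y i j := by
  induction l generalizing B with
  | nil => exact le_rfl
  | cons u l ih =>
    have hu := hy u (by simp)
    exact (le_sch hB hu i j).trans (ih (sch_nonneg hB hu) fun i hi => hy i (by simp [hi]))

lemma elim_append (l m : List V) (B : V → V → ℝ) (y : V → ℝ) :
    elim (l ++ m) B y = elim m (elim l B y) y := by
  induction l generalizing B with
  | nil => rfl
  | cons u l ih => exact ih _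

lemma hseg_le_elim {B : V → V → ℝ} (hB : ∀ i j, 0 ≤ B i j) {y : V → ℝ} {γ : List V}
    (hy : ∀ i ∈ γ, 0 < y i) (v prev : V) : hseg B y v prev γ ≤ elim γ.reverse B y prev v := by
  induction γ using List.reverseRecOn generalizing B with
  | nil => exact le_rfl
  | append_singleton γ x ih =>
    rw [List.reverse_append]
    have hx : 0 < y x := hy x (by simp)
    exact (hseg_append_le hB hy v prev).trans
      (ih (sch_nonneg hB hx) fun i hi => hy i (by simp [hi]))

/-- Constant in the exponential bound for powers of the diagonal. -/
noncomputable def expConst (j : ℕ) : ℝ :=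
  5 * (4 ^ (j + 1) * (j + 1).factorial * Real.exp (1 / 4))

lemma pow_mul_le_exp {x z h : ℝ} (hx : 0 ≤ x) (hz : 0 ≤ z) (hh : 0 ≤ h) (hxz : h ^ 2 ≤ x * z)
    (j : ℕ) : x ^ j * h ≤ expConst j * (Real.exp (x / 4 + z / 4) * √h) := by
  have h1 : √h ≤ (1 + x) * (1 + z) := by
    rw [Real.sqrt_le_left (by positivity)]
    have h2 : h ≤ (1 + x) * (1 + z) := by
      refine abs_le_of_sq_le_sq' (a := h) ?_ (by positivity) |>.2
      nlinarith [mul_nonneg hx hz, mul_nonneg (mul_nonneg hx hz) (mul_nonneg hx hz),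
        mul_nonneg (mul_nonneg hx hz) hx, mul_nonneg (mul_nonneg hx hz) hz]
    have h3 : 1 ≤ (1 + x) * (1 + z) := by nlinarith [mul_nonneg hx hz]
    nlinarith
  have h2 : (1 + x) ^ (j + 1) ≤
      4 ^ (j + 1) * (j + 1).factorial * Real.exp (1 / 4) * Real.exp (x / 4) := by
    have := Real.pow_div_factorial_le_exp ((1 + x) / 4) (by positivity) (j + 1)
    rw [div_pow, div_div, div_le_iff₀ (by positivity)] at this
    rw [add_div, Real.exp_add] at this
    linarith
  have h3 : 1 + z ≤ 5 * Real.exp (z / 4) := by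
    have := Real.add_one_le_exp (z / 4)
    linarith
  have h4 : x ^ j ≤ (1 + x) ^ j := by gcongr; linarith
  calc x ^ j * h = x ^ j * √h * √h := by rw [mul_assoc, Real.mul_self_sqrt hh]
    _ ≤ (1 + x) ^ j * ((1 + x) * (1 + z)) * √h := by gcongr
    _ = (1 + x) ^ (j + 1) * (1 + z) * √h := by ring
    _ ≤ (4 ^ (j + 1) * (j + 1).factorial * Real.exp (1 / 4) * Real.exp (x / 4)) *
        (5 * Real.exp (z / 4)) * √h := by gcongr
    _ = _ := by rw [Real.exp_add, expConst]; ring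

/-- Square roots of the edge weights along a path. -/
noncomputable def sqrtPath (B : V → V → ℝ) (v : V) : V → List V → ℝ
  | prev, [] => √(B prev v)
  | prev, x :: γ => √(B prev x) * sqrtPath B v x γ

lemma sqrt_hseg {B : V → V → ℝ} (hB : ∀ i j, 0 ≤ B i j) {y : V → ℝ} {γ : List V}
    (hy : ∀ i ∈ γ, 0 < y i) (v prev : V) :
    √(hseg B y v prev γ) = sqrtPath B v prev γ * (γ.map fun u => y u ^ (-(1 / 2) : ℝ)).prod := by
  induction γ generalizing prev with
  | nil => simp [hseg, sqrtPath]
  | cons x γ ih =>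
    have hx := hy x (by simp)
    have h1 := hB prev x
    simp only [hseg, sqrtPath, List.map_cons, List.prod_cons]
    rw [Real.sqrt_mul (by positivity), ih (fun i hi => hy i (by simp [hi])), Real.sqrt_div h1,
      Real.rpow_neg hx.le, ← Real.sqrt_eq_rpow]
    ring

lemma sqrtPath_nonneg (B : V → V → ℝ) (v prev : V) (γ : List V) : 0 ≤ sqrtPath B v prev γ := by
  induction γ generalizing prev with
  | nil => exact Real.sqrt_nonneg _
  | cons x γ ih => exact mul_nonneg (Real.sqrt_nonneg _) (ih x)

/-- The marks along the path starting after `prev`: every vertex points to its predecessor. -/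
def MarksPath (mk : V → Option V) : V → List V → Prop
  | _, [] => True
  | prev, x :: γ => mk x = some prev ∧ MarksPath mk x γ

lemma markOK_append {mk : V → Option V} {B : V → V → ℝ} {l m : List V}
    (hl : ∀ u ∈ l, mk u = none) (hm : MarkOK mk B m) : MarkOK mk B (l ++ m) := by
  induction l with
  | nil => exact hm
  | cons u l ih =>
    exact ⟨fun x hx => by simp [hl u (by simp)] at hx, ih fun u hu => hl u (by simp [hu])⟩

variable [DecidableEq V]

lemma bval_append {l : List V} (m : List V) (B : V → V → ℝ) (y : V → ℝ) {x : V} (hx : x ∉ l) :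
    bval (l ++ m) B y x = bval m (elim l B y) y x := by
  induction l generalizing B with
  | nil => rfl
  | cons u l ih =>
    simp only [List.mem_cons, not_or] at hx
    simp only [List.cons_append, bval, if_neg hx.1, elim]
    exact ih _ hx.2

lemma hseg_sq_le {l γ : List V} {o v : V} (hl : (l ++ (γ.reverse ++ [o, v])).Nodup)
    {B : V → V → ℝ} (hB : ∀ i j, B i j = B j i) (hB0 : ∀ i j, 0 ≤ B i j) {y : V → ℝ}
    (hy : ∀ i ∈ l ++ (γ.reverse ++ [o, v]), 0 < y i) :
    hseg B y v o γ ^ 2 ≤ bval (l ++ (γ.reverse ++ [o, v])) B y o *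
      bval (l ++ (γ.reverse ++ [o, v])) B y v := by
  have hmem : o ∉ l ++ γ.reverse ∧ v ∉ l ++ γ.reverse ∧ v ≠ o := by
    rw [← List.append_assoc, List.nodup_append] at hl
    refine ⟨fun h => hl.2.2 o h o (by simp) rfl, fun h => hl.2.2 v h v (by simp) rfl, ?_⟩
    have := hl.2.1
    simp at this
    exact fun h => this h.symm
  have hy1 : ∀ i ∈ l, 0 < y i := fun i hi => hy i (by simp [hi])
  have hy2 : ∀ i ∈ γ, 0 < y i := fun i hi => hy i (by simp [hi])
  have hy3 : ∀ i ∈ l ++ γ.reverse, 0 < y i := fun i hi => by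
    rcases List.mem_append.1 hi with h | h
    · exact hy1 i h
    · exact hy2 i (by simpa using h)
  have ho := hy o (by simp)
  have hv := hy v (by simp)
  set B' := elim (l ++ γ.reverse) B y with hB'
  have h0 : ∀ i j, 0 ≤ B' i j := elim_nonneg hB0 hy3
  have h1 : hseg B y v o γ ≤ B' o v := by
    rw [hB', elim_append]
    exact (hseg_mono hB0 (le_elim hB0 hy1) hy2 v o).trans
      (hseg_le_elim (elim_nonneg hB0 hy1) hy2 v o)
  rw [← List.append_assoc, bval_append _ _ _ hmem.1, bval_append _ _ _ hmem.2.1, ← hB']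
  simp only [bval, if_true, if_neg hmem.2.2, sch]
  rw [show B' v o = B' o v from elim_symm hB v o]
  have h3 := hseg_nonneg hB0 hy2 v o
  have hoo := h0 o o
  have hvv := h0 v v
  have hov := h0 o v
  calc hseg B y v o γ ^ 2 ≤ B' o v ^ 2 := by gcongr
    _ = y o * (B' o v * B' o v / y o) := by field_simp
    _ ≤ _ := by gcongr <;> linarith

lemma exists_marksPath {γ : List V} (hγ : γ.Nodup) (prev : V) :
    ∃ mk : V → Option V, MarksPath mk prev γ ∧ ∀ u ∉ γ, mk u = none := by
  induction γ generalizing prev with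
  | nil => exact ⟨fun _ => none, trivial, fun _ _ => rfl⟩
  | cons x γ ih =>
    rw [List.nodup_cons] at hγ
    obtain ⟨mk, h1, h2⟩ := ih hγ.2 x
    have key : ∀ (δ : List V) (p : V), x ∉ δ → MarksPath mk p δ →
        MarksPath (Function.update mk x (some prev)) p δ := by
      intro δ
      induction δ with
      | nil => intros; trivial
      | cons z δ ihδ =>
        intro p hx h
        simp only [List.mem_cons, not_or] at hx
        exact ⟨by rw [Function.update_of_ne (Ne.symm hx.1)]; exact h.1, ihδ z hx.2 h.2⟩
    refine ⟨Function.update mk x (some prev), ⟨by simp, key γ x hγ.1 h1⟩, fun u hu => ?_⟩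
    simp only [List.mem_cons, not_or] at hu
    rw [Function.update_of_ne hu.1]
    exact h2 u hu.2

/-- All consecutive edges of the path from `prev` through the list to `v` belong to `E`. -/
def PathIn (E : List (Sym2 V)) (v : V) : V → List V → Prop
  | prev, [] => s(prev, v) ∈ E
  | prev, x :: γ => s(prev, x) ∈ E ∧ PathIn E v x γ

lemma hseg_eq_zero {E : List (Sym2 V)} {v prev : V} {γ : List V} (h : ¬ PathIn E v prev γ)
    (W : Sym2 V → ℝ) (y : V → ℝ) : hseg (edgeMat E W) y v prev γ = 0 := by
  induction γ generalizing prev with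
  | nil => exact if_neg h
  | cons x γ ih =>
    simp only [PathIn, not_and_or] at h
    simp only [hseg]
    rcases h with h | h
    · rw [edgeMat, if_neg h]; simp
    · rw [ih h]; simp

lemma markOK_reverse {mk : V → Option V} {E : List (Sym2 V)} {W : Sym2 V → ℝ}
    (hW : ∀ e ∈ E, 0 < W e) {v prev : V} {γ T : List V} (hγ : MarksPath mk prev γ)
    (hE : PathIn E v prev γ) (hT : MarkOK mk (edgeMat E W) T) (hp : prev ∈ T) :
    MarkOK mk (edgeMat E W) (γ.reverse ++ T) := by
  induction γ generalizing prev T with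
  | nil => exact hT
  | cons x γ ih =>
    rw [List.reverse_cons, List.append_assoc]
    refine ih hγ.2 hE.2 ⟨fun z hz => ?_, hT⟩ (by simp)
    obtain rfl : prev = z := by simpa [hγ.1] using hz
    refine ⟨hp, ?_⟩
    rw [edgeMat_symm, edgeMat, if_pos hE.1]
    exact hW _ hE.1

end Segments

lemma bessel_ne_top {θ s : ℝ} (hθ : 0 < θ) (hs : s ≠ 0) : bessel θ s ≠ ⊤ := by
  have hs2 : 0 < s ^ 2 := by positivity
  have h := lintegral_gamma (p := 1) (c := θ ^ 2 / 2) one_pos (by positivity)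
  refine ne_top_of_le_ne_top (b := ENNReal.ofReal (2 / s ^ 2) *
    ∫⁻ w, ENNReal.ofReal (w ^ ((1 : ℝ) - 1) * Real.exp (-(θ ^ 2 / 2 * w))) ∂posVol)
    (by rw [h]; exact ENNReal.mul_ne_top (by simp) (by simp)) ?_
  rw [← lintegral_const_mul' _ _ (by simp), bessel]
  refine setLIntegral_mono' measurableSet_Ioi fun t ht => ?_
  have ht0 : 0 < t := ht
  rw [← ENNReal.ofReal_mul (by positivity)]
  refine ENNReal.ofReal_le_ofReal ?_
  have h1 : s ^ 2 / (2 * t) ≤ Real.exp (s ^ 2 / (2 * t)) := by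
    have := Real.add_one_le_exp (s ^ 2 / (2 * t)); linarith
  have h2 : t⁻¹ ≤ 2 / s ^ 2 * Real.exp (s ^ 2 / (2 * t)) := by
    calc t⁻¹ = 2 / s ^ 2 * (s ^ 2 / (2 * t)) := by field_simp
      _ ≤ _ := by gcongr
  rw [sub_self, Real.rpow_zero, one_mul,
    show -(θ ^ 2 * t + s ^ 2 / t) / 2 = -(s ^ 2 / (2 * t)) + -(θ ^ 2 / 2 * t) by field_simp; ring,
    Real.exp_add, ← mul_assoc]
  gcongr
  calc t⁻¹ * Real.exp (-(s ^ 2 / (2 * t))) ≤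
        2 / s ^ 2 * Real.exp (s ^ 2 / (2 * t)) * Real.exp (-(s ^ 2 / (2 * t))) := by gcongr
    _ = 2 / s ^ 2 := by rw [mul_assoc, ← Real.exp_add]; simp

section EdgeFactors

lemma list_prod_map_update {α M : Type*} [DecidableEq α] [CommMonoid M] {E : List α}
    (hE : E.Nodup) {e₀ : α} (he : e₀ ∈ E) (J : α → M) (c : M) :
    (E.map (Function.update J e₀ c)).prod * J e₀ = c * (E.map J).prod := by
  induction E with
  | nil => simp at he
  | cons e E ih =>
    rw [List.nodup_cons] at hE
    simp only [List.map_cons, List.prod_cons]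
    rcases List.mem_cons.1 he with rfl | he'
    · have : E.map (Function.update J e₀ c) = E.map J :=
        List.map_congr_left fun x hx => Function.update_of_ne (fun h : x = e₀ => hE.1 (h ▸ hx)) _ _
      rw [this, Function.update_self, mul_assoc, mul_comm _ (J e₀)]
    · have hne : e ≠ e₀ := fun h => hE.1 (h ▸ he')
      rw [Function.update_of_ne hne, mul_assoc, ih hE.2 he', mul_left_comm]

variable {V : Type*}

/-- Integral over the weight of one edge, with a factor. -/
noncomputable def edgeInt (a : ℝ) (θ : V → ℝ) (φ : Sym2 V → ℝ → ℝ≥0∞) (e : Sym2 V) : ℝ≥0∞ :=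
  ∫⁻ t, ENNReal.ofReal (t ^ (a - 1) * Real.exp (-(emul θ e * t))) * φ e t ∂posVol

lemma edgeInt_one {a : ℝ} (ha : 0 < a) {θ : V → ℝ} (hθ : ∀ i, 0 < θ i)
    {φ : Sym2 V → ℝ → ℝ≥0∞} {e : Sym2 V} (h : φ e = fun _ => 1) :
    edgeInt a θ φ e = ENNReal.ofReal (Real.Gamma a * emul θ e ^ (-a)) := by
  simp only [edgeInt, h, mul_one]
  exact lintegral_gamma ha (emul_pos hθ e)

lemma lintegral_edge_sqrt {a c : ℝ} (ha : 0 < a) (hc : 0 < c) :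
    ∫⁻ t, ENNReal.ofReal (t ^ (a - 1) * Real.exp (-(c * t))) * ENNReal.ofReal √t ∂posVol =
      ENNReal.ofReal (Real.Gamma (a + 1 / 2) * c ^ (-(a + 1 / 2))) := by
  rw [← lintegral_gamma (by positivity) hc]
  refine setLIntegral_congr_fun measurableSet_Ioi fun t ht => ?_
  have ht0 : 0 < t := ht
  rw [← ENNReal.ofReal_mul (by positivity), Real.sqrt_eq_rpow,
    show a + 1 / 2 - 1 = (a - 1) + 1 / 2 by ring, Real.rpow_add ht0]
  congr 1
  ring

lemma lintegral_edge_bessel {a θ θ' : ℝ} (ha : 0 < a) (hθ : 0 < θ) (hθ' : 0 < θ') :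
    ∫⁻ t, ENNReal.ofReal (t ^ (a - 1) * Real.exp (-(θ' * θ * t))) *
        (ENNReal.ofReal (√t * Real.exp (θ * (θ' * t))) * bessel θ (θ' * t)) ∂posVol =
      ENNReal.ofReal (√(2 * Real.pi) * Real.Gamma a * decay a * (θ' * θ) ^ (-(a + 1 / 2))) := by
  have hG := Real.Gamma_pos_of_pos ha
  have h1 : √(2 * Real.pi) * Real.Gamma a * decay a =
      2 ^ (a - 1 / 2) * Real.Gamma (a / 2 + 1 / 4) ^ 2 := by
    unfold decay; field_simp
  rw [h1, mul_comm θ' θ, ← lintegral_rpow_mul_bessel ha hθ hθ']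
  refine setLIntegral_congr_fun measurableSet_Ioi fun t ht => ?_
  have ht0 : 0 < t := ht
  rw [← mul_assoc, ← ENNReal.ofReal_mul (by positivity)]
  congr 2
  rw [show t ^ (a - 1 / 2) = t ^ (a - 1) * √t by
      rw [Real.sqrt_eq_rpow, ← Real.rpow_add ht0]; congr 1; ring,
    mul_mul_mul_comm, ← Real.exp_add]
  rw [show -(θ * θ' * t) + θ * (θ' * t) = 0 by ring, Real.exp_zero, mul_one]

variable [DecidableEq V]

/-- Factors contributed to the edge integrals by the edges of a self-avoiding path. -/
noncomputable def edgeFac (θ : V → ℝ) (v : V) : V → List V → Sym2 V → ℝ → ℝ≥0∞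
  | prev, [] => Function.update (fun _ _ => 1) s(prev, v) fun t => ENNReal.ofReal √t
  | prev, x :: γ => Function.update (edgeFac θ v x γ) s(prev, x) fun t =>
      ENNReal.ofReal (√t * Real.exp (θ x * (θ prev * t))) * bessel (θ x) (θ prev * t)

lemma edgeFac_fresh (θ : V → ℝ) {v prev p : V} {γ : List V} (hp : p ∉ prev :: (γ ++ [v]))
    {e : Sym2 V} (he : p ∈ e) : edgeFac θ v prev γ e = fun _ => 1 := by
  induction γ generalizing prev with
  | nil =>
    simp only [edgeFac]
    rw [Function.update_of_ne]
    rintro rfl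
    simp at hp he
    tauto
  | cons x γ ih =>
    simp only [edgeFac]
    rw [Function.update_of_ne]
    · exact ih fun h => hp (List.mem_cons_of_mem _ (by simpa using h))
    · rintro rfl
      simp at hp he
      tauto

lemma edgeFac_ne_top {θ : V → ℝ} (hθ : ∀ i, 0 < θ i) (v prev : V) (γ : List V) (e : Sym2 V)
    (t : ℝ) : edgeFac θ v prev γ e t ≠ ⊤ := by
  induction γ generalizing prev with
  | nil =>
    simp only [edgeFac, Function.update_apply]
    split_ifs <;> simp
  | cons x γ ih =>
    simp only [edgeFac, Function.update_apply]
    split_ifs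
    · rcases le_or_gt t 0 with ht | ht
      · simp [Real.sqrt_eq_zero_of_nonpos ht]
      · exact ENNReal.mul_ne_top ENNReal.ofReal_ne_top
          (bessel_ne_top (hθ x) (mul_pos (hθ prev) ht).ne')
    · exact ih x

lemma prod_map_update_apply {α M : Type*} [DecidableEq α] [CommMonoid M] {E : List α}
    (hE : E.Nodup) {e₀ : α} (he : e₀ ∈ E) {φ : α → ℝ → M} (h1 : φ e₀ = fun _ => 1) (h : ℝ → M)
    (W : α → ℝ) : (E.map fun e => Function.update φ e₀ h e (W e)).prod =
      h (W e₀) * (E.map fun e => φ e (W e)).prod := by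
  have := list_prod_map_update hE he (fun e => φ e (W e)) (h (W e₀))
  rw [h1, mul_one] at this
  rw [← this]
  congr 1
  refine List.map_congr_left fun e _ => ?_
  by_cases hee : e = e₀
  · subst hee; simp
  · simp [Function.update_of_ne hee]

lemma sqrtPath_mul_pivFactor {E : List (Sym2 V)} (hE : E.Nodup) {W : Sym2 V → ℝ} (θ : V → ℝ)
    {mk : V → Option V} {v prev : V} {γ : List V} (hn : (prev :: (γ ++ [v])).Nodup)
    (hγ : MarksPath mk prev γ) (hP : PathIn E v prev γ) :
    ENNReal.ofReal (sqrtPath (edgeMat E W) v prev γ) *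
        (γ.map (pivFactor θ mk (edgeMat E W))).prod =
      (E.map fun e => edgeFac θ v prev γ e (W e)).prod := by
  induction γ generalizing prev with
  | nil =>
    simp only [edgeFac]
    rw [prod_map_update_apply hE hP rfl]
    have : edgeMat E W prev v = W s(prev, v) := if_pos hP
    simp [sqrtPath, this]
  | cons x γ ih =>
    simp only [edgeFac]
    rw [prod_map_update_apply hE hP.1 (edgeFac_fresh θ
      (by simpa using (List.nodup_cons.1 hn).1) (Sym2.mem_mk_left prev x)),
      ← ih (by simpa using (List.nodup_cons.1 hn).2) hγ.2 hP.2]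
    have h1 : edgeMat E W prev x = W s(prev, x) := if_pos hP.1
    have h2 : edgeMat E W x prev = W s(prev, x) := by rw [edgeMat_symm, h1]
    simp only [sqrtPath, List.map_cons, List.prod_cons, pivFactor, hγ.1, h1, h2]
    rw [ENNReal.ofReal_mul (Real.sqrt_nonneg _), ENNReal.ofReal_mul (Real.sqrt_nonneg _)]
    ring

lemma edgeInt_update (a : ℝ) (θ : V → ℝ) (φ : Sym2 V → ℝ → ℝ≥0∞) (e₀ : Sym2 V) (h : ℝ → ℝ≥0∞) :
    edgeInt a θ (Function.update φ e₀ h) = Function.update (edgeInt a θ φ) e₀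
      (∫⁻ t, ENNReal.ofReal (t ^ (a - 1) * Real.exp (-(emul θ e₀ * t))) * h t ∂posVol) := by
  funext e
  by_cases hee : e = e₀
  · subst hee; simp [edgeInt]
  · simp [edgeInt, Function.update_of_ne hee]

lemma prod_edgeInt {a : ℝ} (ha : 0 < a) {θ : V → ℝ} (hθ : ∀ i, 0 < θ i) {E : List (Sym2 V)}
    (hE : E.Nodup) {v prev : V} {γ : List V} (hn : (prev :: (γ ++ [v])).Nodup)
    (h1 : ∀ x ∈ γ, θ x = 1) (hP : PathIn E v prev γ) :
    (E.map (edgeInt a θ (edgeFac θ v prev γ))).prod =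
      ENNReal.ofReal ((E.map fun e => Real.Gamma a * emul θ e ^ (-a)).prod *
        (√(2 * Real.pi) * decay a) ^ γ.length * (Real.Gamma (a + 1 / 2) / Real.Gamma a) *
          (θ prev * θ v) ^ (-(1 / 2) : ℝ)) := by
  have hG := Real.Gamma_pos_of_pos ha
  have hG' := Real.Gamma_pos_of_pos (s := a + 1 / 2) (by positivity)
  have hd := decay_pos ha
  have hpos : ∀ e, 0 < Real.Gamma a * emul θ e ^ (-a) := fun e => by
    have := emul_pos hθ e; positivity
  have hprod : 0 ≤ (E.map fun e => Real.Gamma a * emul θ e ^ (-a)).prod :=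
    list_map_prod_nonneg fun e _ => (hpos e).le
  induction γ generalizing prev with
  | nil =>
    have hfr : edgeInt a θ (fun _ _ => 1) = fun e =>
        ENNReal.ofReal (Real.Gamma a * emul θ e ^ (-a)) := by
      funext e; exact edgeInt_one ha hθ rfl
    have h2 := list_prod_map_update hE hP (edgeInt a θ (fun _ _ => 1))
      (ENNReal.ofReal (Real.Gamma (a + 1 / 2) * emul θ s(prev, v) ^ (-(a + 1 / 2))))
    simp only [edgeFac]
    rw [edgeInt_update, lintegral_edge_sqrt ha (emul_pos hθ _)]
    rw [hfr] at h2 ⊢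
    rw [← ofReal_list_prod fun e _ => (hpos e).le] at h2
    refine (ENNReal.mul_left_inj (c := ENNReal.ofReal
      (Real.Gamma a * emul θ s(prev, v) ^ (-a))) ?_ (by simp)).1 ?_
    · simpa using hpos s(prev, v)
    have hm := mul_pos (hθ prev) (hθ v)
    rw [h2, ← ENNReal.ofReal_mul (by positivity), ← ENNReal.ofReal_mul (by positivity)]
    congr 1
    simp only [emul_mk, List.length_nil, pow_zero, neg_add, Real.rpow_add hm]
    field_simp
  | cons x γ ih =>
    have hn' := List.nodup_cons.1 hn
    have h3 := ih (by simpa using hn'.2) (fun z hz => h1 z (by simp [hz])) hP.2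
    have hx : θ x = 1 := h1 x (by simp)
    have hfr := edgeInt_one ha hθ (edgeFac_fresh θ (v := v) (prev := x) (γ := γ)
      (by simpa using hn'.1) (Sym2.mem_mk_left prev x))
    have h2 := list_prod_map_update hE hP.1 (edgeInt a θ (edgeFac θ v x γ))
      (ENNReal.ofReal (√(2 * Real.pi) * Real.Gamma a * decay a *
        emul θ s(prev, x) ^ (-(a + 1 / 2))))
    simp only [edgeFac]
    rw [edgeInt_update, emul_mk, lintegral_edge_bessel ha (hθ x) (hθ prev)]
    rw [hfr, h3] at h2
    refine (ENNReal.mul_left_inj (c := ENNReal.ofReal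
      (Real.Gamma a * emul θ s(prev, x) ^ (-a))) ?_ (by simp)).1 ?_
    · simpa using hpos s(prev, x)
    have hm := mul_pos (hθ prev) (hθ v)
    have hp := hθ prev
    have hv := hθ v
    rw [emul_mk] at h2
    rw [emul_mk, h2, hx, ← ENNReal.ofReal_mul (by positivity),
      ← ENNReal.ofReal_mul (by positivity)]
    congr 1
    simp only [mul_one, one_mul, List.length_cons, pow_succ, neg_add, Real.rpow_add hp,
      Real.mul_rpow hp.le hv.le]
    ring

end EdgeFactors

lemma itInt_zero {ι : Type*} [DecidableEq ι] (l : List ι) (x : ι → ℝ) :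
    itInt l (fun _ => 0) x = 0 := by
  induction l generalizing x with
  | nil => rfl
  | cons i l ih => simp [itInt, ih]

section SegmentBound

variable {V : Type*}

lemma pivFactor_marks {mk : V → Option V} {γ : List V} {prev : V} (h : MarksPath mk prev γ) :
    ∀ x ∈ γ, mk x ≠ none := by
  induction γ generalizing prev with
  | nil => simp
  | cons z γ ih =>
    intro x hx
    rcases List.mem_cons.1 hx with rfl | hx
    · simp [h.1]
    · exact ih h.2 x hx

lemma prod_rpow_pivExp {mk : V → Option V} {l γ : List V} {o v prev : V}
    (hl : ∀ u ∈ l, mk u = none) (ho : mk o = none) (hv : mk v = none) (hγ : MarksPath mk prev γ)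
    {y : V → ℝ} (hy : ∀ i ∈ γ, 0 < y i) :
    ((l ++ (γ.reverse ++ [o, v])).map fun u => y u ^ pivExp mk u).prod =
      ((l ++ (γ.reverse ++ [o, v])).map fun u => y u ^ (-(1 / 2) : ℝ)).prod *
        (γ.map fun u => y u ^ (-(1 / 2) : ℝ)).prod := by
  have h1 : l.map (fun u => y u ^ pivExp mk u) = l.map fun u => y u ^ (-(1 / 2) : ℝ) :=
    List.map_congr_left fun u hu => by rw [pivExp, if_pos (hl u hu)]
  have h2 : (γ.map fun u => y u ^ pivExp mk u).prod =
      (γ.map fun u => y u ^ (-(1 / 2) : ℝ)).prod * (γ.map fun u => y u ^ (-(1 / 2) : ℝ)).prod := by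
    rw [← List.prod_map_mul]
    congr 1
    refine List.map_congr_left fun u hu => ?_
    rw [pivExp, if_neg (pivFactor_marks hγ u hu), ← Real.rpow_add (hy u hu)]
    norm_num
  have h3 : pivExp mk o = -(1 / 2) := by rw [pivExp, if_pos ho]
  have h4 : pivExp mk v = -(1 / 2) := by rw [pivExp, if_pos hv]
  simp only [List.map_append, List.prod_append, List.map_reverse, List.prod_reverse, h1, h2,
    List.map_cons, List.map_nil, h3, h4]
  ring

variable [DecidableEq V]

lemma edgeInt_ne_top {a : ℝ} (ha : 0 < a) {θ : V → ℝ} (hθ : ∀ i, 0 < θ i) (v prev : V)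
    (γ : List V) (e : Sym2 V) : edgeInt a θ (edgeFac θ v prev γ) e ≠ ⊤ := by
  have hone : ∀ e, edgeInt a θ (fun _ _ => 1) e ≠ ⊤ := fun e => by
    rw [edgeInt_one ha hθ rfl]; simp
  induction γ generalizing prev with
  | nil =>
    simp only [edgeFac, edgeInt_update, Function.update_apply]
    split_ifs
    · rw [lintegral_edge_sqrt ha (emul_pos hθ _)]; simp
    · exact hone e
  | cons x γ ih =>
    simp only [edgeFac, edgeInt_update, Function.update_apply]
    split_ifs
    · rw [emul_mk, lintegral_edge_bessel ha (hθ x) (hθ prev)]; simp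
    · exact ih x

/-- The test vector equal to `√(1/2)` at the two endpoints and to `1` elsewhere. -/
noncomputable def endVec (o v u : V) : ℝ := if u = o ∨ u = v then √(1 / 2) else 1

lemma endVec_pos (o v u : V) : 0 < endVec o v u := by
  unfold endVec
  split_ifs
  · exact Real.sqrt_pos.2 (by norm_num)
  · exact one_pos

lemma quad_endVec {l : List V} {o v : V} (hl : (l ++ [o, v]).Nodup) (B : V → V → ℝ) (y : V → ℝ) :
    quad (fun _ => 1) (l ++ [o, v]) B y =
      quad (endVec o v) (l ++ [o, v]) B y +
        (bval (l ++ [o, v]) B y o / 2 + bval (l ++ [o, v]) B y v / 2) := by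
  rw [quad_eq_sum _ hl, quad_eq_sum _ hl]
  have h1 : l.map (fun u => endVec o v u ^ 2 * bval (l ++ [o, v]) B y u) =
      l.map (fun u => 1 ^ 2 * bval (l ++ [o, v]) B y u) := by
    refine List.map_congr_left fun u hu => ?_
    rw [List.nodup_append] at hl
    have h2 : u ≠ o := hl.2.2 u hu o (by simp)
    have h3 : u ≠ v := hl.2.2 u hu v (by simp)
    simp [endVec, h2, h3]
  rw [List.map_append, List.map_append, List.sum_append, List.sum_append, h1]
  have h4 : √(1 / 2 : ℝ) ^ 2 = 1 / 2 := Real.sq_sqrt (by norm_num)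
  simp only [List.map_cons, List.map_nil, List.sum_cons, List.sum_nil, endVec, true_or, or_true,
    if_true, h4]
  ring

lemma prod_emul_endVec_le {a : ℝ} (ha : 0 < a) {l : List V} {o v : V}
    (hl : (l ++ [o, v]).Nodup) {E : List (Sym2 V)} (hEl : EdgesIn E (l ++ [o, v]))
    (ho : (E.filter (o ∈ ·)).length ≤ 4) (hv : (E.filter (v ∈ ·)).length ≤ 4) :
    (E.map fun e => emul (endVec o v) e ^ (-a)).prod ≤ 2 ^ (4 * a) := by
  rw [prod_emul_rpow (endVec_pos o v) hl hEl, List.map_append, List.prod_append]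
  have h1 : (l.map fun i => endVec o v i ^ ((E.filter (i ∈ ·)).map fun _ => -a).sum).prod = 1 := by
    refine List.prod_eq_one fun z hz => ?_
    obtain ⟨u, hu, rfl⟩ := List.mem_map.1 hz
    rw [List.nodup_append] at hl
    have h2 : u ≠ o := hl.2.2 u hu o (by simp)
    have h3 : u ≠ v := hl.2.2 u hu v (by simp)
    simp [endVec, h2, h3]
  have h2 : ∀ n : ℕ, n ≤ 4 → √(1 / 2 : ℝ) ^ ((n : ℝ) * -a) ≤ 2 ^ (2 * a) := by
    intro n hn
    have hn' : (n : ℝ) ≤ 4 := by exact_mod_cast hn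
    rw [Real.sqrt_eq_rpow, ← Real.rpow_mul (by norm_num), one_div, Real.inv_rpow (by norm_num),
      ← Real.rpow_neg (by norm_num)]
    exact Real.rpow_le_rpow_of_exponent_le (by norm_num) (by nlinarith)
  rw [h1, one_mul]
  simp only [List.map_cons, List.map_nil, List.prod_cons, List.prod_nil, endVec, true_or, or_true,
    if_true, List.map_const', List.sum_replicate, nsmul_eq_mul, mul_one]
  calc _ ≤ (2 : ℝ) ^ (2 * a) * 2 ^ (2 * a) := by
        gcongr
        · exact h2 _ ho
        · exact h2 _ hv
    _ = _ := by rw [← Real.rpow_add (by norm_num)]; congr 1; ring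

/-- Constant in the bound on self-avoiding segments. -/
noncomputable def segConst (a : ℝ) (j : ℕ) : ℝ :=
  expConst j * 2 * 2 ^ (4 * a) * (Real.Gamma (a + 1 / 2) / Real.Gamma a) * 2 ^ (1 / 2 : ℝ)

/-- Exponential decay of the weight of a self-avoiding segment, uniformly in the graph. -/
theorem expct_segment_le {a : ℝ} (ha : 0 < a) (j : ℕ) {l γ : List V} {o v : V}
    (hl : (l ++ (γ.reverse ++ [o, v])).Nodup) {E : List (Sym2 V)} (hE : E.Nodup)
    (hEl : EdgesIn E (l ++ (γ.reverse ++ [o, v])))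
    (ho : (E.filter (o ∈ ·)).length ≤ 4) (hv : (E.filter (v ∈ ·)).length ≤ 4) :
    expct a E (l ++ (γ.reverse ++ [o, v])) (fun W y => ENNReal.ofReal
        (bval (l ++ (γ.reverse ++ [o, v])) (edgeMat E W) y o ^ j *
          hseg (edgeMat E W) y v o γ)) ≤
      ENNReal.ofReal (segConst a j *
        (√(2 * Real.pi) ^ (l ++ (γ.reverse ++ [o, v])).length * Real.Gamma a ^ E.length) *
          decay a ^ γ.length) := by
  by_cases hP : PathIn E v o γ
  swap
  · refine le_of_eq_of_le ?_ zero_le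
    unfold expct
    rw [← itInt_zero E 0]
    simp only [hseg_eq_zero hP, mul_zero, ENNReal.ofReal_zero, itInt_zero]
  have hG := Real.Gamma_pos_of_pos ha
  have hG' := Real.Gamma_pos_of_pos (s := a + 1 / 2) (by positivity)
  have hd := decay_pos ha
  set L := l ++ (γ.reverse ++ [o, v]) with hL
  have hLapp : L = (l ++ γ.reverse) ++ [o, v] := by rw [hL, List.append_assoc]
  have hl2 : (l ++ γ.reverse ++ [o, v]).Nodup := hLapp ▸ hl
  have hdis := List.nodup_append.1 hl2
  have hlγ := List.nodup_append.1 hdis.1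
  have hγn : γ.Nodup := List.nodup_reverse.1 hlγ.2.1
  have hoγ : o ∉ γ := fun h => hdis.2.2 o (by simp [h]) o (by simp) rfl
  have hvγ : v ∉ γ := fun h => hdis.2.2 v (by simp [h]) v (by simp) rfl
  have hov : o ≠ v := by simpa using hdis.2.1
  have hn : (o :: (γ ++ [v])).Nodup := by
    rw [List.nodup_cons, List.nodup_append]
    refine ⟨by simp [hoγ, hov], hγn, by simp, ?_⟩
    rintro x hx z hz rfl
    simp only [List.mem_singleton] at hz
    exact hvγ (hz ▸ hx)
  obtain ⟨mk, hmk, hmk0⟩ := exists_marksPath hγn o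
  have hlmk : ∀ u ∈ l, mk u = none := fun u hu => hmk0 u fun h =>
    hlγ.2.2 u hu u (by simpa using h) rfl
  have homk := hmk0 o hoγ
  have hvmk := hmk0 v hvγ
  set θ := endVec o v with hθ
  have hθ0 : ∀ u, 0 < θ u := endVec_pos o v
  have hθ1 : ∀ u ∈ l ++ γ.reverse, θ u = 1 := by
    intro u hu
    have h2 : u ≠ o := hdis.2.2 u hu o (by simp)
    have h3 : u ≠ v := hdis.2.2 u hu v (by simp)
    simp [hθ, endVec, h2, h3]
  have hθo : θ o = √(1 / 2) := by simp [hθ, endVec]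
  have hθv : θ v = √(1 / 2) := by simp [hθ, endVec]
  have hK : 0 < expConst j := by unfold expConst; positivity
  have hpf : ∀ W : Sym2 V → ℝ, (L.map (pivFactor θ mk (edgeMat E W))).prod =
      ENNReal.ofReal (√(2 * Real.pi) ^ (l.length + 2) * 2) *
        (γ.map (pivFactor θ mk (edgeMat E W))).prod := by
    intro W
    have h1 : l.map (pivFactor θ mk (edgeMat E W)) =
        l.map fun _ => ENNReal.ofReal (√(2 * Real.pi)) :=
      List.map_congr_left fun u hu => by
        simp [pivFactor, hlmk u hu, hθ1 u (by simp [hu])]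
    rw [hL]
    simp only [List.map_append, List.prod_append, List.map_reverse, List.prod_reverse, h1,
      List.map_cons, List.map_nil, pivFactor, homk, hvmk, hθo, hθv, List.prod_cons,
      List.prod_nil, List.map_const', List.prod_replicate, mul_one]
    rw [← ENNReal.ofReal_pow (by positivity), mul_comm (γ.map _).prod, ← mul_assoc,
      ← ENNReal.ofReal_mul (by positivity), ← ENNReal.ofReal_mul (by positivity)]
    congr 2
    have : √(1 / 2 : ℝ) ^ 2 = 1 / 2 := Real.sq_sqrt (by norm_num)
    rw [pow_add, mul_assoc]
    congr 1
    rw [div_mul_div_comm, ← pow_two, ← pow_two, this]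
    ring
  calc _ ≤ itInt E (fun W => ENNReal.ofReal (expConst j * (√(2 * Real.pi) ^ (l.length + 2) * 2)) *
        (E.map fun e => ENNReal.ofReal (W e ^ (a - 1) * Real.exp (-(emul θ e * W e))) *
          edgeFac θ v o γ e (W e)).prod) 0 := by
        refine itInt_mono fun W _ hW => ?_
        have hB := edgeMat_symm E W
        have hB0 : ∀ i j, 0 ≤ edgeMat E W i j := edgeMat_nonneg hW
        have hsp := sqrtPath_nonneg (edgeMat E W) v o γ
        have hA : ∀ e ∈ E, 0 ≤ W e ^ (a - 1) := fun e he => (Real.rpow_pos_of_pos (hW e he) _).le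
        have hmarked := itInt_quad_marked hl hθ0 hB hB0 (mk := mk)
          (markOK_append hlmk (markOK_reverse hW hmk hP (T := [o, v])
            ⟨fun x hx => by simp [homk] at hx, fun x hx => by simp [hvmk] at hx, trivial⟩
            (by simp))) 0
        have hin : itInt L (fun y => ENNReal.ofReal ((L.map fun u => y u ^ (-(1 / 2) : ℝ)).prod *
              Real.exp (-quad (fun _ => 1) L (edgeMat E W) y / 2)) *
              ENNReal.ofReal (bval L (edgeMat E W) y o ^ j * hseg (edgeMat E W) y v o γ)) 0 ≤
            ENNReal.ofReal (expConst j * sqrtPath (edgeMat E W) v o γ) *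
              ((L.map (pivFactor θ mk (edgeMat E W))).prod *
                ENNReal.ofReal (Real.exp (-energy θ L (edgeMat E W) / 2))) := by
          refine le_trans ?_ (mul_le_mul' le_rfl hmarked)
          rw [← itInt_const_mul _ (by simp)]
          refine itInt_mono fun y _ hy => ?_
          have hyγ : ∀ i ∈ γ, 0 < y i := fun i hi => hy i (by simp [hL, hi])
          have hp : 0 ≤ (L.map fun u => y u ^ (-(1 / 2) : ℝ)).prod :=
            list_map_prod_nonneg fun i hi => (Real.rpow_pos_of_pos (hy i hi) _).le
          rw [← ENNReal.ofReal_mul (by positivity), ← ENNReal.ofReal_mul (by positivity)]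
          refine ENNReal.ofReal_le_ofReal ?_
          have h1 := pow_mul_le_exp (bval_pos hB0 hy (x := o) (by simp [hL])).le
            (bval_pos hB0 hy (x := v) (by simp [hL])).le (hseg_nonneg hB0 hyγ v o)
            (hseg_sq_le hl hB hB0 hy) j
          rw [sqrt_hseg hB0 hyγ] at h1
          rw [prod_rpow_pivExp hlmk homk hvmk hmk hyγ, ← hL]
          have h2 := quad_endVec hl2 (edgeMat E W) y
          rw [← hLapp, ← hθ] at h2
          have h3 : Real.exp (-quad θ L (edgeMat E W) y / 2) =
              Real.exp (-quad (fun _ => 1) L (edgeMat E W) y / 2) *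
                Real.exp (bval L (edgeMat E W) y o / 4 + bval L (edgeMat E W) y v / 4) := by
            rw [← Real.exp_add, h2]; congr 1; ring
          rw [h3]
          refine (mul_le_mul_of_nonneg_left h1 (by positivity)).trans_eq ?_
          ring
        refine (mul_le_mul' le_rfl hin).trans_eq ?_
        have hen : Real.exp (-energy θ L (edgeMat E W) / 2) =
            (E.map fun e => Real.exp (-(emul θ e * W e))).prod := by
          rw [energy_edgeMat _ hl hE hEl, show ∀ s : ℝ, -(2 * s) / 2 = -s from fun s => by ring,
            ← list_sum_map_neg, Real.exp_list_sum, List.map_map]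
          simp only [Function.comp_def, mul_comm]
        rw [hpf, List.prod_map_mul, ← sqrtPath_mul_pivFactor hE θ hn hmk hP,
          ← ofReal_list_prod fun e he => mul_nonneg (hA e he) (Real.exp_pos _).le,
          List.prod_map_mul, ← hen, ENNReal.ofReal_mul (list_map_prod_nonneg hA),
          ENNReal.ofReal_mul hK.le, ENNReal.ofReal_mul hK.le]
        ring
    _ = ENNReal.ofReal (expConst j * (√(2 * Real.pi) ^ (l.length + 2) * 2)) *
        (E.map (edgeInt a θ (edgeFac θ v o γ))).prod := by
        rw [itInt_const_mul _ (by simp)]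
        congr 1
        refine itInt_prod hE (fun e t => ENNReal.ofReal (t ^ (a - 1) *
          Real.exp (-(emul θ e * t))) * edgeFac θ v o γ e t)
          (fun e _ t => ENNReal.mul_ne_top (by simp) (edgeFac_ne_top hθ0 v o γ e t)) 0
          fun e _ => edgeInt_ne_top ha hθ0 v o γ e
    _ ≤ _ := by
        rw [prod_edgeInt ha hθ0 hE hn (fun x hx => hθ1 x (by simp [hx])) hP,
          ← ENNReal.ofReal_mul (by positivity)]
        refine ENNReal.ofReal_le_ofReal ?_
        have h1 := prod_emul_endVec_le ha hl2 (hLapp ▸ hEl) ho hv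
        rw [← hθ] at h1
        have h2 : (θ o * θ v) ^ (-(1 / 2) : ℝ) = 2 ^ (1 / 2 : ℝ) := by
          rw [hθo, hθv, Real.mul_self_sqrt (by norm_num), one_div (2 : ℝ),
            Real.inv_rpow (by norm_num), ← Real.rpow_neg (by norm_num), neg_neg]
        have h3 : L.length = l.length + 2 + γ.length := by
          simp [hL]; ring
        rw [List.prod_map_mul, List.map_const', List.prod_replicate, h2, h3, pow_add _ _ γ.length,
          mul_pow, segConst]
        calc _ = expConst j * 2 * (E.map fun e => emul θ e ^ (-a)).prod *
              (Real.Gamma (a + 1 / 2) / Real.Gamma a) * 2 ^ (1 / 2 : ℝ) *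
              (√(2 * Real.pi) ^ (l.length + 2) * √(2 * Real.pi) ^ γ.length *
                Real.Gamma a ^ E.length) * decay a ^ γ.length := by ring
          _ ≤ _ := by gcongr

end SegmentBound

section PathSums

variable {V : Type*}

lemma tsum_list {α : Type*} (f : List α → ℝ≥0∞) :
    ∑' t, f t = f [] + ∑' w, ∑' t, f (w :: t) := by
  have h1 : ({[]}ᶜ : Set (List α)) = Set.range fun p : α × List α => p.1 :: p.2 := by
    ext t
    cases t <;> simp
  have hinj : Function.Injective fun p : α × List α => p.1 :: p.2 := by
    rintro ⟨w, t⟩ ⟨w', t'⟩ h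
    simpa using h
  rw [← ENNReal.summable.tsum_add_tsum_compl (s := {[]}) ENNReal.summable, h1,
    tsum_range (g := fun p : α × List α => p.1 :: p.2) f hinj, ENNReal.tsum_prod',
    tsum_singleton [] f]

/-- A supersolution bounds the sum of multiplicative weights over all lists. -/
lemma tsum_list_le {σ α : Type*} {F : σ → List α → ℝ≥0∞} {K : σ → α → ℝ≥0∞} {next : σ → α → σ}
    (hF : ∀ s w t, F s (w :: t) = K s w * F (next s w) t) {H : σ → ℝ≥0∞}
    (hH : ∀ s, F s [] + ∑' w, K s w * H (next s w) ≤ H s) (s : σ) :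
    ∑' t, F s t ≤ H s := by
  have key : ∀ n s, ∑' t, (if t.length < n then F s t else 0) ≤ H s := by
    intro n
    induction n with
    | zero => simp
    | succ n ih =>
      intro s
      rw [tsum_list]
      refine le_trans ?_ (hH s)
      simp only [List.length_nil, Nat.zero_lt_succ, if_true, List.length_cons, Nat.add_lt_add_iff_right]
      gcongr with w
      calc ∑' t, (if t.length < n then F s (w :: t) else 0)
          = ∑' t, K s w * (if t.length < n then F (next s w) t else 0) := by
            simp only [hF, mul_ite, mul_zero]
        _ = K s w * ∑' t, (if t.length < n then F (next s w) t else 0) := ENNReal.tsum_mul_left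
        _ ≤ _ := by gcongr; exact ih _
  rw [ENNReal.tsum_eq_iSup_sum]
  refine iSup_le fun A => ?_
  refine le_trans ?_ (key (A.sup List.length + 1) s)
  refine le_trans (le_of_eq ?_) (ENNReal.sum_le_tsum A)
  refine Finset.sum_congr rfl fun t ht => ?_
  rw [if_pos (Nat.lt_succ_of_le (Finset.le_sup (f := List.length) ht))]

lemma tsum_ite_le_of_cover {α β γ : Type*} {Q : α → Prop} [DecidablePred Q]
    {R : β → γ → Prop} [∀ y z, Decidable (R y z)] {f : α → ℝ≥0∞}
    {m : β → γ → α} (h : ∀ x, Q x → ∃ y z, R y z ∧ m y z = x) :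
    ∑' x, (if Q x then f x else 0) ≤ ∑' y, ∑' z, if R y z then f (m y z) else 0 := by
  choose Y Z hR hm using h
  rw [← ENNReal.tsum_prod]
  have h1 : ∑' x, (if Q x then f x else 0) = ∑' x : {x // Q x}, f x := by
    rw [← tsum_subtype_eq_of_support_subset (s := {x | Q x})]
    · exact tsum_congr fun x => if_pos x.2
    · intro x hx
      by_contra hq
      exact hx (if_neg hq)
  rw [h1]
  have hinj : Function.Injective fun x : {x // Q x} => (Y x x.2, Z x x.2) := by
    intro x x' hxx
    simp only [Prod.mk.injEq] at hxx
    ext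
    rw [← hm x x.2, ← hm x' x'.2, hxx.1, hxx.2]
  refine le_trans (le_of_eq ?_) (ENNReal.tsum_comp_le_tsum_of_injective hinj _)
  refine tsum_congr fun x => ?_
  simp only
  rw [if_pos (hR x x.2), hm x x.2]

/-- Weight of the path `prev, π, v` with edge weights `β` and vertex weights `g` on `π`. -/
noncomputable def sWt (β : V → V → ℝ≥0∞) (g : V → ℝ≥0∞) (v : V) : V → List V → ℝ≥0∞
  | prev, [] => β prev v
  | prev, x :: π => β prev x * g x * sWt β g v x π

/-- Weight of the walk `z :: t`. -/
noncomputable def walkWt (β : V → V → ℝ≥0∞) (g : V → ℝ≥0∞) : V → List V → ℝ≥0∞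
  | z, [] => g z
  | z, w :: t => g z * β z w * walkWt β g w t

/-- The walk `z :: t` ends at `x` and `t` stays in `S`. -/
def EndsIn (x : V) (S : Set V) : V → List V → Prop
  | z, [] => z = x
  | _, w :: t => w ∈ S ∧ EndsIn x S w t

lemma mul_sWt_append (β : V → V → ℝ≥0∞) (g : V → ℝ≥0∞) (v : V) {x z : V} {S : Set V} {t : List V}
    (h : EndsIn x S z t) (π : List V) :
    g z * sWt β g v z (t ++ π) = walkWt β g z t * sWt β g v x π := by
  induction t generalizing z with
  | nil => cases h; rfl
  | cons w t ih =>
    rw [List.cons_append, sWt, walkWt, mul_assoc (β z w), ih h.2]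
    ring

/-- `γ` arises from the walk `π` in `S` by erasing, successively, the loops up to the last visit. -/
def Erases : Set V → List V → List V → Prop
  | _, [], π => π = []
  | S, x :: γ, π => x ∈ S ∧ ∃ t π', EndsIn x S x t ∧ Erases (S \ {x}) γ π' ∧ x :: t ++ π' = π

lemma exists_last_visit {x z : V} {S : Set V} {t : List V} (hS : ∀ w ∈ t, w ∈ S) (hx : x ∈ z :: t) :
    ∃ t₁ π, EndsIn x S z t₁ ∧ x ∉ π ∧ z :: t₁ ++ π = z :: t := by
  induction t generalizing z with
  | nil =>
    obtain rfl : x = z := by simpa using hx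
    exact ⟨[], [], rfl, by simp, rfl⟩
  | cons w t ih =>
    by_cases h : x ∈ w :: t
    · obtain ⟨t₁, π, h1, h2, h3⟩ := ih (fun u hu => hS u (List.mem_cons_of_mem _ hu)) h
      exact ⟨w :: t₁, π, ⟨hS w (by simp), h1⟩, h2, by rw [← h3]; rfl⟩
    · obtain rfl : x = z := (List.mem_cons.1 hx).resolve_right h
      exact ⟨[], w :: t, rfl, h, rfl⟩

lemma exists_erases {S : Set V} {π : List V} (hS : ∀ w ∈ π, w ∈ S) : ∃ γ, Erases S γ π := by
  induction hn : π.length using Nat.strong_induction_on generalizing S π with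
  | _ n ih =>
    cases π with
    | nil => exact ⟨[], rfl⟩
    | cons x t =>
      obtain ⟨t₁, π, h1, h2, h3⟩ := exists_last_visit (x := x) (z := x) (t := t)
        (fun w hw => hS w (List.mem_cons_of_mem _ hw)) (by simp)
      have h4 : ∀ w ∈ π, w ∈ S \ {x} := fun w hw =>
        ⟨hS w (by rw [← h3]; simp [hw]), fun hwx => h2 (Set.mem_singleton_iff.1 hwx ▸ hw)⟩
      have hlt : π.length < n := by
        rw [← hn, ← h3]; simp
      obtain ⟨γ, hγ⟩ := ih _ hlt h4 rfl
      exact ⟨x :: γ, hS x (by simp), t₁, π, h1, hγ, h3⟩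

lemma Erases.subset {S : Set V} {γ π : List V} (h : Erases S γ π) : ∀ x ∈ γ, x ∈ S := by
  induction γ generalizing S π with
  | nil => simp
  | cons x γ ih =>
    obtain ⟨hx, t, π', -, h2, -⟩ := h
    intro w hw
    rcases List.mem_cons.1 hw with rfl | hw
    · exact hx
    · exact (ih h2 w hw).1

lemma Erases.nodup {S : Set V} {γ π : List V} (h : Erases S γ π) : γ.Nodup := by
  induction γ generalizing S π with
  | nil => simp
  | cons x γ ih =>
    obtain ⟨hx, t, π', -, h2, -⟩ := h
    exact List.nodup_cons.2 ⟨fun hw => (h2.subset x hw).2 rfl, ih h2⟩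

variable [DecidableEq V]

/-- A supersolution bounds the sum over all walks in `S` from `z` to `x`. -/
lemma tsum_walkWt_le {β : V → V → ℝ≥0∞} {g h : V → ℝ≥0∞} {x : V} {S : Set V}
    (hh : ∀ z ∈ S, g z * ((if z = x then 1 else 0) + ∑' w, if w ∈ S then β z w * h w else 0) ≤ h z)
    {z : V} (hz : z ∈ S) :
    ∑' t, (if EndsIn x S z t then walkWt β g z t else 0) ≤ h z := by
  have key := tsum_list_le (F := fun z t => if EndsIn x S z t then walkWt β g z t else 0)
    (K := fun z w => if w ∈ S then g z * β z w else 0) (next := fun _ w => w)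
    (H := fun z => if z ∈ S then h z else ⊤) (fun z w t => by
      simp only [EndsIn, walkWt, ite_mul, zero_mul, mul_ite, mul_zero]
      by_cases h1 : w ∈ S <;> by_cases h2 : EndsIn x S w t <;> simp [h1, h2]) (fun z => by
      by_cases hz : z ∈ S
      · rw [if_pos hz]
        refine le_trans (le_of_eq ?_) (hh z hz)
        rw [mul_add, ← ENNReal.tsum_mul_left]
        congr 1
        · by_cases hx : z = x <;> simp [EndsIn, walkWt, hx]
        · refine tsum_congr fun w => ?_
          split_ifs <;> simp [mul_assoc]
      · rw [if_neg hz]; exact le_top) z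
  simpa only [if_pos hz] using key

/-- A supersolution bounds the sum over all loops in `S` with a given number of visits to `o`. -/
lemma tsum_walkWt_count_le {β : V → V → ℝ≥0∞} {g h : V → ℝ≥0∞} {o : V} {S : Set V}
    (hh : ∀ z ∈ S, g z * ∑' w, (if w ∈ S then β z w * h w else 0) ≤ h z)
    (hg : g o ≤ h o) (ho : o ∈ S) (k : ℕ) :
    ∑' t, (if EndsIn o S o t ∧ (o :: t).count o = k then walkWt β g o t else 0) ≤ h o := by
  have key := tsum_list_le
    (F := fun (p : V × ℕ) t =>
      if EndsIn o S p.1 t ∧ (p.1 :: t).count o = p.2 then walkWt β g p.1 t else 0)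
    (K := fun p w => if w ∈ S ∧ ¬ (p.1 = o ∧ p.2 = 0) then g p.1 * β p.1 w else 0)
    (next := fun p w => (w, if p.1 = o then p.2 - 1 else p.2))
    (H := fun p => if p.1 ∈ S then if p.2 = 0 then 0 else h p.1 else ⊤) ?_ ?_ (o, k)
  · refine key.trans ?_
    simp only [if_pos ho]
    split_ifs <;> simp
  · rintro ⟨z, k⟩ w t
    simp only [EndsIn, walkWt]
    have hc := List.count_cons (a := o) (b := z) (l := w :: t)
    by_cases h1 : w ∈ S <;> by_cases h2 : EndsIn o S w t <;> simp only [h1, h2, true_and, false_and,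
      and_false, if_false, mul_zero, zero_mul]
    by_cases hz : z = o
    · simp only [hz, beq_self_eq_true, if_true, true_and] at hc ⊢
      by_cases hk : k = 0
      · simp [hk, hc]
      · by_cases h3 : (w :: t).count o = k - 1
        · rw [if_pos (by omega), if_pos hk, if_pos h3]
        · rw [if_neg (by omega), if_neg h3, mul_zero]
    · simp only [hz, beq_iff_eq, if_false, false_and, not_false_iff, if_true, add_zero] at hc ⊢
      rw [hc]
      by_cases h3 : (w :: t).count o = k <;> simp [h3]
  · rintro ⟨z, k⟩
    dsimp only
    by_cases hz : z ∈ S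
    swap
    · simp [hz]
    rw [if_pos hz]
    by_cases hzo : z = o
    · subst hzo
      rcases k with _ | _ | k
      · simp
      · simp only [zero_add, EndsIn, List.count_cons_self, List.count_nil, and_true, if_true, walkWt,
          Nat.sub_self]
        refine (add_le_add hg (le_of_eq ?_)).trans (add_zero _).le
        refine ENNReal.tsum_eq_zero.2 fun w => ?_
        split_ifs <;> simp_all
      · refine le_trans (le_of_eq ?_) (hh z hz)
        simp only [EndsIn, List.count_cons_self, List.count_nil]
        rw [← ENNReal.tsum_mul_left, if_neg (by omega), zero_add]
        refine tsum_congr fun w => ?_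
        split_ifs <;> simp_all [mul_assoc]
    · simp only [EndsIn, hzo, false_and, if_false, zero_add, not_false_iff, and_true]
      split_ifs with hk
      · refine le_of_eq (ENNReal.tsum_eq_zero.2 fun w => ?_)
        split_ifs <;> simp
      · refine le_trans (le_of_eq ?_) (hh z hz)
        rw [← ENNReal.tsum_mul_left]
        refine tsum_congr fun w => ?_
        split_ifs <;> simp_all [mul_assoc]

end PathSums

section PathBounds

variable {V : Type*}

variable [DecidableEq V]

/-- The column at `x` of the Green function of the vertices up to `x` in elimination order. -/
lemma exists_green {p rest : List V} {x : V} (hl : (p ++ x :: rest).Nodup) {B : V → V → ℝ}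
    (hB : ∀ i j, 0 ≤ B i j) {y : V → ℝ} (hy : ∀ i ∈ p ++ [x], 0 < y i) :
    ∃ h : V → ℝ, (∀ z, 0 ≤ h z) ∧ h x = 1 / y x ∧ ∀ z ∈ p ++ [x],
      (if z = x then 1 else 0) + ((p ++ [x]).map fun w => B z w * h w).sum =
        bval (p ++ x :: rest) B y z * h z := by
  induction p generalizing B with
  | nil =>
    have hx : 0 < y x := hy x (by simp)
    refine ⟨fun z => if z = x then 1 / y x else 0, fun z => ?_, if_pos rfl, fun z hz => ?_⟩
    · dsimp only; split_ifs <;> positivity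
    · obtain rfl : z = x := by simpa using hz
      simp [bval]
      field_simp
  | cons u p ih =>
    have hu : 0 < y u := hy u (by simp)
    have hl' := List.nodup_cons.1 hl
    obtain ⟨h, h0, hx, hh⟩ := ih hl'.2 (B := sch B u (y u)) (sch_nonneg hB hu)
      (fun i hi => hy i (List.mem_cons_of_mem _ hi))
    have hup : u ∉ p ++ [x] := fun hm => hl'.1 (by
      rcases List.mem_append.1 hm with hm | hm
      · simp [hm]
      · simp [List.mem_singleton.1 hm])
    have hxu : x ≠ u := fun h => hup (by simp [h])
    set s := ((p ++ [x]).map fun w => B u w * h w).sum with hs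
    have hs0 : 0 ≤ s := List.sum_nonneg (by
      intro z hz
      obtain ⟨w, -, rfl⟩ := List.mem_map.1 hz
      exact mul_nonneg (hB _ _) (h0 _))
    have hmap : ∀ z, ((p ++ [x]).map fun w => B z w * Function.update h u (s / y u) w).sum =
        ((p ++ [x]).map fun w => B z w * h w).sum := fun z => by
      congr 1
      refine List.map_congr_left fun w hw => ?_
      have hwu : w ≠ u := by rintro rfl; exact hup hw
      rw [Function.update_of_ne hwu]
    refine ⟨Function.update h u (s / y u), fun z => ?_, ?_, fun z hz => ?_⟩
    · by_cases hz : z = u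
      · subst hz; simp; positivity
      · simp [hz, h0]
    · rw [Function.update_of_ne hxu, hx]
    · rw [List.cons_append, List.map_cons, List.sum_cons, hmap, Function.update_self,
        List.cons_append, bval]
      by_cases hzu : z = u
      · subst hzu
        rw [if_neg hxu.symm, if_pos rfl, Function.update_self, ← hs]
        field_simp
        ring
      · have hz' : z ∈ p ++ [x] := (List.mem_cons.1 hz).resolve_left hzu
        rw [if_neg hzu, Function.update_of_ne hzu, ← hh z hz']
        have : ((p ++ [x]).map fun w => sch B u (y u) z w * h w).sum =
            ((p ++ [x]).map fun w => B z w * h w).sum + B z u / y u * s := by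
          rw [hs, ← List.sum_map_mul_left, ← List.sum_map_add]
          congr 1
          refine List.map_congr_left fun w _ => ?_
          simp only [sch]; ring
        rw [this]; ring

lemma tsum_ite_mem_le {l : List V} (hl : l.Nodup) {S : Set V} (hS : ∀ w ∈ S, w ∈ l) {f : V → ℝ}
    (hf : ∀ w, 0 ≤ f w) :
    ∑' w, (if w ∈ S then ENNReal.ofReal (f w) else 0) ≤ ENNReal.ofReal (l.map f).sum := by
  rw [← List.sum_toFinset _ hl, ENNReal.ofReal_sum_of_nonneg fun w _ => hf w,
    tsum_eq_sum (s := l.toFinset)]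
  · refine Finset.sum_le_sum fun w _ => ?_
    split_ifs
    · exact le_rfl
    · exact zero_le
  · intro w hw
    rw [if_neg fun h => hw (by simpa using hS w h)]

variable {p rest : List V} {x : V} {B : V → V → ℝ} {y : V → ℝ} {S : Set V}

lemma tsum_walkWt_le_inv (hl : (p ++ x :: rest).Nodup) (hB : ∀ i j, 0 ≤ B i j)
    (hy : ∀ i ∈ p ++ x :: rest, 0 < y i) (hS : ∀ w ∈ S, w ∈ p ++ [x]) (hx : x ∈ S) :
    ∑' t, (if EndsIn x S x t then walkWt (fun i j => ENNReal.ofReal (B i j))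
      (fun i => ENNReal.ofReal (1 / bval (p ++ x :: rest) B y i)) x t else 0) ≤
        ENNReal.ofReal (1 / y x) := by
  have hsub : ∀ i ∈ p ++ [x], i ∈ p ++ x :: rest := fun i hi => by
    simp only [List.mem_append, List.mem_cons, List.not_mem_nil, or_false] at hi ⊢; tauto
  obtain ⟨h, h0, hx', hh⟩ := exists_green hl hB (fun i hi => hy i (hsub i hi))
  rw [← hx']
  refine tsum_walkWt_le (h := fun z => ENNReal.ofReal (h z)) (fun z hz => ?_) hx
  have hb := bval_pos hB hy (hsub z (hS z hz))
  have h1 := tsum_ite_mem_le (l := p ++ [x]) (hl.sublist (by simp)) hS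
    (f := fun w => B z w * h w) (fun w => mul_nonneg (hB _ _) (h0 _))
  simp only [← ENNReal.ofReal_mul (hB _ _)]
  refine (mul_le_mul_right (add_le_add_right h1 _) _).trans (le_of_eq ?_)
  have h2 : (if z = x then (1 : ℝ≥0∞) else 0) = ENNReal.ofReal (if z = x then 1 else 0) := by
    split_ifs <;> simp
  rw [h2, ← ENNReal.ofReal_add (by split_ifs <;> simp) (List.sum_nonneg (by
      intro z hz
      obtain ⟨w, -, rfl⟩ := List.mem_map.1 hz
      exact mul_nonneg (hB _ _) (h0 _))), hh z (hS z hz), ← ENNReal.ofReal_mul (by positivity)]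
  congr 1
  field_simp

lemma tsum_walkWt_count_le_inv (hl : (p ++ x :: rest).Nodup) (hB : ∀ i j, 0 ≤ B i j)
    (hy : ∀ i ∈ p ++ x :: rest, 0 < y i) (hS : ∀ w ∈ S, w ∈ p ++ [x]) (hx : x ∈ S) (k : ℕ) :
    ∑' t, (if EndsIn x S x t ∧ (x :: t).count x = k then
      walkWt (fun i j => ENNReal.ofReal (B i j))
        (fun i => ENNReal.ofReal (1 / bval (p ++ x :: rest) B y i)) x t else 0) ≤
        ENNReal.ofReal (1 / bval (p ++ x :: rest) B y x) := by
  have hsub : ∀ i ∈ p ++ [x], i ∈ p ++ x :: rest := fun i hi => by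
    simp only [List.mem_append, List.mem_cons, List.not_mem_nil, or_false] at hi ⊢; tauto
  obtain ⟨h, h0, hx', hh⟩ := exists_green hl hB (fun i hi => hy i (hsub i hi))
  have hyx : 0 < y x := hy x (by simp)
  have hxpos : 0 < h x := by rw [hx']; positivity
  have hbx := bval_pos hB hy (x := x) (by simp)
  set b := bval (p ++ x :: rest) B y with hb_def
  have key := tsum_walkWt_count_le (β := fun i j => ENNReal.ofReal (B i j))
    (g := fun i => ENNReal.ofReal (1 / b i)) (h := fun z => ENNReal.ofReal (h z / (b x * h x)))
    (S := S) (o := x) (fun z hz => ?_) (le_of_eq ?_) hx k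
  · refine key.trans (le_of_eq ?_)
    congr 1; field_simp
  · have hb := bval_pos hB hy (hsub z (hS z hz))
    rw [← hb_def] at hb
    have h1 := tsum_ite_mem_le (l := p ++ [x]) (hl.sublist (by simp)) hS
      (f := fun w => B z w * (h w / (b x * h x)))
      (fun w => mul_nonneg (hB _ _) (div_nonneg (h0 _) (by positivity)))
    simp only [← ENNReal.ofReal_mul (hB _ _)]
    refine (mul_le_mul_right h1 _).trans ?_
    rw [← ENNReal.ofReal_mul (by positivity)]
    refine ENNReal.ofReal_le_ofReal ?_
    have h3 : ((p ++ [x]).map fun w => B z w * (h w / (b x * h x))).sum =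
        ((p ++ [x]).map fun w => B z w * h w).sum / (b x * h x) := by
      rw [div_eq_mul_inv, ← List.sum_map_mul_right]
      congr 1
      refine List.map_congr_left fun w _ => by ring
    have h4 : ((p ++ [x]).map fun w => B z w * h w).sum ≤ b z * h z := by
      rw [← hh z (hS z hz)]
      split_ifs <;> simp
    rw [h3]
    calc 1 / b z * (((p ++ [x]).map fun w => B z w * h w).sum / (b x * h x))
        ≤ 1 / b z * (b z * h z / (b x * h x)) := by gcongr
      _ = _ := by field_simp
  · congr 1; field_simp

lemma tsum_sWt_erases_le {p γ rest : List V} {S : Set V} {v prev : V}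
    (hl : (p ++ (γ.reverse ++ rest)).Nodup) (hB : ∀ i j, 0 ≤ B i j)
    (hy : ∀ i ∈ p ++ (γ.reverse ++ rest), 0 < y i) (hS : ∀ w ∈ S, w ∈ p ++ γ.reverse) :
    ∑' π, (if Erases S γ π then sWt (fun i j => ENNReal.ofReal (B i j))
      (fun i => ENNReal.ofReal (1 / bval (p ++ (γ.reverse ++ rest)) B y i)) v prev π else 0) ≤
        ENNReal.ofReal (hseg B y v prev γ) := by
  induction γ generalizing rest S prev with
  | nil =>
    rw [tsum_eq_single []]
    · simp [Erases, sWt, hseg]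
    · intro π hπ
      rw [if_neg (show ¬ Erases S [] π from hπ)]
  | cons x γ ih =>
    have he : p ++ ((x :: γ).reverse ++ rest) = p ++ (γ.reverse ++ (x :: rest)) := by simp
    have he' : p ++ ((x :: γ).reverse ++ rest) = (p ++ γ.reverse) ++ x :: rest := by simp
    by_cases hx : x ∈ S
    swap
    · simp [Erases, hx]
    set g : V → ℝ≥0∞ := fun i => ENNReal.ofReal (1 / bval (p ++ ((x :: γ).reverse ++ rest)) B y i)
      with hg
    have h1 := tsum_ite_le_of_cover (Q := Erases S (x :: γ))
      (R := fun t π' => EndsIn x S x t ∧ Erases (S \ {x}) γ π') (m := fun t π' => x :: t ++ π')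
      (f := sWt (fun i j => ENNReal.ofReal (B i j)) g v prev)
      (fun π hπ => by
        obtain ⟨-, t, π', h1, h2, h3⟩ := hπ
        exact ⟨t, π', ⟨h1, h2⟩, h3⟩)
    refine h1.trans ?_
    have h2 : ∀ t π', (if EndsIn x S x t ∧ Erases (S \ {x}) γ π' then
        sWt (fun i j => ENNReal.ofReal (B i j)) g v prev (x :: t ++ π') else 0) =
        ENNReal.ofReal (B prev x) *
        ((if EndsIn x S x t then walkWt (fun i j => ENNReal.ofReal (B i j)) g x t else 0) *
        (if Erases (S \ {x}) γ π' then sWt (fun i j => ENNReal.ofReal (B i j)) g v x π' else 0)) := by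
      intro t π'
      by_cases ht : EndsIn x S x t
      · by_cases hπ : Erases (S \ {x}) γ π'
        · rw [if_pos ⟨ht, hπ⟩, if_pos ht, if_pos hπ, ← mul_sWt_append _ _ _ ht, List.cons_append,
            sWt, mul_assoc]
        · simp [hπ]
      · simp [ht]
    simp only [h2, ENNReal.tsum_mul_left, ENNReal.tsum_mul_right]
    have hyx : 0 < y x := hy x (by simp)
    rw [hseg, ENNReal.ofReal_mul (by have := hB prev x; positivity), div_eq_mul_one_div,
      ENNReal.ofReal_mul (hB _ _), mul_assoc]
    gcongr
    · rw [hg, he']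
      exact tsum_walkWt_le_inv (he' ▸ hl) hB (he' ▸ hy) (by simpa using hS) hx
    · rw [hg, he]
      refine ih (he ▸ hl) (he ▸ hy) fun w hw => ?_
      have := hS w hw.1
      have hwx : w ≠ x := hw.2
      simpa [hwx] using this

/-- The tail `t` of a walk from `o` in `S` visiting `o` exactly `k` times erases to `γ`. -/
def ErasesFrom (S : Set V) (o : V) (k : ℕ) (γ t : List V) : Prop :=
  ∃ t₁ π, (EndsIn o S o t₁ ∧ (o :: t₁).count o = k) ∧ Erases (S \ {o}) γ π ∧ t₁ ++ π = t

lemma tsum_sWt_erasesFrom_le {p γ rest : List V} {S : Set V} {o v : V}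
    (hl : (p ++ (γ.reverse ++ o :: rest)).Nodup) (hB : ∀ i j, 0 ≤ B i j)
    (hy : ∀ i ∈ p ++ (γ.reverse ++ o :: rest), 0 < y i) (hS : ∀ w ∈ S, w ∈ p ++ γ.reverse ++ [o])
    (ho : o ∈ S) (k : ℕ) :
    ∑' t, (if ErasesFrom S o k γ t then
      ENNReal.ofReal (1 / bval (p ++ (γ.reverse ++ o :: rest)) B y o) *
      sWt (fun i j => ENNReal.ofReal (B i j))
      (fun i => ENNReal.ofReal (1 / bval (p ++ (γ.reverse ++ o :: rest)) B y i)) v o t else 0) ≤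
        ENNReal.ofReal (1 / bval (p ++ (γ.reverse ++ o :: rest)) B y o) *
          ENNReal.ofReal (hseg B y v o γ) := by
  have he : p ++ (γ.reverse ++ o :: rest) = (p ++ γ.reverse) ++ o :: rest := by simp
  set g : V → ℝ≥0∞ := fun i => ENNReal.ofReal (1 / bval (p ++ (γ.reverse ++ o :: rest)) B y i)
    with hg
  have h1 := tsum_ite_le_of_cover (Q := ErasesFrom S o k γ)
    (R := fun t π' => (EndsIn o S o t ∧ (o :: t).count o = k) ∧ Erases (S \ {o}) γ π')
    (m := fun t π' => t ++ π')
    (f := fun t => g o * sWt (fun i j => ENNReal.ofReal (B i j)) g v o t)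
    (fun π hπ => by
      obtain ⟨t, π', h1, h2, h3⟩ := hπ
      exact ⟨t, π', ⟨h1, h2⟩, h3⟩)
  refine h1.trans ?_
  have h2 : ∀ t π', (if (EndsIn o S o t ∧ (o :: t).count o = k) ∧ Erases (S \ {o}) γ π' then
      g o * sWt (fun i j => ENNReal.ofReal (B i j)) g v o (t ++ π') else 0) =
      ((if EndsIn o S o t ∧ (o :: t).count o = k then
        walkWt (fun i j => ENNReal.ofReal (B i j)) g o t else 0) *
      (if Erases (S \ {o}) γ π' then sWt (fun i j => ENNReal.ofReal (B i j)) g v o π' else 0)) := by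
    intro t π'
    by_cases ht : EndsIn o S o t ∧ (o :: t).count o = k
    · by_cases hπ : Erases (S \ {o}) γ π'
      · rw [if_pos ⟨ht, hπ⟩, if_pos ht, if_pos hπ, mul_sWt_append _ _ _ ht.1]
      · simp [hπ]
    · rw [if_neg fun h => ht h.1, if_neg ht, zero_mul]
  simp only [h2, ENNReal.tsum_mul_left, ENNReal.tsum_mul_right]
  gcongr
  · rw [hg, he]
    exact tsum_walkWt_count_le_inv (he ▸ hl) hB (he ▸ hy) hS ho k
  · refine tsum_sWt_erases_le hl hB hy fun w hw => ?_
    have := hS w hw.1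
    have hwx : w ≠ o := hw.2
    simpa [hwx] using this

end PathBounds

section PathExpectation

variable {V : Type*}

lemma exists_erasesFrom {S : Set V} {o : V} {t : List V} (ht : ∀ w ∈ t, w ∈ S) :
    ∃ γ, ∃ t₁ π, EndsIn o S o t₁ ∧ o ∉ π ∧ Erases (S \ {o}) γ π ∧ t₁ ++ π = t := by
  obtain ⟨t₁, π, h1, h2, h3⟩ := exists_last_visit (x := o) (z := o) ht (by simp)
  have h4 : t₁ ++ π = t := by simpa using h3
  obtain ⟨γ, hγ⟩ := exists_erases (S := S \ {o}) (π := π) fun w hw =>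
    ⟨ht w (by rw [← h4]; simp [hw]), fun hwo => h2 (Set.mem_singleton_iff.1 hwo ▸ hw)⟩
  exact ⟨γ, t₁, π, h1, h2, hγ, h4⟩

lemma EdgesIn.perm {E : List (Sym2 V)} {l l' : List V} (h : EdgesIn E l) (hl : l'.Perm l) :
    EdgesIn E l' :=
  fun e he => ⟨(h e he).1, fun x hx => hl.mem_iff.2 ((h e he).2 x hx)⟩

variable [DecidableEq V]

lemma exists_erasesFrom_count {S : Set V} {o : V} {t : List V} (ht : ∀ w ∈ t, w ∈ S) :
    ∃ γ, ErasesFrom S o ((o :: t).count o) γ t := by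
  obtain ⟨γ, t₁, π, h1, h2, h3, h4⟩ := exists_erasesFrom (o := o) ht
  refine ⟨γ, t₁, π, ⟨h1, ?_⟩, h3, h4⟩
  rw [← h4, ← List.cons_append, List.count_append, List.count_eq_zero_of_not_mem h2, add_zero]

lemma expct_mono {a : ℝ} {E : List (Sym2 V)} {l : List V} {F G : (Sym2 V → ℝ) → (V → ℝ) → ℝ≥0∞}
    (h : ∀ W y, (∀ e ∈ E, 0 < W e) → (∀ i ∈ l, 0 < y i) → F W y ≤ G W y) :
    expct a E l F ≤ expct a E l G := by
  refine itInt_mono fun W _ hW => ?_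
  gcongr
  refine itInt_mono fun y _ hy => ?_
  gcongr
  exact h W y hW hy

lemma expct_zero (a : ℝ) (E : List (Sym2 V)) (l : List V) : expct a E l (fun _ _ => 0) = 0 := by
  simp [expct, itInt_zero]

lemma expct_tsum_le {α : Type*} (a : ℝ) (E : List (Sym2 V)) (l : List V)
    (F : α → (Sym2 V → ℝ) → (V → ℝ) → ℝ≥0∞) :
    ∑' k, expct a E l (F k) ≤ expct a E l (fun W y => ∑' k, F k W y) := by
  refine (itInt_tsum_le _ _ _).trans (itInt_mono fun W _ _ => ?_)
  rw [ENNReal.tsum_mul_left]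
  gcongr
  refine (itInt_tsum_le _ _ _).trans (itInt_mono fun y _ _ => ?_)
  rw [ENNReal.tsum_mul_left]

/-- The weight of the walk `o :: t` ended at `v`, in the random environment. -/
noncomputable def pathWt (E : List (Sym2 V)) (l : List V) (o v : V) (t : List V)
    (W : Sym2 V → ℝ) (y : V → ℝ) : ℝ≥0∞ :=
  ENNReal.ofReal (1 / bval l (edgeMat E W) y o) *
    sWt (fun i j => ENNReal.ofReal (edgeMat E W i j))
      (fun i => ENNReal.ofReal (1 / bval l (edgeMat E W) y i)) v o t

lemma elimOrder_perm {Λ γ : List V} (hΛ : Λ.Nodup) {o v : V} (ho : o ∈ Λ) (hv : v ∈ Λ) (hov : o ≠ v)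
    (hγ : γ.Nodup) (hγΛ : ∀ x ∈ γ, x ∈ Λ ∧ x ≠ o ∧ x ≠ v) :
    (Λ.filter (fun x => x ≠ o ∧ x ≠ v ∧ x ∉ γ) ++ (γ.reverse ++ [o, v])).Perm Λ := by
  have h2 : (γ.reverse ++ [o, v]).Nodup := by
    refine List.nodup_append.2 ⟨List.nodup_reverse.2 hγ, by simp [hov], ?_⟩
    intro x hx z hz
    have := hγΛ x (by simpa using hx)
    rintro rfl
    simp at hz
    tauto
  refine (List.perm_ext_iff_of_nodup (List.nodup_append.2 ⟨hΛ.filter _, h2, ?_⟩) hΛ).2 ?_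
  · intro x hx z hz
    rintro rfl
    simp at hx hz
    tauto
  · intro x
    simp only [List.mem_append, List.mem_filter, List.mem_reverse, List.mem_cons, List.not_mem_nil,
      or_false, decide_eq_true_eq]
    constructor
    · rintro (h | h | rfl | rfl)
      exacts [h.1, (hγΛ x h).1, ho, hv]
    · intro h
      tauto

lemma tsum_le_of_expct {a : ℝ} (ha : 0 < a) {E : List (Sym2 V)} (hE : E.Nodup) {Λ : List V}
    (hΛ : Λ.Nodup) (hEΛ : EdgesIn E Λ) {o v : V} (ho : o ∈ Λ) (hv : v ∈ Λ) (hov : o ≠ v)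
    (hdo : (E.filter (o ∈ ·)).length ≤ 4) (hdv : (E.filter (v ∈ ·)).length ≤ 4) {S : Set V}
    (hS : ∀ w ∈ S, w ∈ Λ ∧ w ≠ v) (hoS : o ∈ S) (j : ℕ) {pr : List V → ℝ≥0∞} {c : ℝ} (hc : 0 ≤ c)
    (hpr : ∀ l : List V, l.Perm Λ → ∀ t, (∀ w ∈ t, w ∈ S) → (o :: t).count o = j + 1 →
      pr t ≤ ENNReal.ofReal (c / (√(2 * Real.pi) ^ l.length * Real.Gamma a ^ E.length)) *
        expct a E l (fun W y => ENNReal.ofReal (bval l (edgeMat E W) y o ^ (j + 1)) *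
          pathWt E l o v t W y)) :
    ∑' t, (if (∀ w ∈ t, w ∈ S) ∧ (o :: t).count o = j + 1 then pr t else 0) ≤
      ∑' γ, if γ.Nodup ∧ (∀ x ∈ γ, x ∈ S ∧ x ≠ o) ∧ PathIn E v o γ then
        ENNReal.ofReal (c * segConst a j * decay a ^ γ.length) else 0 := by
  have hcover := tsum_ite_le_of_cover (f := pr)
    (Q := fun t : List V => (∀ w ∈ t, w ∈ S) ∧ (o :: t).count o = j + 1)
    (R := fun γ t => ErasesFrom S o (j + 1) γ t ∧ (∀ w ∈ t, w ∈ S) ∧ (o :: t).count o = j + 1)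
    (m := fun _ t => t) (fun t ht => by
      obtain ⟨γ, hγ⟩ := exists_erasesFrom_count (o := o) ht.1
      exact ⟨γ, t, ⟨ht.2 ▸ hγ, ht⟩, rfl⟩)
  refine hcover.trans (ENNReal.tsum_le_tsum fun γ => ?_)
  by_cases hγ : γ.Nodup ∧ ∀ x ∈ γ, x ∈ S ∧ x ≠ o
  swap
  · refine le_trans (le_of_eq (ENNReal.tsum_eq_zero.2 fun t => if_neg ?_)) zero_le
    rintro ⟨⟨-, π, -, h, -⟩, -⟩
    exact hγ ⟨h.nodup, fun x hx => ⟨(h.subset x hx).1, (h.subset x hx).2⟩⟩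
  set p := Λ.filter (fun x => x ≠ o ∧ x ≠ v ∧ x ∉ γ) with hp
  have hperm := elimOrder_perm hΛ ho hv hov hγ.1 fun x hx =>
    ⟨(hS x (hγ.2 x hx).1).1, (hγ.2 x hx).2, (hS x (hγ.2 x hx).1).2⟩
  rw [← hp] at hperm
  have hnd := (hperm.nodup_iff).2 hΛ
  have hEl := hEΛ.perm hperm
  set l := p ++ (γ.reverse ++ [o, v]) with hl
  have hSl : ∀ w ∈ S, w ∈ p ++ γ.reverse ++ [o] := fun w hw => by
    have h1 := hperm.mem_iff.2 (hS w hw).1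
    have h2 := (hS w hw).2
    simp only [hl, List.mem_append, List.mem_cons, List.not_mem_nil, or_false] at h1 ⊢
    tauto
  have hC : 0 ≤ c / (√(2 * Real.pi) ^ l.length * Real.Gamma a ^ E.length) := by
    have := Real.Gamma_pos_of_pos ha
    positivity
  set C := c / (√(2 * Real.pi) ^ l.length * Real.Gamma a ^ E.length) with hCdef
  have hstep : ∑' t, (if ErasesFrom S o (j + 1) γ t ∧ (∀ w ∈ t, w ∈ S) ∧ (o :: t).count o = j + 1
      then pr t else 0) ≤ ENNReal.ofReal C * expct a E l (fun W y =>
        ENNReal.ofReal (bval l (edgeMat E W) y o ^ j * hseg (edgeMat E W) y v o γ)) := by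
    calc _ ≤ ∑' t, ENNReal.ofReal C * expct a E l (fun W y =>
            ENNReal.ofReal (bval l (edgeMat E W) y o ^ (j + 1)) *
              if ErasesFrom S o (j + 1) γ t then pathWt E l o v t W y else 0) := by
          refine ENNReal.tsum_le_tsum fun t => ?_
          split_ifs with ht ht' ht'
          · exact hpr l hperm t ht.2.1 ht.2.2
          · exact absurd ht.1 ht'
          · exact zero_le
          · exact zero_le
      _ ≤ ENNReal.ofReal C * expct a E l (fun W y => ∑' t,
            ENNReal.ofReal (bval l (edgeMat E W) y o ^ (j + 1)) *
              if ErasesFrom S o (j + 1) γ t then pathWt E l o v t W y else 0) := by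
          rw [ENNReal.tsum_mul_left]
          gcongr
          exact expct_tsum_le _ _ _ _
      _ ≤ _ := by
          gcongr
          refine expct_mono fun W y hW hy => ?_
          have hB := edgeMat_nonneg hW
          have hb := bval_pos hB hy (x := o) (by simp [hl])
          rw [ENNReal.tsum_mul_left]
          refine (mul_le_mul_right (tsum_sWt_erasesFrom_le (rest := [v]) hnd hB hy hSl hoS (j + 1))
            _).trans (le_of_eq ?_)
          rw [← ENNReal.ofReal_mul (by positivity), ← ENNReal.ofReal_mul (by positivity)]
          congr 1
          rw [← hl]
          field_simp
          ring
  refine hstep.trans ?_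
  by_cases hpath : PathIn E v o γ
  · rw [if_pos ⟨hγ.1, hγ.2, hpath⟩]
    refine (mul_le_mul_right (expct_segment_le ha j hnd hE hEl hdo hdv) _).trans ?_
    rw [← ENNReal.ofReal_mul hC]
    refine ENNReal.ofReal_le_ofReal (le_of_eq ?_)
    have := Real.Gamma_pos_of_pos ha
    have := Real.pi_pos
    rw [hCdef, ← hl]
    field_simp
  · simp only [hseg_eq_zero hpath, mul_zero, ENNReal.ofReal_zero, expct_zero]
    exact zero_le

end PathExpectation

section PathProbability

/-- The number of times before `n` at which the sequence `c` takes the value `i`. -/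
noncomputable def visits {ι : Type*} (c : ℕ → ι) (n : ℕ) (i : ι) : ℕ :=
  ((Finset.range n).filter fun s => c s = i).card

lemma visits_zero {ι : Type*} (c : ℕ → ι) (i : ι) : visits c 0 i = 0 := rfl

lemma visits_succ {ι : Type*} [DecidableEq ι] (c : ℕ → ι) (n : ℕ) (i : ι) :
    visits c (n + 1) i = visits c n i + if c n = i then 1 else 0 := by
  unfold visits
  rw [Finset.range_add_one, Finset.filter_insert]
  split_ifs with h
  · rw [Finset.card_insert_of_notMem (by simp)]
  · rfl

lemma prod_range_eq_prod_visits {ι : Type*} {l : List ι} (hl : l.Nodup) {c : ℕ → ι} {n : ℕ}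
    (hc : ∀ s < n, c s ∈ l) {M : Type*} [CommMonoid M] (φ : ι → ℕ → M) :
    ∏ t ∈ Finset.range n, φ (c t) (visits c t (c t)) =
      (l.map fun i => ∏ m ∈ Finset.range (visits c n i), φ i m).prod := by
  rw [← List.prod_toFinset _ hl]
  induction n with
  | zero => simp [visits_zero]
  | succ n ih =>
    rw [Finset.prod_range_succ, ih fun s hs => hc s (by omega)]
    have h1 : ∀ i, ∏ m ∈ Finset.range (visits c (n + 1) i), φ i m =
        (∏ m ∈ Finset.range (visits c n i), φ i m) * if c n = i then φ i (visits c n i) else 1 := by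
      intro i
      rw [visits_succ]
      split_ifs
      · rw [Finset.prod_range_succ]
      · simp
    simp only [h1, Finset.prod_mul_distrib]
    rw [Finset.prod_ite_eq, if_pos (by simpa using hc n (by omega))]

lemma prod_range_add_eq_Gamma {α : ℝ} (hα : 0 < α) (n : ℕ) :
    ∏ m ∈ Finset.range n, (α + m) = Real.Gamma (α + n) / Real.Gamma α := by
  have := Real.Gamma_pos_of_pos hα
  induction n with
  | zero => simp; field_simp
  | succ n ih =>
    rw [Finset.prod_range_succ, ih]
    push_cast
    rw [← add_assoc, Real.Gamma_add_one (by positivity)]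
    ring

lemma list_prod_map_div {ι : Type*} (l : List ι) (f g : ι → ℝ) :
    (l.map fun i => f i / g i).prod = (l.map f).prod / (l.map g).prod := by
  induction l with
  | nil => simp
  | cons i l ih => simp only [List.map_cons, List.prod_cons, ih]; ring

variable {V : Type*} [DecidableEq V]

/-- The edge crossed at time `s`. -/
def stepEdge (u : ℕ → V) (s : ℕ) : Sym2 V := s(u s, u (s + 1))

lemma sum_visits_stepEdge {E : List (Sym2 V)} (hE : E.Nodup) {u : ℕ → V} {n : ℕ}
    (hu : ∀ s < n, stepEdge u s ∈ E) (hd : ∀ e ∈ E, ¬ e.IsDiag) (i : V) :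
    ((E.filter (i ∈ ·)).map (visits (stepEdge u) n)).sum + (if u 0 = i then 1 else 0) =
      2 * visits u n i + if u n = i then 1 else 0 := by
  induction n with
  | zero => simp [funext (visits_zero (stepEdge u)), visits_zero]
  | succ n ih =>
    have h1 : ((E.filter (i ∈ ·)).map (visits (stepEdge u) (n + 1))).sum =
        ((E.filter (i ∈ ·)).map (visits (stepEdge u) n)).sum +
          if i ∈ stepEdge u n then 1 else 0 := by
      simp only [funext (visits_succ (stepEdge u) n), List.sum_map_add]
      congr 1
      have hn := hu n (by omega)
      rw [← List.sum_toFinset _ (hE.filter _), Finset.sum_ite_eq]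
      simp [hn]
    have h2 := ih fun s hs => hu s (by omega)
    have h3 : u n ≠ u (n + 1) := fun h => hd _ (hu n (by omega)) (by simp [stepEdge, h])
    rw [h1, visits_succ]
    simp only [stepEdge, Sym2.mem_iff, eq_comm (a := i)]
    split_ifs at h2 ⊢ <;> simp_all <;> omega

/-- The exponent of the vertex `i` for the walk started at `o`. -/
noncomputable def startExp (a : ℝ) (E : List (Sym2 V)) (o i : V) : ℝ :=
  (a * (E.filter (i ∈ ·)).length + if i = o then 0 else 1) / 2

lemma startExp_of_ne {a : ℝ} {E : List (Sym2 V)} {o i : V} (h : i ≠ o) :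
    startExp a E o i = vexp a E i := by
  simp [startExp, vexp, h]

variable {a : ℝ} {E : List (Sym2 V)} {l : List V} {u : ℕ → V} {n : ℕ}

lemma startExp_pos (ha : 0 < a) (h0 : E.filter (u 0 ∈ ·) ≠ []) (i : V) :
    0 < startExp a E (u 0) i := by
  unfold startExp
  by_cases hi : i = u 0
  · have := List.length_pos_of_ne_nil h0
    rw [if_pos hi, hi]
    positivity
  · rw [if_neg hi]; positivity

/-- The partially exchangeable closed form of the probability of a finite path. -/
lemma prod_reinforced_eq (ha : 0 < a) (hE : E.Nodup) (hEl : EdgesIn E l) (hl : l.Nodup)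
    (hu : ∀ s < n, stepEdge u s ∈ E) (h0 : E.filter (u 0 ∈ ·) ≠ []) :
    ∏ t ∈ Finset.range n, (a + visits (stepEdge u) t (stepEdge u t)) /
        (a * (E.filter (u t ∈ ·)).length +
          (((E.filter (u t ∈ ·)).map (visits (stepEdge u) t)).sum : ℕ)) =
      (E.map fun e => Real.Gamma (a + visits (stepEdge u) n e) / Real.Gamma a).prod *
        (l.map fun i => Real.Gamma (startExp a E (u 0) i) /
          (2 ^ visits u n i * Real.Gamma (startExp a E (u 0) i + visits u n i))).prod := by
  have hα := startExp_pos (u := u) ha h0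
  have hden : ∀ t ∈ Finset.range n, (a * (E.filter (u t ∈ ·)).length +
      (((E.filter (u t ∈ ·)).map (visits (stepEdge u) t)).sum : ℕ) : ℝ) =
        2 * (startExp a E (u 0) (u t) + visits u t (u t)) := by
    intro t ht
    have h1 := sum_visits_stepEdge hE (fun s hs => hu s (hs.trans (Finset.mem_range.1 ht)))
      (fun e he => (hEl e he).1) (u t)
    rw [if_pos rfl] at h1
    have h2 : ((((E.filter (u t ∈ ·)).map (visits (stepEdge u) t)).sum : ℕ) : ℝ) +
        (if u 0 = u t then 1 else 0) = 2 * visits u t (u t) + 1 := by exact_mod_cast h1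
    unfold startExp
    simp only [eq_comm (a := u t)]
    split_ifs at h2 ⊢ <;> linarith
  have hul : ∀ s < n, u s ∈ l := fun s hs => (hEl _ (hu s hs)).2 _ (by simp [stepEdge])
  rw [Finset.prod_div_distrib, Finset.prod_congr rfl hden,
    prod_range_eq_prod_visits hE hu (fun _ m => a + (m : ℝ)),
    prod_range_eq_prod_visits hl hul (fun i m => 2 * (startExp a E (u 0) i + (m : ℝ))),
    div_eq_mul_inv, List.prod_inv, List.map_map]
  congr 2
  · refine List.map_congr_left fun e _ => prod_range_add_eq_Gamma ha _
  · refine List.map_congr_left fun i _ => ?_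
    simp only [Function.comp, Finset.prod_mul_distrib, prod_range_add_eq_Gamma (hα i)]
    simp only [Finset.prod_const, Finset.card_range]
    rw [mul_div_assoc', inv_div]

/-- The probability of a finite path as an expectation in the random environment. -/
lemma prod_reinforced_eq_expct (ha : 0 < a) (hE : E.Nodup) (hEl : EdgesIn E l) (hl : l.Nodup)
    (hu : ∀ s < n, stepEdge u s ∈ E) (h0 : E.filter (u 0 ∈ ·) ≠ []) (h0l : u 0 ∈ l)
    (hn : visits u n (u n) = 0) :
    ENNReal.ofReal (∏ t ∈ Finset.range n, (a + visits (stepEdge u) t (stepEdge u t)) /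
        (a * (E.filter (u t ∈ ·)).length +
          (((E.filter (u t ∈ ·)).map (visits (stepEdge u) t)).sum : ℕ))) =
      ENNReal.ofReal (Real.Gamma (startExp a E (u 0) (u 0)) / (2 ^ visits u n (u 0) *
          Real.Gamma (startExp a E (u 0) (u 0) + visits u n (u 0))) /
        (√(2 * Real.pi) ^ l.length * Real.Gamma a ^ E.length)) *
      expct a E l (fun W y => ENNReal.ofReal (bval l (edgeMat E W) y (u 0) ^ visits u n (u 0) *
        ∏ s ∈ Finset.range n, edgeMat E W (u s) (u (s + 1)) / bval l (edgeMat E W) y (u s))) := by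
  have hα := startExp_pos (u := u) ha h0
  have hΓ := Real.Gamma_pos_of_pos ha
  set k : V → ℕ := fun i => if i = u 0 then 0 else visits u n i with hk
  have hul : ∀ s < n, u s ∈ l := fun s hs => (hEl _ (hu s hs)).2 _ (by simp [stepEdge])
  have hmom := expct_moment ha hl hE hEl (visits (stepEdge u) n) k (fun i _ hki => by
    have hi0 : i ≠ u 0 := fun h => hki (by simp [hk, h])
    have hin : i ≠ u n := fun h => hki (by simp [hk, h, hn])
    have := sum_visits_stepEdge hE hu (fun e he => (hEl e he).1) i
    rw [if_neg hi0.symm, if_neg hin.symm] at this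
    simpa [hk, hi0] using this)
  have hsplit : ∀ f g : V → ℝ, f (u 0) = 1 → (∀ i ≠ u 0, f i = g i) →
      (l.map g).prod = g (u 0) * (l.map f).prod := by
    intro f g h1 h2
    rw [← List.prod_toFinset _ hl, ← List.prod_toFinset _ hl,
      ← Finset.mul_prod_erase _ g (List.mem_toFinset.2 h0l),
      ← Finset.mul_prod_erase _ f (List.mem_toFinset.2 h0l), h1, one_mul]
    congr 1
    exact Finset.prod_congr rfl fun i hi => (h2 i (Finset.ne_of_mem_erase hi)).symm
  have hF : expct a E l (fun W y => ENNReal.ofReal (bval l (edgeMat E W) y (u 0) ^ visits u n (u 0) *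
        ∏ s ∈ Finset.range n, edgeMat E W (u s) (u (s + 1)) / bval l (edgeMat E W) y (u s))) =
      expct a E l (fun W y => ENNReal.ofReal ((E.map fun e => W e ^ visits (stepEdge u) n e).prod *
        (l.map fun i => (bval l (edgeMat E W) y i ^ k i)⁻¹).prod)) := by
    have hpt : ∀ W y, (∀ e ∈ E, 0 < W e) → (∀ i ∈ l, 0 < y i) →
        bval l (edgeMat E W) y (u 0) ^ visits u n (u 0) *
          ∏ s ∈ Finset.range n, edgeMat E W (u s) (u (s + 1)) / bval l (edgeMat E W) y (u s) =
        (E.map fun e => W e ^ visits (stepEdge u) n e).prod *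
          (l.map fun i => (bval l (edgeMat E W) y i ^ k i)⁻¹).prod := by
      intro W y hW hy
      have hb := bval_pos (edgeMat_nonneg hW) hy h0l
      have h1 : ∀ s ∈ Finset.range n, edgeMat E W (u s) (u (s + 1)) = W (stepEdge u s) := fun s hs =>
        if_pos (hu s (Finset.mem_range.1 hs))
      rw [Finset.prod_div_distrib, Finset.prod_congr rfl h1,
        prod_range_eq_prod_visits hE hu (fun e _ => W e),
        prod_range_eq_prod_visits hl hul (fun i _ => bval l (edgeMat E W) y i), div_eq_mul_inv,
        List.prod_inv, List.map_map]
      simp only [Finset.prod_const, Finset.card_range, Function.comp_def]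
      rw [hsplit (fun i => (bval l (edgeMat E W) y i ^ k i)⁻¹) _ (by simp [hk])
        (fun i hi => by simp [hk, hi])]
      field_simp
    refine le_antisymm (expct_mono fun W y hW hy => ?_) (expct_mono fun W y hW hy => ?_)
    · rw [hpt W y hW hy]
    · rw [hpt W y hW hy]
  rw [hF, hmom, prod_reinforced_eq ha hE hEl hl hu h0, ← ENNReal.ofReal_mul (by
    have := hα (u 0)
    have h1 := Real.Gamma_pos_of_pos this
    have h2 := Real.Gamma_pos_of_pos (s := startExp a E (u 0) (u 0) + visits u n (u 0)) (by positivity)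
    positivity)]
  congr 1
  rw [hsplit (fun i => Real.Gamma (vexp a E i) / (2 ^ k i * Real.Gamma (vexp a E i + k i))) _
    (by
      have := Real.Gamma_pos_of_pos (vexp_pos ha E (u 0))
      simp [hk, this.ne'])
    (fun i hi => by simp [hk, hi, startExp_of_ne hi]), list_prod_map_div]
  have : (E.map fun _ => Real.Gamma a).prod = Real.Gamma a ^ E.length := by simp
  rw [this]
  have hpi := Real.pi_pos
  field_simp

end PathProbability

section PathOfList

variable {V : Type*}

/-- The sequence running through `o :: t` and then staying at `v`. -/
def listPath (o v : V) (t : List V) (s : ℕ) : V := (o :: (t ++ [v])).getD s v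

@[simp] lemma listPath_zero (o v : V) (t : List V) : listPath o v t 0 = o := rfl

@[simp] lemma listPath_nil_succ (o v : V) (s : ℕ) : listPath o v [] (s + 1) = v := by
  cases s <;> simp [listPath]

@[simp] lemma listPath_cons_succ (o v w : V) (t : List V) (s : ℕ) :
    listPath o v (w :: t) (s + 1) = listPath w v t s := by
  simp [listPath]

lemma listPath_length_succ (o v : V) (t : List V) : listPath o v t (t.length + 1) = v := by
  induction t generalizing o with
  | nil => simp
  | cons w t ih => rw [listPath_cons_succ]; exact ih w

lemma listPath_mem (o v : V) (t : List V) {s : ℕ} (hs : s < t.length + 1) :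
    listPath o v t s ∈ o :: t := by
  induction t generalizing o s with
  | nil =>
    obtain rfl : s = 0 := by simpa using hs
    simp
  | cons w t ih =>
    cases s with
    | zero => simp
    | succ s =>
      rw [listPath_cons_succ]
      exact List.mem_cons_of_mem _ (ih w (by simpa using hs))

lemma mul_sWt_eq_prod (β : V → V → ℝ≥0∞) (g : V → ℝ≥0∞) (v o : V) (t : List V) :
    g o * sWt β g v o t = ∏ s ∈ Finset.range (t.length + 1),
      g (listPath o v t s) * β (listPath o v t s) (listPath o v t (s + 1)) := by
  induction t generalizing o with
  | nil => simp [sWt]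
  | cons w t ih =>
    rw [List.length_cons, Finset.prod_range_succ', sWt]
    simp only [listPath_cons_succ, listPath_zero]
    rw [← ih w]
    ring

lemma visits_listPath [DecidableEq V] (o v : V) (t : List V) (i : V) :
    visits (listPath o v t) (t.length + 1) i = (o :: t).count i := by
  have hsum : ∀ (c : ℕ → V) n, visits c n i = ∑ s ∈ Finset.range n, if c s = i then 1 else 0 := by
    intro c n
    induction n with
    | zero => rfl
    | succ n ih => rw [visits_succ, ih, Finset.sum_range_succ]
  rw [hsum]
  induction t generalizing o with
  | nil =>
    rw [List.length_nil, zero_add, Finset.sum_range_one, listPath_zero]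
    by_cases h : o = i <;> simp [h]
  | cons w t ih =>
    rw [List.length_cons, Finset.sum_range_succ']
    simp only [listPath_cons_succ, listPath_zero]
    rw [ih w, List.count_cons (b := o)]
    by_cases h : o = i <;> simp [h]

lemma visits_listPath_end {o v : V} {t : List V} (h : v ∉ o :: t) :
    visits (listPath o v t) (t.length + 1) (listPath o v t (t.length + 1)) = 0 := by
  rw [visits_listPath, listPath_length_succ]
  exact List.count_eq_zero_of_not_mem h

end PathOfList

section Lattice

/-- The four unit vectors. -/
def unitVecs : Finset (ℤ × ℤ) := {(1, 0), (-1, 0), (0, 1), (0, -1)}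

variable {r : ℕ}

lemma AdjG.symm {x y : ℤ × ℤ} (h : AdjG r x y) : AdjG r y x :=
  ⟨h.2.1, h.1, by rw [← h.2.2]; ring⟩

lemma AdjG.ne {x y : ℤ × ℤ} (h : AdjG r x y) : x ≠ y := by
  rintro rfl
  simpa using h.2.2

lemma AdjG.exists_unitVec {x y : ℤ × ℤ} (h : AdjG r x y) : ∃ d ∈ unitVecs, y = x + d := by
  refine ⟨y - x, ?_, by simp⟩
  obtain ⟨x1, x2⟩ := x
  obtain ⟨y1, y2⟩ := y
  have h2 := h.2.2
  simp only at h2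
  have h3 : (x1 - y1) ^ 2 ≤ 1 := by nlinarith [sq_nonneg (x2 - y2)]
  have h4 : (x2 - y2) ^ 2 ≤ 1 := by nlinarith [sq_nonneg (x1 - y1)]
  have h5 : -1 ≤ x1 - y1 ∧ x1 - y1 ≤ 1 := abs_le.1 ((sq_le_one_iff_abs_le_one _).1 h3)
  have h6 : -1 ≤ x2 - y2 ∧ x2 - y2 ≤ 1 := abs_le.1 ((sq_le_one_iff_abs_le_one _).1 h4)
  simp only [unitVecs, Finset.mem_insert, Finset.mem_singleton, Prod.mk_sub_mk, Prod.mk.injEq]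
  have h7 : x1 - y1 = -1 ∨ x1 - y1 = 0 ∨ x1 - y1 = 1 := by omega
  have h8 : x2 - y2 = -1 ∨ x2 - y2 = 0 ∨ x2 - y2 = 1 := by omega
  rcases h7 with h7 | h7 | h7 <;> rcases h8 with h8 | h8 | h8 <;> rw [h7, h8] at h2 <;>
    norm_num at h2 <;> omega

/-- The part of `V_r` in the box of radius `n`. -/
noncomputable def box (r n : ℕ) : Finset (ℤ × ℤ) :=
  (Finset.Icc (-(n : ℤ)) n ×ˢ Finset.Icc (-(n : ℤ)) n).filter (· ∈ Vr r)

lemma mem_box {n : ℕ} {x : ℤ × ℤ} :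
    x ∈ box r n ↔ (-(n : ℤ) ≤ x.1 ∧ x.1 ≤ n) ∧ (-(n : ℤ) ≤ x.2 ∧ x.2 ≤ n) ∧ x ∈ Vr r := by
  simp [box, and_assoc]

lemma box_mono {n m : ℕ} (h : n ≤ m) : box r n ⊆ box r m := fun x hx => by
  rw [mem_box] at hx ⊢
  refine ⟨by omega, by omega, hx.2.2⟩

lemma AdjG.mem_box {n : ℕ} {x y : ℤ × ℤ} (h : AdjG r x y) (hx : x ∈ box r n) :
    y ∈ box r (n + 1) := by
  obtain ⟨d, hd, rfl⟩ := h.exists_unitVec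
  rw [ERRWZ2.mem_box] at hx ⊢
  refine ⟨?_, ?_, h.2.1⟩
  all_goals
    simp only [unitVecs, Finset.mem_insert, Finset.mem_singleton] at hd
    rcases hd with rfl | rfl | rfl | rfl <;> simp <;> omega

/-- The edges of `G_r` inside a finite set. -/
noncomputable def edgesOf (r : ℕ) (Λ : Finset (ℤ × ℤ)) : List (Sym2 (ℤ × ℤ)) :=
  (((Λ ×ˢ Λ).filter fun p => AdjG r p.1 p.2).image fun p => s(p.1, p.2)).toList

lemma nodup_edgesOf (Λ : Finset (ℤ × ℤ)) : (edgesOf r Λ).Nodup := Finset.nodup_toList _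

lemma mem_edgesOf {Λ : Finset (ℤ × ℤ)} {x y : ℤ × ℤ} :
    s(x, y) ∈ edgesOf r Λ ↔ x ∈ Λ ∧ y ∈ Λ ∧ AdjG r x y := by
  simp only [edgesOf, Finset.mem_toList, Finset.mem_image, Finset.mem_filter, Finset.mem_product,
    Sym2.eq_iff]
  constructor
  · rintro ⟨⟨p, q⟩, ⟨⟨h1, h2⟩, h3⟩, ⟨rfl, rfl⟩ | ⟨rfl, rfl⟩⟩
    exacts [⟨h1, h2, h3⟩, ⟨h2, h1, h3.symm⟩]
  · rintro ⟨h1, h2, h3⟩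
    exact ⟨(x, y), ⟨⟨h1, h2⟩, h3⟩, Or.inl ⟨rfl, rfl⟩⟩

lemma edgesIn_edgesOf (Λ : Finset (ℤ × ℤ)) : EdgesIn (edgesOf r Λ) Λ.toList := by
  intro e he
  induction e with
  | _ x y =>
    obtain ⟨h1, h2, h3⟩ := mem_edgesOf.1 he
    refine ⟨fun h => h3.ne (by simpa using h), fun z hz => ?_⟩
    rcases Sym2.mem_iff.1 hz with rfl | rfl <;> simpa

lemma edgesOf_filter_perm {Λ : Finset (ℤ × ℤ)} {x : ℤ × ℤ} (hx : x ∈ Λ) :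
    ((edgesOf r Λ).filter (x ∈ ·)).Perm
      ((unitVecs.filter fun d => AdjG r x (x + d) ∧ x + d ∈ Λ).toList.map fun d => s(x, x + d)) := by
  refine (List.perm_ext_iff_of_nodup ((nodup_edgesOf Λ).filter _)
    ((Finset.nodup_toList _).map fun d d' h => ?_)).2 fun e => ?_
  · rcases Sym2.eq_iff.1 h with ⟨-, h⟩ | ⟨h1, h2⟩
    · exact add_left_cancel h
    · have h3 : d = 0 := by simpa using h2
      have h4 : d' = 0 := by simpa using h1
      rw [h3, h4]
  · induction e with
    | _ p q =>
      simp only [List.mem_filter, mem_edgesOf, decide_eq_true_eq, Sym2.mem_iff, List.mem_map,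
        Finset.mem_toList, Finset.mem_filter]
      constructor
      · rintro ⟨⟨h1, h2, h3⟩, rfl | rfl⟩
        · obtain ⟨d, hd, rfl⟩ := h3.exists_unitVec
          exact ⟨d, ⟨hd, h3, h2⟩, rfl⟩
        · obtain ⟨d, hd, rfl⟩ := h3.symm.exists_unitVec
          exact ⟨d, ⟨hd, h3.symm, h1⟩, Sym2.eq_swap⟩
      · rintro ⟨d, ⟨h1, h2, h3⟩, h4⟩
        rcases Sym2.eq_iff.1 h4 with ⟨rfl, rfl⟩ | ⟨rfl, rfl⟩
        · exact ⟨⟨hx, h3, h2⟩, Or.inl rfl⟩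
        · exact ⟨⟨h3, hx, h2.symm⟩, Or.inr rfl⟩

lemma degree_le_four {Λ : Finset (ℤ × ℤ)} {x : ℤ × ℤ} (hx : x ∈ Λ) :
    ((edgesOf r Λ).filter (x ∈ ·)).length ≤ 4 := by
  rw [(edgesOf_filter_perm hx).length_eq, List.length_map, Finset.length_toList]
  exact (Finset.card_filter_le _ _).trans (by simp [unitVecs])

lemma degree_zero_eq_four {n : ℕ} :
    ((edgesOf r (box r (n + 1))).filter ((0, 0) ∈ ·)).length = 4 := by
  have h0 : (0, 0) ∈ box r n := by simp [mem_box, Vr]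
  rw [(edgesOf_filter_perm (box_mono (Nat.le_succ n) h0)).length_eq, List.length_map,
    Finset.length_toList, Finset.filter_true_of_mem]
  · simp [unitVecs]
  · intro d hd
    have h1 : AdjG r (0, 0) ((0, 0) + d) := by
      simp only [unitVecs, Finset.mem_insert, Finset.mem_singleton] at hd
      rcases hd with rfl | rfl | rfl | rfl <;> simp [AdjG, Vr]
    exact ⟨h1, h1.mem_box h0⟩

lemma wt_eq_visits (a : ℝ) (u : ℕ → ℤ × ℤ) (t : ℕ) (x y : ℤ × ℤ) :
    wt a u t x y = a + visits (stepEdge u) t s(x, y) := by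
  simp only [wt, visits, stepEdge, Sym2.eq_iff]

lemma totWt_eq_sum {a : ℝ} {u : ℕ → ℤ × ℤ} {t n : ℕ} (hu : u t ∈ box r n) :
    totWt r a u t = a * ((edgesOf r (box r (n + 1))).filter (u t ∈ ·)).length +
      ((((edgesOf r (box r (n + 1))).filter (u t ∈ ·)).map (visits (stepEdge u) t)).sum : ℕ) := by
  have hp := edgesOf_filter_perm (r := r) (box_mono (Nat.le_succ n) hu)
  rw [hp.length_eq, (hp.map _).sum_eq, List.length_map, List.map_map, Finset.length_toList,
    Finset.sum_map_toList]
  have h1 : (unitVecs.filter fun d => AdjG r (u t) (u t + d) ∧ u t + d ∈ box r (n + 1)) =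
      unitVecs.filter fun d => AdjG r (u t) (u t + d) :=
    Finset.filter_congr fun d _ => ⟨fun h => h.1, fun h => ⟨h, h.mem_box hu⟩⟩
  rw [h1, totWt, ← Finset.sum_filter]
  simp only [wt_eq_visits, Finset.sum_add_distrib, Finset.sum_const, nsmul_eq_mul]
  push_cast
  simp only [Function.comp, unitVecs, mul_comm]

end Lattice

section Exit

variable {r : ℕ} {a : ℝ} {P : Measure (ℕ → ℤ × ℤ)}

/-- The probability that the walk first follows the path `o :: t` and then steps to `v`. -/
noncomputable def pathProb (P : Measure (ℕ → ℤ × ℤ)) (v : ℤ × ℤ) (t : List (ℤ × ℤ)) : ℝ≥0∞ :=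
  P {X | ∀ s ≤ t.length + 1, X s = listPath (0, 0) v t s}

/-- The constant in the bound for walks visiting the origin `j + 1` times. -/
noncomputable def visitConst (a : ℝ) (j : ℕ) : ℝ :=
  Real.Gamma (2 * a) / (2 ^ (j + 1) * Real.Gamma (2 * a + (j + 1 : ℕ)))

lemma zero_mem_box (r n : ℕ) : ((0, 0) : ℤ × ℤ) ∈ box r n := by simp [mem_box, Vr]

lemma pathProb_le (ha : 0 < a) (hP : IsERRW r a P) {n j : ℕ} {v : ℤ × ℤ}
    (hv : v ∉ box r n) {l : List (ℤ × ℤ)} (hl : l.Perm (box r (n + 1)).toList)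
    {t : List (ℤ × ℤ)} (ht : ∀ w ∈ t, w ∈ box r n)
    (hj : visits (listPath (0, 0) v t) (t.length + 1) (0, 0) = j + 1) :
    pathProb P v t ≤ ENNReal.ofReal (visitConst a j /
        (√(2 * Real.pi) ^ l.length * Real.Gamma a ^ (edgesOf r (box r (n + 1))).length)) *
      expct a (edgesOf r (box r (n + 1))) l (fun W y =>
        ENNReal.ofReal (bval l (edgeMat (edgesOf r (box r (n + 1))) W) y (0, 0) ^ (j + 1)) *
          pathWt (edgesOf r (box r (n + 1))) l (0, 0) v t W y) := by
  set E := edgesOf r (box r (n + 1)) with hE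
  set u := listPath ((0, 0) : ℤ × ℤ) v t with hu
  rw [pathProb, hP.2]
  split_ifs with hadj
  swap
  · exact zero_le
  have hbox : ∀ s < t.length + 1, u s ∈ box r n := fun s hs => by
    rcases List.mem_cons.1 (listPath_mem (0, 0) v t hs) with h | h
    · rw [hu, h]; exact zero_mem_box r n
    · exact ht _ h
  have hstep : ∀ s < t.length + 1, stepEdge u s ∈ E := fun s hs =>
    mem_edgesOf.2 ⟨box_mono n.le_succ (hbox s hs), (hadj.2 s hs).mem_box (hbox s hs), hadj.2 s hs⟩
  have hEl : EdgesIn E l := (edgesIn_edgesOf _).perm hl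
  have h4 : (E.filter (u 0 ∈ ·)).length = 4 := degree_zero_eq_four
  have h0 : E.filter (u 0 ∈ ·) ≠ [] := fun h => by simp [h] at h4
  have hvis : visits u (t.length + 1) (u 0) = j + 1 := hj
  have hend : visits u (t.length + 1) (u (t.length + 1)) = 0 := by
    refine visits_listPath_end fun h => ?_
    rcases List.mem_cons.1 h with h | h
    · exact hv (h ▸ zero_mem_box r n)
    · exact hv (ht _ h)
  have hstart : startExp a E (u 0) (u 0) = 2 * a := by
    rw [startExp, h4, if_pos rfl]; push_cast; ring
  have key := prod_reinforced_eq_expct ha (nodup_edgesOf _) hEl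
    (hl.nodup_iff.2 (Finset.nodup_toList _)) hstep h0
    (hl.mem_iff.2 (Finset.mem_toList.2 (box_mono n.le_succ (zero_mem_box r n)))) hend
  rw [hvis, hstart] at key
  refine (le_of_eq (Eq.trans ?_ key)).trans ?_
  · congr 1
    refine Finset.prod_congr rfl fun s hs => ?_
    rw [wt_eq_visits, totWt_eq_sum (hbox s (Finset.mem_range.1 hs))]
    rfl
  · refine mul_le_mul_right (expct_mono fun W y hW hy => le_of_eq ?_) _
    have hb : ∀ i ∈ l, 0 < bval l (edgeMat E W) y i := fun i hi => bval_pos (edgeMat_nonneg hW) hy hi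
    have hb0 := hb (0, 0) (hl.mem_iff.2 (Finset.mem_toList.2 (box_mono n.le_succ (zero_mem_box r n))))
    have hbs : ∀ s ∈ Finset.range (t.length + 1), 0 < bval l (edgeMat E W) y (u s) := fun s hs =>
      hb _ (hl.mem_iff.2 (Finset.mem_toList.2
        (box_mono n.le_succ (hbox s (Finset.mem_range.1 hs)))))
    have hw := mul_sWt_eq_prod (fun i j => ENNReal.ofReal (edgeMat E W i j))
      (fun i => ENNReal.ofReal (1 / bval l (edgeMat E W) y i)) v (0, 0) t
    change ENNReal.ofReal (bval l (edgeMat E W) y (0, 0) ^ (j + 1) *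
      ∏ s ∈ Finset.range (t.length + 1),
        edgeMat E W (u s) (u (s + 1)) / bval l (edgeMat E W) y (u s)) = _
    rw [pathWt, hw, ENNReal.ofReal_mul (pow_nonneg hb0.le _),
      ENNReal.ofReal_prod_of_nonneg fun s hs =>
        div_nonneg (edgeMat_nonneg hW _ _) (hbs s hs).le]
    refine congrArg _ (Finset.prod_congr rfl fun s hs => ?_)
    rw [← hu, ← ENNReal.ofReal_mul (one_div_nonneg.2 (hbs s hs).le), one_div_mul_eq_div]

theorem tsum_pathProb_le (ha : 0 < a) (hP : IsERRW r a P) {n : ℕ} (j : ℕ) {v : ℤ × ℤ}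
    (hv : v ∈ box r (n + 1)) (hv' : v ∉ box r n) :
    ∑' t, (if (∀ w ∈ t, w ∈ box r n) ∧ visits (listPath (0, 0) v t) (t.length + 1) (0, 0) = j + 1
      then pathProb P v t else 0) ≤
    ∑' γ : List (ℤ × ℤ), if γ.Nodup ∧ (∀ x ∈ γ, x ∈ box r n ∧ x ≠ (0, 0)) ∧
        PathIn (edgesOf r (box r (n + 1))) v (0, 0) γ then
      ENNReal.ofReal (visitConst a j * segConst a j * decay a ^ γ.length) else 0 := by
  have h0 := zero_mem_box r n
  have h01 := box_mono n.le_succ h0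
  have hc : 0 ≤ visitConst a j := by
    have := Real.Gamma_pos_of_pos (s := 2 * a) (by positivity)
    have := Real.Gamma_pos_of_pos (s := 2 * a + (j + 1 : ℕ)) (by positivity)
    unfold visitConst
    positivity
  have := tsum_le_of_expct ha (nodup_edgesOf (r := r) (box r (n + 1))) (Finset.nodup_toList _)
    (edgesIn_edgesOf _) (Finset.mem_toList.2 h01) (Finset.mem_toList.2 hv)
    (fun h => hv' (h ▸ h0)) (degree_le_four h01) (degree_le_four hv) (S := ↑(box r n))
    (fun w hw => ⟨Finset.mem_toList.2 (box_mono n.le_succ hw), fun h => hv' (h ▸ hw)⟩) h0 j hc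
    (pr := pathProb P v) (fun l hl t ht hj =>
      pathProb_le ha hP hv' hl ht (by rw [visits_listPath, hj]))
  simp only [← visits_listPath (v := v), Finset.mem_coe] at this
  exact this

end Exit

section Counting

variable {r : ℕ}

/-- The coordinate of `y` in the direction of the step from `x` to `y`. -/
def stepCoord (x y : ℤ × ℤ) : ℤ := y.1 * (y.1 - x.1) + y.2 * (y.2 - x.2)

/-- The number of steps made since the last crossing, not counting the present step. -/
def sinceCrossing (r : ℕ) (x y : ℤ × ℤ) : ℕ := ((stepCoord x y - 1) % r).toNat

lemma emod_eq_add_one {m : ℤ} (hr : 2 ≤ r) (hm : ¬ (r : ℤ) ∣ m) : m % r = (m - 1) % r + 1 := by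
  have h1 := Int.emod_nonneg m (b := (r : ℤ)) (by omega)
  have h2 := Int.emod_lt_of_pos m (b := (r : ℤ)) (by omega)
  have h3 : m % r ≠ 0 := fun h => hm (Int.dvd_of_emod_eq_zero h)
  have h4 : (m - 1) % r = (m % r - 1) % r := by rw [Int.emod_sub_emod]
  have h5 : (m % r - 1) % r = m % r - 1 := Int.emod_eq_of_lt (by omega) (by omega)
  omega

lemma not_dvd_add_one (hr : 2 ≤ r) {m : ℤ} (h : (r : ℤ) ∣ m) : ¬ (r : ℤ) ∣ m + 1 := fun h' => by
  have h1 : (r : ℤ) ∣ 1 := by simpa using dvd_sub h' h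
  have := Int.le_of_dvd one_pos h1
  omega

lemma AdjG.straight (hr : 2 ≤ r) {x y w : ℤ × ℤ} (h : AdjG r x y) (hy : y ∉ Lr r)
    (hw : AdjG r y w) (hne : w ≠ x) : w = y + (y - x) ∧
      sinceCrossing r y w = sinceCrossing r x y + 1 := by
  obtain ⟨d, hd, rfl⟩ := h.symm.exists_unitVec
  obtain ⟨d', hd', rfl⟩ := hw.exists_unitVec
  obtain ⟨p, q⟩ := y
  have h1 := h.1
  have h2 := hw.1
  have h3 := hw.2.1
  have p1 := not_dvd_add_one hr (m := p)
  have p2 := not_dvd_add_one hr (m := p - 1)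
  have q1 := not_dvd_add_one hr (m := q)
  have q2 := not_dvd_add_one hr (m := q - 1)
  simp only [sub_add_cancel] at p2 q2
  simp only [unitVecs, Finset.mem_insert, Finset.mem_singleton] at hd hd'
  clear h hw
  have key : ∀ m : ℤ, ¬ (r : ℤ) ∣ m → (m % r).toNat = ((m - 1) % r).toNat + 1 := fun m hm => by
    have := Int.emod_nonneg (m - 1) (b := (r : ℤ)) (by omega)
    rw [emod_eq_add_one hr hm]
    omega
  have k1 := key p
  have k2 := key q
  have k3 := key (-p)
  have k4 := key (-q)
  rw [dvd_neg] at k3 k4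
  clear key
  rcases hd with rfl | rfl | rfl | rfl <;> rcases hd' with rfl | rfl | rfl | rfl <;>
    simp [Vr, Lr, sinceCrossing, stepCoord, ← sub_eq_add_neg] at h1 h2 h3 hy hne ⊢ <;> grind

lemma AdjG.sinceCrossing_eq_zero {y w : ℤ × ℤ} (hy : y ∈ Lr r) (hw : AdjG r y w) :
    sinceCrossing r y w = 0 := by
  obtain ⟨d, hd, rfl⟩ := hw.exists_unitVec
  obtain ⟨p, q⟩ := y
  obtain ⟨h1, h2⟩ := hy
  have h3 : (r : ℤ) ∣ stepCoord (p, q) ((p, q) + d) - 1 := by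
    simp only [unitVecs, Finset.mem_insert, Finset.mem_singleton] at hd
    rcases hd with rfl | rfl | rfl | rfl <;> simp_all [stepCoord]
  rw [sinceCrossing, Int.emod_eq_zero_of_dvd h3, Int.toNat_zero]

lemma sinceCrossing_eq_sub_one (hr : 2 ≤ r) {x y : ℤ × ℤ} (hy : y ∈ Lr r) :
    sinceCrossing r x y = r - 1 := by
  have h1 : (r : ℤ) ∣ stepCoord x y := dvd_add (hy.1.mul_right _) (hy.2.mul_right _)
  have h2 := Int.emod_nonneg (stepCoord x y - 1) (b := (r : ℤ)) (by omega)
  have h3 := Int.emod_lt_of_pos (stepCoord x y - 1) (b := (r : ℤ)) (by omega)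
  have h4 : (r : ℤ) ∣ (stepCoord x y - 1) % r + 1 := by
    have h5 := Int.emod_add_mul_ediv (stepCoord x y - 1) r
    rw [show (stepCoord x y - 1) % r + 1 = stepCoord x y - r * ((stepCoord x y - 1) / r) by linarith]
    exact dvd_sub h1 (dvd_mul_right _ _)
  have := Int.le_of_dvd (by omega) h4
  rw [sinceCrossing]
  omega

/-- The path `x, y` followed by the list runs in `G_r` without backtracking. -/
def NoBack (r : ℕ) : ℤ × ℤ → ℤ × ℤ → List (ℤ × ℤ) → Prop
  | _, _, [] => True
  | x, y, w :: t => AdjG r y w ∧ w ≠ x ∧ NoBack r y w t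

lemma tsum_ite_le_card_mul {α : Type*} {p : α → Prop} [DecidablePred p] {f : α → ℝ≥0∞} {b : ℝ≥0∞} {s : Finset α}
    (hs : ∀ x, p x → x ∈ s ∧ f x ≤ b) : ∑' x, (if p x then f x else 0) ≤ s.card * b := by
  rw [tsum_eq_sum (s := s) fun x hx => if_neg fun h => hx (hs x h).1, ← nsmul_eq_mul]
  refine Finset.sum_le_card_nsmul _ _ _ fun x _ => ?_
  split_ifs with h
  exacts [(hs x h).2, zero_le]

/-- The neighbours of `y` in the square lattice. -/
def latticeNeighbors (y : ℤ × ℤ) : Finset (ℤ × ℤ) := unitVecs.image (y + ·)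

lemma card_latticeNeighbors_le (y : ℤ × ℤ) : (latticeNeighbors y).card ≤ 4 :=
  Finset.card_image_le.trans (by simp [unitVecs])

lemma AdjG.mem_latticeNeighbors {y w : ℤ × ℤ} (h : AdjG r y w) : w ∈ latticeNeighbors y := by
  obtain ⟨d, hd, rfl⟩ := h.exists_unitVec
  exact Finset.mem_image_of_mem _ hd

lemma tsum_noBack_le (hr : 2 ≤ r) {q : ℝ} (hq0 : 0 < q) (hq1 : q < 1) (hqr : (q ^ 2) ^ r ≤ 1 / 3)
    {x y : ℤ × ℤ} (h : AdjG r x y) :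
    ∑' t, (if NoBack r x y t then ENNReal.ofReal (q ^ (3 * t.length)) else 0) ≤
      ENNReal.ofReal ((q ^ 2)⁻¹ ^ sinceCrossing r x y / (1 - q)) := by
  have hq : 0 < 1 - q := by linarith
  have key := tsum_list_le
    (F := fun (s : (ℤ × ℤ) × (ℤ × ℤ)) t =>
      if NoBack r s.1 s.2 t then ENNReal.ofReal (q ^ (3 * t.length)) else 0)
    (K := fun s w => if AdjG r s.2 w ∧ w ≠ s.1 then ENNReal.ofReal (q ^ 3) else 0)
    (next := fun s w => (s.2, w))
    (H := fun s => if AdjG r s.1 s.2 then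
      ENNReal.ofReal ((q ^ 2)⁻¹ ^ sinceCrossing r s.1 s.2 / (1 - q)) else ⊤)
    (fun s w t => by
      simp only [NoBack, List.length_cons, mul_add, mul_one, pow_add,
        ENNReal.ofReal_mul (pow_nonneg hq0.le _), ← and_assoc]
      by_cases h1 : AdjG r s.2 w ∧ w ≠ s.1 <;> by_cases h2 : NoBack r s.2 w t <;>
        simp [h1, h2, mul_comm])
    (fun ⟨x, y⟩ => by
      by_cases hxy : AdjG r x y
      swap
      · simp [hxy]
      simp only [if_pos hxy, NoBack, if_true, List.length_nil, mul_zero, pow_zero]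
      have hstep : ∑' w, (if AdjG r y w ∧ w ≠ x then ENNReal.ofReal (q ^ 3) else 0) *
          (if AdjG r y w then ENNReal.ofReal ((q ^ 2)⁻¹ ^ sinceCrossing r y w / (1 - q)) else ⊤) ≤
          ENNReal.ofReal (q * ((q ^ 2)⁻¹ ^ sinceCrossing r x y / (1 - q))) := by
        have hrw : ∀ w, (if AdjG r y w ∧ w ≠ x then ENNReal.ofReal (q ^ 3) else 0) *
            (if AdjG r y w then ENNReal.ofReal ((q ^ 2)⁻¹ ^ sinceCrossing r y w / (1 - q)) else ⊤) =
            if AdjG r y w ∧ w ≠ x then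
              ENNReal.ofReal (q ^ 3 * ((q ^ 2)⁻¹ ^ sinceCrossing r y w / (1 - q))) else 0 := by
          intro w
          by_cases h1 : AdjG r y w <;> by_cases h2 : w = x <;>
            simp [h1, h2, ENNReal.ofReal_mul (pow_nonneg hq0.le _)]
        simp only [hrw]
        by_cases hy : y ∈ Lr r
        · refine (tsum_ite_le_card_mul (p := fun w => AdjG r y w ∧ w ≠ x) (s := (latticeNeighbors y).erase x)
            (b := ENNReal.ofReal (q ^ 3 * (1 / (1 - q)))) fun w hw =>
            ⟨Finset.mem_erase.2 ⟨hw.2, hw.1.mem_latticeNeighbors⟩, le_of_eq ?_⟩).trans ?_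
          · rw [hw.1.sinceCrossing_eq_zero hy, pow_zero]
          · have hcard : ((latticeNeighbors y).erase x).card ≤ 3 := by
              rw [Finset.card_erase_of_mem hxy.symm.mem_latticeNeighbors]
              have := card_latticeNeighbors_le y
              omega
            rw [sinceCrossing_eq_sub_one hr hy]
            calc _ ≤ (3 : ℝ≥0∞) * ENNReal.ofReal (q ^ 3 * (1 / (1 - q))) := by
                  gcongr; exact_mod_cast hcard
              _ = ENNReal.ofReal (3 * (q ^ 3 * (1 / (1 - q)))) := by
                  rw [← ENNReal.ofReal_ofNat, ← ENNReal.ofReal_mul (by norm_num)]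
              _ ≤ _ := by
                  refine ENNReal.ofReal_le_ofReal ?_
                  have h1 : (q ^ 2) ^ r = (q ^ 2) ^ (r - 1) * q ^ 2 := by
                    rw [← pow_succ, Nat.sub_add_cancel (by omega)]
                  rw [h1] at hqr
                  have h2 : 3 * q ^ 2 ≤ (q ^ 2)⁻¹ ^ (r - 1) := by
                    rw [inv_pow, ← one_div, le_div_iff₀ (by positivity)]
                    linarith
                  calc _ = q * (3 * q ^ 2 / (1 - q)) := by ring
                    _ ≤ _ := by gcongr
        · refine (tsum_ite_le_card_mul (p := fun w => AdjG r y w ∧ w ≠ x) (s := {y + (y - x)})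
            (b := ENNReal.ofReal (q * ((q ^ 2)⁻¹ ^ sinceCrossing r x y / (1 - q)))) fun w hw =>
            ⟨Finset.mem_singleton.2 (hxy.straight hr hy hw.1 hw.2).1, le_of_eq ?_⟩).trans ?_
          · have h2 : q ^ 2 * (q ^ 2)⁻¹ = 1 := mul_inv_cancel₀ (by positivity)
            rw [(hxy.straight hr hy hw.1 hw.2).2]
            congr 1
            linear_combination q * (q ^ 2)⁻¹ ^ sinceCrossing r x y / (1 - q) * h2
          · simp
      refine (add_le_add le_rfl hstep).trans ?_
      rw [← ENNReal.ofReal_add zero_le_one (by positivity)]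
      refine ENNReal.ofReal_le_ofReal ?_
      have h1 : 1 ≤ (q ^ 2)⁻¹ ^ sinceCrossing r x y :=
        one_le_pow₀ ((one_le_inv₀ (by positivity)).2 (by nlinarith))
      rw [← mul_div_assoc, ← sub_nonneg, show (q ^ 2)⁻¹ ^ sinceCrossing r x y / (1 - q) -
        (1 + q * (q ^ 2)⁻¹ ^ sinceCrossing r x y / (1 - q)) =
          (q ^ 2)⁻¹ ^ sinceCrossing r x y - 1 by field_simp; ring]
      linarith) (x, y)
  simpa [h] using key

/-- The path `o` followed by the list runs in `G_r` without backtracking. -/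
def NoBackFrom (r : ℕ) (o : ℤ × ℤ) : List (ℤ × ℤ) → Prop
  | [] => False
  | w :: t => AdjG r o w ∧ NoBack r o w t

lemma tsum_noBackFrom_le (hr : 2 ≤ r) {q : ℝ} (hq0 : 0 < q) (hq1 : q < 1)
    (hqr : (q ^ 2) ^ r ≤ 1 / 3) {o : ℤ × ℤ} (ho : o ∈ Lr r) :
    ∑' t, (if NoBackFrom r o t then ENNReal.ofReal (q ^ (3 * t.length)) else 0) ≤
      ENNReal.ofReal (4 * q ^ 3 / (1 - q)) := by
  have hq : 0 < 1 - q := by linarith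
  rw [tsum_list]
  simp only [NoBackFrom, ↓reduceIte, zero_add, List.length_cons]
  calc _ = ∑' w : ℤ × ℤ, if AdjG r o w then ENNReal.ofReal (q ^ 3) *
        ∑' t, (if NoBack r o w t then ENNReal.ofReal (q ^ (3 * t.length)) else 0) else 0 := by
        refine tsum_congr fun w => ?_
        by_cases h : AdjG r o w <;> simp only [h, true_and, false_and, if_true, if_false, tsum_zero]
        rw [← ENNReal.tsum_mul_left]
        refine tsum_congr fun t => ?_
        rw [mul_ite, mul_zero, ← ENNReal.ofReal_mul (by positivity), ← pow_add, mul_add, mul_one,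
          add_comm]
    _ ≤ ((latticeNeighbors o).card : ℝ≥0∞) * ENNReal.ofReal (q ^ 3 * (1 / (1 - q))) := by
        refine tsum_ite_le_card_mul fun w hw => ⟨hw.mem_latticeNeighbors, ?_⟩
        rw [ENNReal.ofReal_mul (by positivity)]
        gcongr
        simpa [hw.sinceCrossing_eq_zero ho] using tsum_noBack_le hr hq0 hq1 hqr hw
    _ ≤ (4 : ℝ≥0∞) * ENNReal.ofReal (q ^ 3 * (1 / (1 - q))) := by
        gcongr
        exact_mod_cast card_latticeNeighbors_le o
    _ = _ := by
        rw [← ENNReal.ofReal_ofNat, ← ENNReal.ofReal_mul (by norm_num)]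
        congr 1
        ring

end Counting

section ExitDecay

variable {r : ℕ} {a : ℝ} {P : Measure (ℕ → ℤ × ℤ)}

lemma PathIn.noBack {Λ : Finset (ℤ × ℤ)} {v x y : ℤ × ℤ} {γ : List (ℤ × ℤ)}
    (h : PathIn (edgesOf r Λ) v y γ) (hx : x ∉ γ ++ [v]) (hnd : (y :: (γ ++ [v])).Nodup) :
    NoBack r x y (γ ++ [v]) := by
  induction γ generalizing x y with
  | nil => exact ⟨(mem_edgesOf.1 h).2.2, fun h => hx (by simp [h]), trivial⟩
  | cons w γ ih =>
    rw [List.cons_append, List.nodup_cons] at hnd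
    exact ⟨(mem_edgesOf.1 h.1).2.2, fun h => hx (by simp [h]), ih h.2 (fun hy => hnd.1 (by simp_all)) hnd.2⟩

lemma PathIn.noBackFrom {Λ : Finset (ℤ × ℤ)} {v o : ℤ × ℤ} {γ : List (ℤ × ℤ)}
    (h : PathIn (edgesOf r Λ) v o γ) (hnd : (o :: (γ ++ [v])).Nodup) :
    NoBackFrom r o (γ ++ [v]) := by
  cases γ with
  | nil => exact ⟨(mem_edgesOf.1 h).2.2, trivial⟩
  | cons w γ =>
    rw [List.cons_append, List.nodup_cons] at hnd
    exact ⟨(mem_edgesOf.1 h.1).2.2, h.2.noBack (fun hx => hnd.1 (by simp_all)) hnd.2⟩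

lemma PathIn.mem_box {Λ : Finset (ℤ × ℤ)} {v y : ℤ × ℤ} {γ : List (ℤ × ℤ)} {m : ℕ}
    (h : PathIn (edgesOf r Λ) v y γ) (hy : y ∈ box r m) : v ∈ box r (m + γ.length + 1) := by
  induction γ generalizing y m with
  | nil => exact (mem_edgesOf.1 h).2.2.mem_box hy
  | cons w γ ih =>
    have := ih h.2 ((mem_edgesOf.1 h.1).2.2.mem_box hy)
    rwa [List.length_cons, ← add_assoc, add_right_comm m]

/-- A fourth root of the rate of decay. -/
noncomputable def rate (a : ℝ) : ℝ := √√(decay a)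

lemma rate_pos (ha : 0 < a) : 0 < rate a := Real.sqrt_pos.2 (Real.sqrt_pos.2 (decay_pos ha))

lemma rate_lt_one (ha : 0 < a) : rate a < 1 := by
  rw [rate, Real.sqrt_lt' one_pos, one_pow, Real.sqrt_lt' one_pos, one_pow]
  exact decay_lt_one ha

lemma rate_sq (a : ℝ) : rate a ^ 2 = √(decay a) := Real.sq_sqrt (Real.sqrt_nonneg _)

lemma rate_pow_four (ha : 0 < a) : rate a ^ 4 = decay a := by
  rw [show 4 = 2 * 2 from rfl, pow_mul, rate_sq, Real.sq_sqrt (decay_pos ha).le]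

theorem tsum_exit_le (hr : 2 ≤ r) (ha : 0 < a) (har : a < ((r : ℝ) - 129) / 256)
    (hP : IsERRW r a P) (n j : ℕ) :
    ∑' v, ∑' t, (if v ∈ box r (n + 1) ∧ v ∉ box r n ∧ (∀ w ∈ t, w ∈ box r n) ∧
        visits (listPath (0, 0) v t) (t.length + 1) (0, 0) = j + 1 then pathProb P v t else 0) ≤
      ENNReal.ofReal (visitConst a j * segConst a j * (4 / (1 - rate a)) * rate a ^ n) := by
  set q := rate a with hq
  have hq0 : 0 < q := rate_pos ha
  have hq1 : 0 < 1 - q := sub_pos.2 (rate_lt_one ha)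
  set C := visitConst a j * segConst a j with hC
  have hC0 : 0 ≤ C := by
    have h1 := Real.Gamma_pos_of_pos (s := 2 * a) (by positivity)
    have h2 := Real.Gamma_pos_of_pos (s := 2 * a + (j + 1 : ℕ)) (by positivity)
    have h3 := Real.Gamma_pos_of_pos (s := a + 1 / 2) (by positivity)
    have h4 := Real.Gamma_pos_of_pos ha
    unfold C visitConst segConst expConst
    positivity
  calc _ ≤ ∑' v, ∑' γ : List (ℤ × ℤ), ENNReal.ofReal (C * q ^ n / q ^ 3) *
        (if NoBackFrom r (0, 0) (γ ++ [v]) then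
          ENNReal.ofReal (q ^ (3 * (γ ++ [v]).length)) else 0) := by
        refine ENNReal.tsum_le_tsum fun v => ?_
        by_cases hv : v ∈ box r (n + 1) ∧ v ∉ box r n
        swap
        · refine le_trans (le_of_eq (ENNReal.tsum_eq_zero.2 fun t => if_neg ?_)) zero_le
          tauto
        simp only [hv.1, hv.2, not_false_eq_true, true_and]
        refine (tsum_pathProb_le ha hP j hv.1 hv.2).trans (ENNReal.tsum_le_tsum fun γ => ?_)
        by_cases hγ : γ.Nodup ∧ (∀ x ∈ γ, x ∈ box r n ∧ x ≠ (0, 0)) ∧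
            PathIn (edgesOf r (box r (n + 1))) v (0, 0) γ
        swap
        · rw [if_neg hγ]; exact zero_le
        have hnd : ((0, 0) :: (γ ++ [v])).Nodup := by
          have h0 : ((0, 0) : ℤ × ℤ) ≠ v := fun h => hv.2 (h ▸ zero_mem_box r n)
          have h1 : v ∉ γ := fun h => hv.2 (hγ.2.1 v h).1
          have h2 : (0, 0) ∉ γ := fun h => (hγ.2.1 _ h).2 rfl
          simp [List.nodup_append, hγ.1, h0, h2]
          exact fun x y hxy h => h1 (h ▸ hxy)
        have hlen : n ≤ γ.length := by
          have h1 := hγ.2.2.mem_box (zero_mem_box r 0)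
          by_contra! h2
          exact hv.2 (box_mono (by omega) h1)
        rw [if_pos hγ, if_pos (hγ.2.2.noBackFrom hnd), ← ENNReal.ofReal_mul (by positivity)]
        refine ENNReal.ofReal_le_ofReal ?_
        rw [List.length_append, List.length_singleton, ← rate_pow_four ha, ← hq]
        calc C * (q ^ 4) ^ γ.length = C * q ^ γ.length * q ^ (3 * γ.length) := by ring
          _ ≤ C * q ^ n * q ^ (3 * γ.length) := by
              gcongr ?_ * _
              exact mul_le_mul_of_nonneg_left
                (pow_le_pow_of_le_one hq0.le (by linarith) hlen) hC0
          _ = _ := by field_simp; ring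
    _ = ENNReal.ofReal (C * q ^ n / q ^ 3) * ∑' p : (ℤ × ℤ) × List (ℤ × ℤ),
        (if NoBackFrom r (0, 0) (p.2 ++ [p.1]) then
          ENNReal.ofReal (q ^ (3 * (p.2 ++ [p.1]).length)) else 0) := by
        simp only [ENNReal.tsum_mul_left]
        congr 1
        exact (ENNReal.tsum_prod (f := fun (v : ℤ × ℤ) (γ : List (ℤ × ℤ)) =>
          if NoBackFrom r (0, 0) (γ ++ [v]) then
            ENNReal.ofReal (q ^ (3 * (γ ++ [v]).length)) else 0)).symm
    _ ≤ ENNReal.ofReal (C * q ^ n / q ^ 3) * ∑' t,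
        (if NoBackFrom r (0, 0) t then ENNReal.ofReal (q ^ (3 * t.length)) else 0) := by
        gcongr
        exact ENNReal.tsum_comp_le_tsum_of_injective
          (f := fun p : (ℤ × ℤ) × List (ℤ × ℤ) => p.2 ++ [p.1])
          (fun p p' h => by
            have := List.append_inj' h rfl
            exact Prod.ext (by simpa using this.2) this.1) _
    _ ≤ ENNReal.ofReal (C * q ^ n / q ^ 3) * ENNReal.ofReal (4 * q ^ 3 / (1 - q)) := by
        gcongr
        exact tsum_noBackFrom_le hr hq0 (by linarith)
          (by rw [rate_sq]; exact sqrt_decay_pow_le ha har) ⟨dvd_zero _, dvd_zero _⟩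
    _ = _ := by
        rw [← ENNReal.ofReal_mul (by positivity)]
        congr 1
        field_simp

end ExitDecay

section Conditional

variable {r : ℕ} {a : ℝ} {P : Measure (ℕ → ℤ × ℤ)}

lemma wt_congr {X X' : ℕ → ℤ × ℤ} {t : ℕ} (h : ∀ s ≤ t, X s = X' s) (x y : ℤ × ℤ) :
    wt a X t x y = wt a X' t x y := by
  rw [wt, wt]
  congr 3
  refine Finset.filter_congr fun s hs => ?_
  have hs' := Finset.mem_range.1 hs
  rw [h s (by omega), h (s + 1) (by omega)]

lemma totWt_congr {X X' : ℕ → ℤ × ℤ} {t : ℕ} (h : ∀ s ≤ t, X s = X' s) :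
    totWt r a X t = totWt r a X' t := by
  simp only [totWt, h t le_rfl, wt_congr h]

lemma wt_pos (ha : 0 < a) (X : ℕ → ℤ × ℤ) (t : ℕ) (x y : ℤ × ℤ) : 0 < wt a X t x y := by
  rw [wt]; positivity

lemma wt_le_totWt (ha : 0 < a) {X : ℕ → ℤ × ℤ} {t : ℕ} {v w : ℤ × ℤ} (hX : X t = v)
    (h : AdjG r v w) : wt a X t v w ≤ totWt r a X t := by
  obtain ⟨d, hd, rfl⟩ := h.exists_unitVec
  subst hX
  refine le_trans (le_of_eq (if_pos h).symm) (Finset.single_le_sum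
    (f := fun d => if AdjG r (X t) (X t + d) then wt a X t (X t) (X t + d) else 0) (fun d _ => ?_) hd)
  split_ifs
  exacts [(wt_pos ha _ _ _ _).le, le_rfl]

/-- The conditional probability of stepping from `v` to `w` at time `k`. -/
noncomputable def stepProb (r : ℕ) (a : ℝ) (v w : ℤ × ℤ) (k : ℕ) (X : ℕ → ℤ × ℤ) : ℝ :=
  if X k = v then wt a X k v w / totWt r a X k else 0

lemma stepProb_congr {v w : ℤ × ℤ} {X X' : ℕ → ℤ × ℤ} {t : ℕ} (h : ∀ s ≤ t, X s = X' s) :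
    stepProb r a v w t X = stepProb r a v w t X' := by
  rw [stepProb, stepProb, h t le_rfl, wt_congr h, totWt_congr h]

lemma stepProb_nonneg (ha : 0 < a) {v w : ℤ × ℤ} (h : AdjG r v w) (k : ℕ) (X : ℕ → ℤ × ℤ) :
    0 ≤ stepProb r a v w k X := by
  rw [stepProb]
  split_ifs with hX
  · exact div_nonneg (wt_pos ha _ _ _ _).le ((wt_pos ha X k v w).le.trans (wt_le_totWt ha hX h))
  · exact le_rfl

lemma stepProb_le_one (ha : 0 < a) {v w : ℤ × ℤ} (h : AdjG r v w) (k : ℕ) (X : ℕ → ℤ × ℤ) :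
    stepProb r a v w k X ≤ 1 := by
  rw [stepProb]
  split_ifs with hX
  · exact div_le_one_of_le₀ (wt_le_totWt ha hX h)
      ((wt_pos ha X k v w).le.trans (wt_le_totWt ha hX h))
  · exact zero_le_one

/-- The filtration of the past of a trajectory. -/
def past : Filtration ℕ (MeasurableSpace.pi : MeasurableSpace (ℕ → ℤ × ℤ)) := Filtration.piLE

/-- The trajectory that follows `y` up to time `k`, and stays at `w` afterwards. -/
def extendPast (k : ℕ) (w : ℤ × ℤ) (y : Set.Iic k → ℤ × ℤ) (s : ℕ) : ℤ × ℤ :=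
  if h : s ≤ k then y ⟨s, h⟩ else w

lemma extendPast_restrict {k s : ℕ} (w : ℤ × ℤ) (X : ℕ → ℤ × ℤ) (hs : s ≤ k) :
    extendPast k w (Preorder.restrictLe k X) s = X s := dif_pos hs

lemma measurable_past {β : Type*} [MeasurableSpace β] {k : ℕ} {f : (ℕ → ℤ × ℤ) → β}
    (hf : ∀ X X' : ℕ → ℤ × ℤ, (∀ s ≤ k, X s = X' s) → f X = f X') : Measurable[past k] f := by
  have h : f = (fun y => f (extendPast k 0 y)) ∘ Preorder.restrictLe k :=
    funext fun X => hf _ _ fun s hs => (extendPast_restrict 0 X hs).symm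
  rw [h]
  exact (Measurable.of_discrete (f := fun y : Set.Iic k → ℤ × ℤ => f (extendPast k 0 y))).comp
    (comap_measurable _)

lemma measure_step_eq (ha : 0 < a) (hP : IsERRW r a P) {v w : ℤ × ℤ} (h : AdjG r v w) (k : ℕ) :
    (P.restrict {X | X k = v ∧ X (k + 1) = w}).map (Preorder.restrictLe k) =
      (P.withDensity fun X => ENNReal.ofReal (stepProb r a v w k X)).map
        (Preorder.restrictLe k) := by
  have hm : Measurable (Preorder.restrictLe (π := fun _ : ℕ => ℤ × ℤ) k) := by fun_prop
  refine Measure.ext_of_singleton fun y => ?_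
  have hy : MeasurableSet (Preorder.restrictLe (π := fun _ : ℕ => ℤ × ℤ) k ⁻¹' {y}) :=
    hm (measurableSet_singleton y)
  rw [Measure.map_apply hm (measurableSet_singleton y),
    Measure.map_apply hm (measurableSet_singleton y), Measure.restrict_apply hy,
    withDensity_apply _ hy]
  set u := extendPast k w y with hu
  have hset : Preorder.restrictLe (π := fun _ : ℕ => ℤ × ℤ) k ⁻¹' {y} = {X | ∀ t ≤ k, X t = u t} := by
    ext X
    constructor
    · rintro rfl t ht
      exact (extendPast_restrict w X ht).symm
    · intro hX
      ext1 ⟨t, ht⟩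
      exact (hX t ht).trans (dif_pos ht)
  rw [setLIntegral_congr_fun hy (g := fun _ => ENNReal.ofReal (stepProb r a v w k u)) (fun X hX => by
    rw [hset] at hX
    dsimp only
    rw [stepProb_congr hX]), setLIntegral_const, hset]
  have huk : u (k + 1) = w := dif_neg (by omega)
  by_cases hv : u k = v
  · have h1 : {X : ℕ → ℤ × ℤ | ∀ t ≤ k, X t = u t} ∩ {X | X k = v ∧ X (k + 1) = w} =
        {X | ∀ t ≤ k + 1, X t = u t} := by
      ext X
      constructor
      · rintro ⟨h1, h2⟩ t ht
        rcases Nat.lt_or_eq_of_le ht with h3 | rfl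
        exacts [h1 t (by omega), h2.2.trans huk.symm]
      · exact fun h1 => ⟨fun t ht => h1 t (by omega), (h1 k (by omega)).trans hv,
          (h1 _ le_rfl).trans huk⟩
    have h2 : (∀ t < k + 1, AdjG r (u t) (u (t + 1))) ↔ ∀ t < k, AdjG r (u t) (u (t + 1)) := by
      rw [Nat.forall_lt_succ_right, and_iff_left_iff_imp]
      intro _
      rwa [huk, hv]
    rw [h1, hP.2, hP.2]
    simp only [h2]
    split_ifs with h3
    · rw [Finset.prod_range_succ, mul_comm (∏ _ ∈ _, _), ENNReal.ofReal_mul]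
      · rw [stepProb, if_pos hv, huk, hv]
      · rw [huk, hv]
        simpa [stepProb, hv] using stepProb_nonneg ha h k u
    · simp
  · have h1 : {X : ℕ → ℤ × ℤ | ∀ t ≤ k, X t = u t} ∩ {X | X k = v ∧ X (k + 1) = w} = ∅ := by
      exact Set.eq_empty_iff_forall_notMem.2 fun X h1 => hv ((h1.1 k le_rfl).symm.trans h1.2.1)
    rw [h1, stepProb, if_neg hv]
    simp

lemma stepProb_ae_eq_condExp (ha : 0 < a) (hP : IsERRW r a P) {v w : ℤ × ℤ} (h : AdjG r v w)
    (k : ℕ) : stepProb r a v w k =ᵐ[P]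
      P[{X | X k = v ∧ X (k + 1) = w}.indicator (1 : (ℕ → ℤ × ℤ) → ℝ) | past k] := by
  have := hP.1
  have hmeas : Measurable[past k] (stepProb r a v w k) :=
    measurable_past fun X X' hX => stepProb_congr hX
  have hmeas' : Measurable (stepProb r a v w k) := hmeas.mono (past.le k) le_rfl
  have hA : MeasurableSet {X : ℕ → ℤ × ℤ | X k = v ∧ X (k + 1) = w} :=
    (measurableSet_eq_fun (measurable_pi_apply k) measurable_const).inter
      (measurableSet_eq_fun (measurable_pi_apply (k + 1)) measurable_const)
  have hfi : Integrable (stepProb r a v w k) P :=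
    Integrable.of_bound hmeas'.aestronglyMeasurable 1 (Filter.Eventually.of_forall fun X => by
      rw [Real.norm_of_nonneg (stepProb_nonneg ha h k X)]
      exact stepProb_le_one ha h k X)
  refine ae_eq_condExp_of_forall_setIntegral_eq (past.le k)
    ((integrable_const (1 : ℝ)).indicator hA) (fun s _ _ => hfi.integrableOn) ?_
    hmeas.aestronglyMeasurable
  rintro s ⟨S, hS, rfl⟩ -
  have hm : Measurable (Preorder.restrictLe (π := fun _ : ℕ => ℤ × ℤ) k) := by fun_prop
  have h1 := congrArg (· S) (measure_step_eq ha hP h k)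
  simp only [Measure.map_apply hm hS, Measure.restrict_apply (hm hS),
    withDensity_apply _ (hm hS)] at h1
  rw [integral_eq_lintegral_of_nonneg_ae
    (Filter.Eventually.of_forall fun X => stepProb_nonneg ha h k X)
    hmeas'.aestronglyMeasurable, ← h1, integral_indicator_one hA, measureReal_def,
    Measure.restrict_apply hA, Set.inter_comm]

lemma ae_infinite_of_tendsto_sum_stepProb (ha : 0 < a) (hP : IsERRW r a P) {v w : ℤ × ℤ} (h : AdjG r v w) :
    ∀ᵐ X ∂P, Filter.Tendsto (fun n => ∑ k ∈ Finset.range n, stepProb r a v w k X)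
      Filter.atTop Filter.atTop → {t : ℕ | X t = w}.Infinite := by
  have := hP.1
  have hs : ∀ n, MeasurableSet[past n]
      (match n with | 0 => ∅ | k + 1 => {X : ℕ → ℤ × ℤ | X k = v ∧ X (k + 1) = w}) := by
    rintro (_ | k)
    · exact @MeasurableSet.empty _ (past 0)
    · refine (@measurableSet_setOfPred _ (past (k + 1)) _).2 (measurable_past fun X X' hX => ?_)
      rw [hX k (by omega), hX (k + 1) le_rfl]
  filter_upwards [ae_mem_limsup_atTop_iff P hs,
    ae_all_iff.2 fun k => stepProb_ae_eq_condExp ha hP h k] with X h1 h2 h3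
  simp only [h2] at h3
  have h4 := Filter.mem_limsup_iff_frequently_mem.1 (h1.2 h3)
  refine Nat.frequently_atTop_iff_infinite.1 (h4.mono fun n hn => ?_)
  rcases n with _ | k
  exacts [hn.elim, hn.2]

end Conditional

section Recurrence

variable {r : ℕ} {a : ℝ} {P : Measure (ℕ → ℤ × ℤ)} {X : ℕ → ℤ × ℤ}

lemma mem_box_of_path (h0 : X 0 = (0, 0)) (hX : ∀ t, AdjG r (X t) (X (t + 1))) (t : ℕ) :
    X t ∈ box r t := by
  induction t with
  | zero => rw [h0]; exact zero_mem_box r 0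
  | succ t ih => exact (hX t).mem_box ih

lemma totWt_le_of_path (ha : 0 < a) (h0 : X 0 = (0, 0)) (hX : ∀ t, AdjG r (X t) (X (t + 1)))
    (t : ℕ) : totWt r a X t ≤ 4 * a + 2 * visits X t (X t) + 1 := by
  have hbox := mem_box_of_path h0 hX
  rw [totWt_eq_sum (hbox t)]
  set E := edgesOf r (box r (t + 1)) with hE
  have h1 : (((E.filter (X t ∈ ·)).length : ℕ) : ℝ) ≤ 4 :=
    mod_cast degree_le_four (box_mono (Nat.le_succ t) (hbox t))
  have h2 := sum_visits_stepEdge (nodup_edgesOf (r := r) (box r (t + 1))) (u := X) (n := t)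
    (fun s hs => mem_edgesOf.2 ⟨box_mono (by omega) (hbox s), box_mono (by omega) (hbox (s + 1)),
      hX s⟩)
    (fun e he => by
      induction e with
      | _ x y => exact fun h => (mem_edgesOf.1 he).2.2.ne (Sym2.mk_isDiag_iff.1 h)) (X t)
  rw [if_pos rfl, ← hE] at h2
  have h3 : ((((E.filter (X t ∈ ·)).map (visits (stepEdge X) t)).sum : ℕ) : ℝ) ≤
      2 * visits X t (X t) + 1 := by
    exact_mod_cast (Nat.le_add_right _ _).trans h2.le
  nlinarith

lemma sum_stepProb_ge (ha : 0 < a) (h0 : X 0 = (0, 0)) (hX : ∀ t, AdjG r (X t) (X (t + 1)))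
    {v w : ℤ × ℤ} (h : AdjG r v w) (n : ℕ) :
    ∑ i ∈ Finset.range (visits X n v), a / (4 * a + 2 * i + 1) ≤
      ∑ k ∈ Finset.range n, stepProb r a v w k X := by
  induction n with
  | zero => simp [visits_zero]
  | succ n ih =>
    rw [visits_succ, Finset.sum_range_succ _ n]
    split_ifs with hv
    · rw [Finset.sum_range_succ, stepProb, if_pos hv]
      have h1 := totWt_le_of_path ha h0 hX n
      rw [hv] at h1
      refine add_le_add ih (div_le_div₀ (wt_pos ha _ _ _ _).le ?_
        ((wt_pos ha _ _ _ _).trans_le (wt_le_totWt ha hv h)) h1)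
      rw [wt]
      exact le_add_of_nonneg_right (Nat.cast_nonneg _)
    · exact (add_zero (visits X n v)).symm ▸ ih.trans
        (le_add_of_nonneg_right (stepProb_nonneg ha h n X))

lemma visits_eq_count {ι : Type*} (c : ℕ → ι) (n : ℕ) (i : ι) :
    visits c n i = Nat.count (fun t => c t = i) n := (Nat.count_eq_card_filter_range _ _).symm

lemma tendsto_visits {ι : Type*} {c : ℕ → ι} {i : ι} (h : {t | c t = i}.Infinite) :
    Filter.Tendsto (fun n => visits c n i) Filter.atTop Filter.atTop := by
  simp only [visits_eq_count]
  exact Filter.tendsto_atTop_atTop_of_monotone (Nat.count_monotone _)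
    fun b => ⟨Nat.nth _ b, (Nat.count_nth_of_infinite h b).ge⟩

lemma visits_le_card {ι : Type*} {c : ℕ → ι} {i : ι} (h : {t | c t = i}.Finite) (n : ℕ) :
    visits c n i ≤ h.toFinset.card :=
  Finset.card_le_card fun s hs => by simpa using (Finset.mem_filter.1 hs).2

lemma tendsto_sum_stepProb (ha : 0 < a) (h0 : X 0 = (0, 0))
    (hX : ∀ t, AdjG r (X t) (X (t + 1))) {v w : ℤ × ℤ} (h : AdjG r v w)
    (hv : {t | X t = v}.Infinite) :
    Filter.Tendsto (fun n => ∑ k ∈ Finset.range n, stepProb r a v w k X)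
      Filter.atTop Filter.atTop := by
  refine Filter.tendsto_atTop_mono (sum_stepProb_ge ha h0 hX h)
    (Filter.Tendsto.comp (g := fun m : ℕ => ∑ i ∈ Finset.range m, a / (4 * a + 2 * (i : ℝ) + 1))
      ?_ (tendsto_visits hv))
  refine Filter.tendsto_atTop_mono (fun m => ?_)
    (Real.tendsto_sum_range_one_div_nat_succ_atTop.const_mul_atTop
      (show 0 < a / (4 * a + 2) by positivity))
  rw [Finset.mul_sum]
  refine Finset.sum_le_sum fun i _ => ?_
  rw [div_mul_div_comm, mul_one]
  refine div_le_div_of_nonneg_left ha.le (by positivity) ?_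
  have : (0 : ℝ) ≤ i := Nat.cast_nonneg i
  nlinarith

lemma ae_path (hP : IsERRW r a P) :
    ∀ᵐ X ∂P, X 0 = (0, 0) ∧ ∀ t, AdjG r (X t) (X (t + 1)) := by
  have h : ∀ k, ∀ᵐ X ∂P, X 0 = (0, 0) ∧ ∀ t < k, AdjG r (X t) (X (t + 1)) := by
    intro k
    refine measure_mono_null (t := ⋃ y : {y : Set.Iic k → ℤ × ℤ // ¬ (extendPast k 0 y 0 = (0, 0) ∧
      ∀ t < k, AdjG r (extendPast k 0 y t) (extendPast k 0 y (t + 1)))},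
        {X | ∀ t ≤ k, X t = extendPast k 0 y.1 t}) ?_ (measure_iUnion_null fun y => ?_)
    · intro X hX
      have h1 : ∀ t ≤ k, X t = extendPast k 0 (Preorder.restrictLe k X) t :=
        fun t ht => (extendPast_restrict 0 X ht).symm
      refine Set.mem_iUnion.2 ⟨⟨Preorder.restrictLe k X, fun h2 => hX ?_⟩, h1⟩
      refine ⟨(h1 0 (Nat.zero_le k)).trans h2.1, fun t ht => ?_⟩
      rw [h1 t ht.le, h1 (t + 1) ht]
      exact h2.2 t ht
    · rw [hP.2, if_neg y.2]
  filter_upwards [ae_all_iff.2 h] with X hX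
  exact ⟨(hX 0).1, fun t => (hX (t + 1)).2 t (Nat.lt_succ_self t)⟩

lemma reflTransGen_horizontal {y : ℤ} (hy : (r : ℤ) ∣ y) (x : ℤ) :
    Relation.ReflTransGen (AdjG r) (0, y) (x, y) := by
  induction x using Int.induction_on with
  | zero => exact .refl
  | succ i ih => exact ih.tail ⟨Or.inr hy, Or.inr hy, by simp⟩
  | pred i ih => exact ih.tail ⟨Or.inr hy, Or.inr hy, by simp⟩

lemma reflTransGen_vertical {x : ℤ} (hx : (r : ℤ) ∣ x) (y : ℤ) :
    Relation.ReflTransGen (AdjG r) (x, 0) (x, y) := by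
  induction y using Int.induction_on with
  | zero => exact .refl
  | succ i ih => exact ih.tail ⟨Or.inl hx, Or.inl hx, by simp⟩
  | pred i ih => exact ih.tail ⟨Or.inl hx, Or.inl hx, by simp⟩

lemma reflTransGen_zero {v : ℤ × ℤ} (hv : v ∈ Vr r) :
    Relation.ReflTransGen (AdjG r) (0, 0) v := by
  obtain ⟨x, y⟩ := v
  rcases hv with h | h
  · exact (reflTransGen_horizontal (dvd_zero _) x).trans (reflTransGen_vertical h y)
  · exact (reflTransGen_vertical (dvd_zero _) y).trans (reflTransGen_horizontal h x)

lemma reflTransGen_of_mem {v w : ℤ × ℤ} (hv : v ∈ Vr r) (hw : w ∈ Vr r) :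
    Relation.ReflTransGen (AdjG r) v w := by
  have : Std.Symm (AdjG r) := ⟨fun _ _ h => h.symm⟩
  exact (Relation.ReflTransGen.stdSymm.symm _ _ (reflTransGen_zero hv)).trans
    (reflTransGen_zero hw)

lemma listPath_map_range (X : ℕ → ℤ × ℤ) {m s : ℕ} (hs : s ≤ m + 1) :
    listPath (X 0) (X (m + 1)) ((List.range m).map fun i => X (i + 1)) s = X s := by
  have h : X 0 :: ((List.range m).map (fun i => X (i + 1)) ++ [X (m + 1)]) =
      (List.range (m + 2)).map X := by
    rw [List.range_succ_eq_map, List.range_succ]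
    simp [Function.comp_def]
  rw [listPath, h, List.getD_eq_getElem _ _ (by simp; omega)]
  simp

lemma visits_congr {ι : Type*} {c c' : ℕ → ι} {n : ℕ} (h : ∀ s < n, c s = c' s) (i : ι) :
    visits c n i = visits c' n i := by
  unfold visits
  congr 1
  exact Finset.filter_congr fun s hs => by rw [h s (Finset.mem_range.1 hs)]

lemma exists_exit_path (h0 : X 0 = (0, 0)) (hX : ∀ t, AdjG r (X t) (X (t + 1))) {n : ℕ}
    (hn : ∃ t, X t ∉ box r n) :
    ∃ v t, (v ∈ box r (n + 1) ∧ v ∉ box r n ∧ (∀ w ∈ t, w ∈ box r n) ∧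
      visits (listPath (0, 0) v t) (t.length + 1) (0, 0) = visits X (t.length + 1) (0, 0)) ∧
      ∀ s ≤ t.length + 1, X s = listPath (0, 0) v t s := by
  obtain ⟨T, hT, hmin⟩ : ∃ T, X T ∉ box r n ∧ ∀ s < T, X s ∈ box r n :=
    ⟨Nat.find hn, Nat.find_spec hn, fun s hs => not_not.1 (Nat.find_min hn hs)⟩
  rcases T with _ | m
  · exact (hT (h0 ▸ zero_mem_box r n)).elim
  have hpath : ∀ s ≤ m + 1,
      X s = listPath (0, 0) (X (m + 1)) ((List.range m).map fun i => X (i + 1)) s :=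
    fun s hs => by rw [← h0]; exact (listPath_map_range X hs).symm
  refine ⟨X (m + 1), (List.range m).map fun i => X (i + 1),
    ⟨(hX m).mem_box (hmin m (Nat.lt_succ_self m)), hT, ?_, ?_⟩, ?_⟩
  · simp only [List.mem_map, List.mem_range]
    rintro _ ⟨i, hi, rfl⟩
    exact hmin _ (by omega)
  · rw [List.length_map, List.length_range]
    exact visits_congr (fun s hs => (hpath s hs.le).symm) _
  · rw [List.length_map, List.length_range]
    exact hpath

lemma measure_escape_eq_zero (hr : 2 ≤ r) (ha : 0 < a) (har : a < ((r : ℝ) - 129) / 256)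
    (hP : IsERRW r a P) (K : ℕ) :
    P {X | (X 0 = (0, 0) ∧ ∀ t, AdjG r (X t) (X (t + 1))) ∧ (∀ n, ∃ t, X t ∉ box r n) ∧
      ∀ n, visits X n (0, 0) ≤ K} = 0 := by
  refine le_antisymm (ge_of_tendsto' (f := fun n : ℕ => ∑ j ∈ Finset.range K,
    ENNReal.ofReal (visitConst a j * segConst a j * (4 / (1 - rate a)) * rate a ^ n))
    (x := Filter.atTop) ?_ fun n => ?_) zero_le
  · rw [← Finset.sum_const_zero (s := Finset.range K)]
    refine tendsto_finsetSum _ fun j _ => ?_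
    rw [← ENNReal.ofReal_zero]
    refine ENNReal.tendsto_ofReal ?_
    simpa using (tendsto_pow_atTop_nhds_zero_of_lt_one (rate_pos ha).le (rate_lt_one ha)).const_mul
      (visitConst a j * segConst a j * (4 / (1 - rate a)))
  · refine le_trans (measure_mono (t := ⋃ j ∈ Finset.range K, ⋃ v, ⋃ t,
      {X | (v ∈ box r (n + 1) ∧ v ∉ box r n ∧ (∀ w ∈ t, w ∈ box r n) ∧
        visits (listPath (0, 0) v t) (t.length + 1) (0, 0) = j + 1) ∧
        ∀ s ≤ t.length + 1, X s = listPath (0, 0) v t s}) ?_) ?_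
    · rintro X ⟨⟨h0, hX⟩, hex, hK⟩
      obtain ⟨v, t, ⟨h1, h2, h3, h4⟩, h5⟩ := exists_exit_path h0 hX (hex n)
      have h6 : 0 < visits X (t.length + 1) (0, 0) :=
        Finset.card_pos.2 ⟨0, by simp [h0]⟩
      have h7 := hK (t.length + 1)
      simp only [Set.mem_iUnion]
      exact ⟨visits X (t.length + 1) (0, 0) - 1, Finset.mem_range.2 (by omega), v, t,
        ⟨h1, h2, h3, by omega⟩, h5⟩
    · refine (measure_biUnion_finset_le _ _).trans (Finset.sum_le_sum fun j _ => ?_)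
      refine le_trans ?_ (tsum_exit_le hr ha har hP n j)
      refine (measure_iUnion_le _).trans (ENNReal.tsum_le_tsum fun v => ?_)
      refine (measure_iUnion_le _).trans (ENNReal.tsum_le_tsum fun t => ?_)
      split_ifs with hc
      · exact measure_mono fun X h => h.2
      · exact (measure_mono_null (fun X h => hc h.1) measure_empty).le

lemma ae_exists_infinite (hr : 2 ≤ r) (ha : 0 < a) (har : a < ((r : ℝ) - 129) / 256)
    (hP : IsERRW r a P) : ∀ᵐ X ∂P, ∃ v ∈ Vr r, {t : ℕ | X t = v}.Infinite := by
  have h1 : ∀ K, ∀ᵐ X ∂P, ¬ ((X 0 = (0, 0) ∧ ∀ t, AdjG r (X t) (X (t + 1))) ∧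
      (∀ n, ∃ t, X t ∉ box r n) ∧ ∀ n, visits X n (0, 0) ≤ K) := fun K => by
    simpa only [ae_iff, not_not] using measure_escape_eq_zero hr ha har hP K
  filter_upwards [ae_path hP, ae_all_iff.2 h1] with X hX h2
  by_contra! hcon
  have hfin : ∀ v ∈ Vr r, {t : ℕ | X t = v}.Finite := hcon
  have h0 := hfin (0, 0) (Or.inl (dvd_zero _))
  refine h2 h0.toFinset.card ⟨hX, fun n => ?_, visits_le_card h0⟩
  by_contra! hn
  obtain ⟨v, hv⟩ := Finite.exists_infinite_fiber (fun t => (⟨X t, hn t⟩ : box r n))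
  refine Set.infinite_coe_iff.1 hv ((hfin v.1 (mem_box.1 v.2).2.2).subset fun t ht => ?_)
  exact congrArg Subtype.val ht

lemma ae_infinite (hr : 2 ≤ r) (ha : 0 < a) (har : a < ((r : ℝ) - 129) / 256)
    (hP : IsERRW r a P) : ∀ᵐ X ∂P, ∀ v ∈ Vr r, {t : ℕ | X t = v}.Infinite := by
  have h1 : ∀ v w, ∀ᵐ X ∂P, AdjG r v w →
      Filter.Tendsto (fun n => ∑ k ∈ Finset.range n, stepProb r a v w k X)
        Filter.atTop Filter.atTop → {t : ℕ | X t = w}.Infinite := fun v w => by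
    by_cases h : AdjG r v w
    · filter_upwards [ae_infinite_of_tendsto_sum_stepProb ha hP h] with X hX _ using hX
    · exact Filter.Eventually.of_forall fun X h' => (h h').elim
  filter_upwards [ae_path hP, ae_exists_infinite hr ha har hP,
    ae_all_iff.2 fun v => ae_all_iff.2 (h1 v)] with X hX ⟨v, hv, hinf⟩ hstep w hw
  have h2 := reflTransGen_of_mem hv hw
  clear hw
  induction h2 with
  | refl => exact hinf
  | tail _ h ih => exact hstep _ _ h (tendsto_sum_stepProb ha hX.1 hX.2 h ih)

end Recurrence

end ERRWZ2

/-- Theorem 1.1 (Recurrence): for `r ≥ 130` and `0 < a < (r-129)/256`, the linearly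
edge-reinforced random walk on `G_r` with constant initial weights `a` started at `0`
visits every vertex infinitely often with probability one. -/
theorem errw_recurrence (r : ℕ) (hr : 130 ≤ r) (a : ℝ) (ha : 0 < a)
    (ha' : a < ((r : ℝ) - 129) / 256) (P : Measure (ℕ → ℤ × ℤ))
    (hP : ERRWZ2.IsERRW r a P) :
    P {X | ∀ v ∈ ERRWZ2.Vr r, {t : ℕ | X t = v}.Infinite} = 1 := by
  have := hP.1
  exact (measure_congr (Filter.eventuallyEq_univ.2 (ERRWZ2.ae_infinite (by omega) ha ha' hP))).trans
    measure_univ
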